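/- arXiv:2209.12470 — 6 statements merged into one kernel-verified Lean document; each statement's English description precedes it below -/
import Mathlib

section
/- For every λ ∈ k, the algebra U_23(λ) is 256-dimensional over k; the images of the monomials p1^i p2^j q1^k q2^l a^e b^f c^g d^h with i, j, k, l, e, f, g, h ∈ {0,1} form a k-basis. -/
namespace Stmt10

/-- The generators `a, b, c, d, p1, p2, q1, q2`. -/
inductive Gen | a | b | c | d | p1 | p2 | q1 | q2

open Gen

variable (k : Type*) [Field k]

/-- The generators viewed inside the free algebra. -/
abbrev g (x : Gen) : FreeAlgebra k Gen := FreeAlgebra.ι k x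

variable (lam : k)

/-- The defining relations of `U_23(λ)`: the `H`-relations together with the listed
relations involving `p1, p2, q1, q2`. -/
inductive Rel : FreeAlgebra k Gen → FreeAlgebra k Gen → Prop
  -- H-relations
  | haa : Rel (g k a * g k a) 1
  | hbb : Rel (g k b * g k b) 1
  | hcc : Rel (g k c * g k c) 1
  | hab : Rel (g k a * g k b) (g k b * g k a)
  | hac : Rel (g k a * g k c) (g k c * g k a)
  | hbc : Rel (g k b * g k c) (g k c * g k b)
  | hdd : Rel (g k d * g k d) (g k a)
  | hda : Rel (g k d * g k a) (g k a * g k d)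
  | hdb : Rel (g k d * g k b) (g k c * g k d)
  | hdc : Rel (g k d * g k c) (g k b * g k d)
  | ap1 : Rel (g k a * g k p1) (g k p1 * g k a)
  | bp1 : Rel (g k b * g k p1) (g k p1 * g k b)
  | cp1 : Rel (g k c * g k p1) (-(g k p1 * g k c))
  | dp1 : Rel (g k d * g k p1) (g k p2 * g k a * g k d)
  | ap2 : Rel (g k a * g k p2) (g k p2 * g k a)
  | bp2 : Rel (g k b * g k p2) (-(g k p2 * g k b))
  | cp2 : Rel (g k c * g k p2) (g k p2 * g k c)
  | dp2 : Rel (g k d * g k p2) (g k p1 * g k a * g k d)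
  | aq1 : Rel (g k a * g k q1) (g k q1 * g k a)
  | bq1 : Rel (g k b * g k q1) (-(g k q1 * g k b))
  | cq1 : Rel (g k c * g k q1) (g k q1 * g k c)
  | dq1 : Rel (g k d * g k q1) (g k q2 * g k a * g k d)
  | aq2 : Rel (g k a * g k q2) (g k q2 * g k a)
  | bq2 : Rel (g k b * g k q2) (g k q2 * g k b)
  | cq2 : Rel (g k c * g k q2) (-(g k q2 * g k c))
  | dq2 : Rel (g k d * g k q2) (g k q1 * g k a * g k d)
  | p1p1 : Rel (g k p1 * g k p1) (0)
  | p2p2 : Rel (g k p2 * g k p2) (0)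
  | p1p2 : Rel (g k p1 * g k p2 - g k p2 * g k p1) (0)
  | q1q1 : Rel (g k q1 * g k q1) (0)
  | q2q2 : Rel (g k q2 * g k q2) (0)
  | q1q2 : Rel (g k q1 * g k q2 - g k q2 * g k q1) (0)
  | p1q1 : Rel (g k p1 * g k q1 - g k q1 * g k p1) (0)
  | p2q2 : Rel (g k p2 * g k q2 - g k q2 * g k p2) (0)
  | p1q2 : Rel (g k p1 * g k q2 + g k q2 * g k p1) (lam • (1 - g k a))
  | p2q1 : Rel (g k p2 * g k q1 + g k q1 * g k p2) (lam • (1 - g k a))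

/-- The algebra `U_23(λ)`. -/
abbrev U := RingQuot (Rel k lam)

/-- The quotient map. -/
noncomputable abbrev mk : FreeAlgebra k Gen →ₐ[k] U k lam :=
  RingQuot.mkAlgHom k (Rel k lam)

/-- The image of the monomial `p1^i p2^j q1^k q2^l a^e b^f c^g d^h` in `U_23(λ)`. -/
noncomputable def mono (e : Gen → Fin 2) : U k lam :=
  mk k lam
    (g k p1 ^ (e p1).val * g k p2 ^ (e p2).val * g k q1 ^ (e q1).val * g k q2 ^ (e q2).val *
      g k a ^ (e a).val * g k b ^ (e b).val * g k c ^ (e c).val * g k d ^ (e d).val)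

section Model

/-- The underlying space of the regular representation: coordinate vectors indexed by the
exponents of `p1, p2, q1, q2, a, b, c, d`, in this order. -/
abbrev Model := Fin 2 → Fin 2 → Fin 2 → Fin 2 → Fin 2 → Fin 2 → Fin 2 → Fin 2 → k

/-- The action of a generator by left multiplication on coordinate vectors. -/
def act : Gen → Model k → Model k
  | .a, v => fun i j r s e f t h => v i j r s (e + 1) f t h
  | .b, v => fun i j r s e f t h => (-1) ^ (j + r).val * v i j r s e (f + 1) t h
  | .c, v => fun i j r s e f t h => (-1) ^ (i + s).val * v i j r s e f (t + 1) h
  | .d, v => fun i j r s e f t h => v j i s r (e + (i + j + r + s) + (h + 1)) t f (h + 1)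
  | .p1, v => fun i j r s e f t h => if i = 1 then v 0 j r s e f t h else 0
  | .p2, v => fun i j r s e f t h => if j = 1 then v i 0 r s e f t h else 0
  | .q1, v => fun i j r s e f t h =>
      (if r = 1 then (-1) ^ j.val * v i j 0 s e f t h else 0) +
        if j = 0 then lam * (v i 1 r s e f t h - v i 1 r s (e + 1) f t h) else 0
  | .q2, v => fun i j r s e f t h =>
      (if s = 1 then (-1) ^ i.val * v i j r 0 e f t h else 0) +
        if i = 0 then lam * (v 1 j r s e f t h - v 1 j r s (e + 1) f t h) else 0

/-- `act` as a linear endomorphism. -/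
def actEnd (x : Gen) : Module.End k (Model k) where
  toFun := act k lam x
  map_add' v w := by
    cases x <;> ext <;> simp only [act, Pi.add_apply] <;> (try split_ifs) <;> ring
  map_smul' m v := by
    cases x <;> ext <;> simp only [act, Pi.smul_apply, smul_eq_mul, RingHom.id_apply] <;>
      (try split_ifs) <;> ring

theorem add_one_add_one (e : Fin 2) : e + 1 + 1 = e := by
  revert e; decide

set_option maxHeartbeats 4000000 in
set_option linter.unusedSimpArgs false in
theorem actEnd_rel {x y : FreeAlgebra k Gen} (h : Rel k lam x y) :
    FreeAlgebra.lift k (actEnd k lam) x = FreeAlgebra.lift k (actEnd k lam) y := by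
  cases h <;>
  · simp only [g, map_mul, map_sub, map_add, map_neg, map_smul, map_one, map_zero,
      FreeAlgebra.lift_ι_apply]
    refine LinearMap.ext fun v => ?_
    ext i j r s e f t h
    simp only [actEnd, Module.End.mul_apply, LinearMap.coe_mk, AddHom.coe_mk, act,
      LinearMap.sub_apply, LinearMap.add_apply, LinearMap.neg_apply, LinearMap.smul_apply,
      Module.End.one_apply, LinearMap.zero_apply, Pi.add_apply, Pi.sub_apply, Pi.neg_apply,
      Pi.smul_apply, Pi.zero_apply, smul_eq_mul, add_one_add_one]
    all_goals
      revert i j r s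
      simp [Fin.forall_fin_two, add_one_add_one, add_comm, add_left_comm]
    all_goals
      revert h
      simp [Fin.forall_fin_two, add_one_add_one, add_comm, add_left_comm]
    all_goals
      (repeat' apply And.intro) <;> ring

/-- The regular representation of `U_23(λ)` in coordinates. -/
noncomputable def rep : U k lam →ₐ[k] Module.End k (Model k) :=
  RingQuot.liftAlgHom k ⟨FreeAlgebra.lift k (actEnd k lam), fun _ _ h => actEnd_rel k lam h⟩

/-- The standard basis vectors of `Model`. -/
def delta (i j r s e f t h : Fin 2) : Model k := fun i' j' r' s' e' f' t' h' =>
  if i' = i ∧ j' = j ∧ r' = r ∧ s' = s ∧ e' = e ∧ f' = f ∧ t' = t ∧ h' = h then 1 else 0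

theorem add_one_eq_zero_iff (e : Fin 2) : e + 1 = 0 ↔ e = 1 := by
  revert e; decide

theorem actEnd_d_pow (h : Fin 2) :
    (actEnd k lam .d ^ h.val) (delta k 0 0 0 0 0 0 0 0) = delta k 0 0 0 0 0 0 0 h := by
  match h with
  | 0 => rfl
  | 1 =>
    ext i j r s e f t h
    simp only [Fin.val_one, pow_one, actEnd, LinearMap.coe_mk, AddHom.coe_mk, act, delta]
    refine if_congr ?_ rfl rfl
    rw [add_one_eq_zero_iff]
    constructor
    · rintro ⟨rfl, rfl, rfl, rfl, he, rfl, rfl, rfl⟩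
      simpa using he
    · rintro ⟨rfl, rfl, rfl, rfl, rfl, rfl, rfl, rfl⟩
      simp

theorem actEnd_c_pow (t h : Fin 2) :
    (actEnd k lam .c ^ t.val) (delta k 0 0 0 0 0 0 0 h) = delta k 0 0 0 0 0 0 t h := by
  match t with
  | 0 => rfl
  | 1 =>
    ext i j r s e f t h
    simp [actEnd, act, delta, add_one_eq_zero_iff]
    revert i s
    simp [Fin.forall_fin_two]

theorem actEnd_b_pow (f t h : Fin 2) :
    (actEnd k lam .b ^ f.val) (delta k 0 0 0 0 0 0 t h) = delta k 0 0 0 0 0 f t h := by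
  match f with
  | 0 => rfl
  | 1 =>
    ext i j r s e f t h
    simp [actEnd, act, delta, add_one_eq_zero_iff]
    revert j r
    simp [Fin.forall_fin_two]

theorem actEnd_a_pow (e f t h : Fin 2) :
    (actEnd k lam .a ^ e.val) (delta k 0 0 0 0 0 f t h) = delta k 0 0 0 0 e f t h := by
  match e with
  | 0 => rfl
  | 1 =>
    ext i j r s e f t h
    simp [actEnd, act, delta, add_one_eq_zero_iff]

theorem actEnd_q2_pow (s e f t h : Fin 2) :
    (actEnd k lam .q2 ^ s.val) (delta k 0 0 0 0 e f t h) = delta k 0 0 0 s e f t h := by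
  match s with
  | 0 => rfl
  | 1 =>
    ext i j r s e f t h
    simp [actEnd, act, delta]
    revert i s
    simp [Fin.forall_fin_two]

theorem actEnd_q1_pow (r s e f t h : Fin 2) :
    (actEnd k lam .q1 ^ r.val) (delta k 0 0 0 s e f t h) = delta k 0 0 r s e f t h := by
  match r with
  | 0 => rfl
  | 1 =>
    ext i j r s e f t h
    simp [actEnd, act, delta]
    revert j r
    simp [Fin.forall_fin_two]

theorem actEnd_p2_pow (j r s e f t h : Fin 2) :
    (actEnd k lam .p2 ^ j.val) (delta k 0 0 r s e f t h) = delta k 0 j r s e f t h := by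
  match j with
  | 0 => rfl
  | 1 =>
    ext i j r s e f t h
    simp [actEnd, act, delta]
    grind

theorem actEnd_p1_pow (i j r s e f t h : Fin 2) :
    (actEnd k lam .p1 ^ i.val) (delta k 0 j r s e f t h) = delta k i j r s e f t h := by
  match i with
  | 0 => rfl
  | 1 =>
    ext i j r s e f t h
    simp [actEnd, act, delta]
    grind

theorem rep_mono (x : Gen → Fin 2) :
    rep k lam (mono k lam x) (delta k 0 0 0 0 0 0 0 0) =
      delta k (x p1) (x p2) (x q1) (x q2) (x a) (x b) (x c) (x d) := by
  simp only [rep, mono, mk, RingQuot.liftAlgHom_mkAlgHom_apply, g, map_mul, map_pow,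
    FreeAlgebra.lift_ι_apply, Module.End.mul_apply, actEnd_d_pow, actEnd_c_pow, actEnd_b_pow,
    actEnd_a_pow, actEnd_q2_pow, actEnd_q1_pow, actEnd_p2_pow, actEnd_p1_pow]

/-- Evaluation of the `x`-th coordinate of the action on the first basis vector. -/
noncomputable def coord (x : Gen → Fin 2) : Module.Dual k (U k lam) where
  toFun u := rep k lam u (delta k 0 0 0 0 0 0 0 0) (x p1) (x p2) (x q1) (x q2) (x a) (x b) (x c)
    (x d)
  map_add' u v := by simp
  map_smul' m u := by simp

theorem linearIndependent_mono : LinearIndependent k (mono k lam) := by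
  refine LinearIndependent.of_pairwise_dual_eq_zero_one (mono k lam) (coord k lam) ?_ ?_
  · intro x y hxy
    simp only [coord, LinearMap.coe_mk, AddHom.coe_mk, rep_mono, delta]
    refine if_neg fun h => hxy ?_
    funext z
    cases z <;> simp only [h]
  · intro x
    simp [coord, rep_mono, delta]

end Model

section Spanning

theorem mk_rel {x y : FreeAlgebra k Gen} (h : Rel k lam x y) : mk k lam x = mk k lam y :=
  RingQuot.mkAlgHom_rel k h

variable {k lam} in
theorem rule {x y : Gen} {z : FreeAlgebra k Gen} (h : Rel k lam (g k x * g k y) z) :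
    mk k lam (g k x) * mk k lam (g k y) = mk k lam z := by
  rw [← map_mul, mk_rel k lam h]

theorem assoc_rule {R : Type*} [Semigroup R] {x y z : R} (h : x * y = z) (w : R) :
    x * (y * w) = z * w := by
  rw [← mul_assoc, h]

variable {k lam} in
theorem neg_rule {x y : Gen} (h : Rel k lam (g k x * g k y) (-(g k y * g k x))) :
    mk k lam (g k x) * mk k lam (g k y) = (-1 : k) • (mk k lam (g k y) * mk k lam (g k x)) := by
  rw [rule h, ← neg_one_smul k, map_smul, map_mul]

variable {k lam} in
theorem anticomm_rule {x y : Gen}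
    (h : Rel k lam (g k x * g k y + g k y * g k x) (lam • (1 - g k a))) :
    mk k lam (g k y) * mk k lam (g k x) =
      lam • 1 + (-lam) • mk k lam (g k a) + (-1 : k) • (mk k lam (g k x) * mk k lam (g k y)) := by
  have hz : lam • (1 - g k a) = lam • 1 + (-lam) • g k a := by module
  have h := mk_rel k lam h
  rw [hz, map_add, map_add, map_smul, map_smul, map_mul, map_mul, map_one] at h
  rw [← h]
  module

/-- The part `p1^i p2^j q1^r q2^s` of a monomial. -/
noncomputable def pq (i j r s : Fin 2) : U k lam :=
  mk k lam (g k p1) ^ i.val * mk k lam (g k p2) ^ j.val * mk k lam (g k q1) ^ r.val *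
    mk k lam (g k q2) ^ s.val

/-- The part `a^e b^f c^t d^h` of a monomial. -/
noncomputable def hw (e f t h : Fin 2) : U k lam :=
  mk k lam (g k a) ^ e.val * mk k lam (g k b) ^ f.val * mk k lam (g k c) ^ t.val *
    mk k lam (g k d) ^ h.val

theorem pq_mul_hw_mem {i j r s e f t h : Fin 2} :
    pq k lam i j r s * hw k lam e f t h ∈ Submodule.span k (Set.range (mono k lam)) := by
  refine Submodule.subset_span
    ⟨fun | .p1 => i | .p2 => j | .q1 => r | .q2 => s | .a => e | .b => f | .c => t | .d => h, ?_⟩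
  simp only [mono, pq, hw, map_mul, map_pow, mul_assoc]

theorem b_mul_a : mk k lam (g k b) * mk k lam (g k a) =
    mk k lam (g k a) * mk k lam (g k b) := by
  rw [rule .hab, map_mul]

theorem c_mul_a : mk k lam (g k c) * mk k lam (g k a) =
    mk k lam (g k a) * mk k lam (g k c) := by
  rw [rule .hac, map_mul]

theorem c_mul_b : mk k lam (g k c) * mk k lam (g k b) =
    mk k lam (g k b) * mk k lam (g k c) := by
  rw [rule .hbc, map_mul]

theorem p2_mul_p1 : mk k lam (g k p2) * mk k lam (g k p1) =
    mk k lam (g k p1) * mk k lam (g k p2) := by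
  have h := mk_rel k lam .p1p2
  rw [map_sub, map_zero, sub_eq_zero, map_mul, map_mul] at h
  exact h.symm

theorem q2_mul_q1 : mk k lam (g k q2) * mk k lam (g k q1) =
    mk k lam (g k q1) * mk k lam (g k q2) := by
  have h := mk_rel k lam .q1q2
  rw [map_sub, map_zero, sub_eq_zero, map_mul, map_mul] at h
  exact h.symm

theorem q1_mul_p1 : mk k lam (g k q1) * mk k lam (g k p1) =
    mk k lam (g k p1) * mk k lam (g k q1) := by
  have h := mk_rel k lam .p1q1
  rw [map_sub, map_zero, sub_eq_zero, map_mul, map_mul] at h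
  exact h.symm

theorem q2_mul_p2 : mk k lam (g k q2) * mk k lam (g k p2) =
    mk k lam (g k p2) * mk k lam (g k q2) := by
  have h := mk_rel k lam .p2q2
  rw [map_sub, map_zero, sub_eq_zero, map_mul, map_mul] at h
  exact h.symm

theorem a_mul_hw (e f t h : Fin 2) :
    mk k lam (g k a) * hw k lam e f t h = hw k lam (e + 1) f t h := by
  simp only [hw, mul_assoc]
  revert e
  simp [Fin.forall_fin_two, assoc_rule (rule .haa)]

theorem b_mul_hw (e f t h : Fin 2) :
    mk k lam (g k b) * hw k lam e f t h = hw k lam e (f + 1) t h := by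
  simp only [hw, mul_assoc]
  revert e f
  simp [Fin.forall_fin_two, assoc_rule (b_mul_a k lam), mul_assoc, assoc_rule (rule .hbb)]

theorem c_mul_hw (e f t h : Fin 2) :
    mk k lam (g k c) * hw k lam e f t h = hw k lam e f (t + 1) h := by
  simp only [hw, mul_assoc]
  revert e f t
  simp [Fin.forall_fin_two, assoc_rule (c_mul_a k lam), assoc_rule (c_mul_b k lam), mul_assoc,
    assoc_rule (rule .hcc)]

theorem d_mul_hw (e f t h : Fin 2) :
    mk k lam (g k d) * hw k lam e f t h = hw k lam (e + h) t f (h + 1) := by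
  simp only [hw, mul_assoc]
  revert e f t h
  simp [Fin.forall_fin_two, mul_assoc, rule .haa, rule .hda, rule .hdb, rule .hdc, rule .hdd,
    assoc_rule (rule .haa), assoc_rule (rule .hda), assoc_rule (rule .hdb), assoc_rule (rule .hdc),
    b_mul_a, c_mul_a, c_mul_b, assoc_rule (c_mul_a k lam), assoc_rule (c_mul_b k lam)]

theorem a_mul_pq (i j r s : Fin 2) :
    mk k lam (g k a) * pq k lam i j r s = pq k lam i j r s * mk k lam (g k a) := by
  simp only [pq, mul_assoc]
  revert i j r s
  simp [Fin.forall_fin_two, mul_assoc, rule .ap1, rule .ap2, rule .aq1, rule .aq2,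
    assoc_rule (rule .ap1), assoc_rule (rule .ap2), assoc_rule (rule .aq1)]

theorem b_mul_pq (i j r s : Fin 2) :
    mk k lam (g k b) * pq k lam i j r s =
      (-1 : k) ^ (j + r).val • (pq k lam i j r s * mk k lam (g k b)) := by
  simp only [pq, mul_assoc]
  revert i j r s
  simp [Fin.forall_fin_two, mul_assoc, smul_smul, rule .bp1, neg_rule .bp2, neg_rule .bq1,
    rule .bq2, assoc_rule (rule .bp1), assoc_rule (neg_rule .bp2), assoc_rule (neg_rule .bq1)]

theorem c_mul_pq (i j r s : Fin 2) :
    mk k lam (g k c) * pq k lam i j r s =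
      (-1 : k) ^ (i + s).val • (pq k lam i j r s * mk k lam (g k c)) := by
  simp only [pq, mul_assoc]
  revert i j r s
  simp [Fin.forall_fin_two, mul_assoc, smul_smul, neg_rule .cp1, rule .cp2, rule .cq1,
    neg_rule .cq2, assoc_rule (neg_rule .cp1), assoc_rule (rule .cp2), assoc_rule (rule .cq1)]

theorem d_mul_pq (i j r s : Fin 2) :
    mk k lam (g k d) * pq k lam i j r s =
      pq k lam j i s r * (mk k lam (g k a) ^ (i + j + r + s).val * mk k lam (g k d)) := by
  simp only [pq, mul_assoc]
  revert i j r s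
  simp [Fin.forall_fin_two, mul_assoc, assoc_rule (rule .ap1), assoc_rule (rule .aq1),
    assoc_rule (rule .aq2), rule .dp1, rule .dp2, rule .dq1, rule .dq2, assoc_rule (rule .dp1),
    assoc_rule (rule .dp2), assoc_rule (rule .dq1), assoc_rule (rule .haa),
    assoc_rule (p2_mul_p1 k lam), assoc_rule (q2_mul_q1 k lam)]

theorem p1_mul_pq (i j r s : Fin 2) :
    mk k lam (g k p1) * pq k lam i j r s = if i = 0 then pq k lam 1 j r s else 0 := by
  simp only [pq, mul_assoc]
  revert i
  simp [Fin.forall_fin_two, assoc_rule (rule .p1p1)]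

theorem p2_mul_pq (i j r s : Fin 2) :
    mk k lam (g k p2) * pq k lam i j r s = if j = 0 then pq k lam i 1 r s else 0 := by
  simp only [pq, mul_assoc]
  revert i j
  simp [Fin.forall_fin_two, mul_assoc, assoc_rule (rule .p2p2), assoc_rule (p2_mul_p1 k lam)]

theorem q1_mul_pq (i j r s : Fin 2) :
    mk k lam (g k q1) * pq k lam i j r s =
      (if j = 1 then pq k lam i 0 r s * (lam • 1 + (-lam) • mk k lam (g k a)) else 0) +
        if r = 0 then (-1 : k) ^ j.val • pq k lam i j 1 s else 0 := by
  simp only [pq, mul_assoc]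
  revert i j r s
  simp [Fin.forall_fin_two, mul_assoc, add_mul, mul_add, assoc_rule (rule .q1q1), rule .q1q1,
    q1_mul_p1, anticomm_rule .p2q1, assoc_rule (q1_mul_p1 k lam), assoc_rule (anticomm_rule .p2q1),
    rule .aq1, rule .aq2, assoc_rule (rule .aq1)]

theorem q2_mul_pq (i j r s : Fin 2) :
    mk k lam (g k q2) * pq k lam i j r s =
      (if i = 1 then pq k lam 0 j r s * (lam • 1 + (-lam) • mk k lam (g k a)) else 0) +
        if s = 0 then (-1 : k) ^ i.val • pq k lam i j r 1 else 0 := by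
  simp only [pq, mul_assoc]
  revert i j r s
  simp [Fin.forall_fin_two, mul_assoc, add_mul, mul_add, rule .q2q2, anticomm_rule .p1q2,
    q2_mul_p2, q2_mul_q1, assoc_rule (anticomm_rule .p1q2), assoc_rule (q2_mul_p2 k lam),
    assoc_rule (q2_mul_q1 k lam), rule .ap2, rule .aq1, rule .aq2, assoc_rule (rule .ap2),
    assoc_rule (rule .aq1)]

theorem gen_mul_mem (x : Gen) {u : U k lam} (hu : u ∈ Submodule.span k (Set.range (mono k lam))) :
    mk k lam (g k x) * u ∈ Submodule.span k (Set.range (mono k lam)) := by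
  induction hu using Submodule.span_induction with
  | zero => simp
  | add v w _ _ hv hw => rw [mul_add]; exact add_mem hv hw
  | smul m v _ hv => rw [mul_smul_comm]; exact Submodule.smul_mem _ m hv
  | mem v hv =>
    obtain ⟨y, rfl⟩ := hv
    have hy : mono k lam y = pq k lam (y p1) (y p2) (y q1) (y q2) *
        hw k lam (y a) (y b) (y c) (y d) := by
      simp only [mono, pq, hw, map_mul, map_pow, mul_assoc]
    rw [hy, ← mul_assoc]
    have ha (e f t h n : Fin 2) : mk k lam (g k a) ^ n.val * hw k lam e f t h =
        hw k lam (e + n) f t h := by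
      match n with
      | 0 => simp
      | 1 => simp [a_mul_hw]
    cases x
    · rw [a_mul_pq, mul_assoc, a_mul_hw]
      exact pq_mul_hw_mem k lam
    · rw [b_mul_pq, smul_mul_assoc, mul_assoc, b_mul_hw]
      exact Submodule.smul_mem _ _ (pq_mul_hw_mem k lam)
    · rw [c_mul_pq, smul_mul_assoc, mul_assoc, c_mul_hw]
      exact Submodule.smul_mem _ _ (pq_mul_hw_mem k lam)
    · rw [d_mul_pq, mul_assoc, mul_assoc, d_mul_hw, ha]
      exact pq_mul_hw_mem k lam
    · rw [p1_mul_pq, ite_mul, zero_mul]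
      split_ifs
      exacts [pq_mul_hw_mem k lam, zero_mem _]
    · rw [p2_mul_pq, ite_mul, zero_mul]
      split_ifs
      exacts [pq_mul_hw_mem k lam, zero_mem _]
    all_goals
      simp only [q1_mul_pq, q2_mul_pq, add_mul, ite_mul, zero_mul, smul_mul_assoc, mul_assoc,
        one_mul, a_mul_hw, mul_add, mul_smul_comm]
      refine add_mem ?_ ?_ <;> split_ifs
      exacts [add_mem (Submodule.smul_mem _ _ (pq_mul_hw_mem k lam))
        (Submodule.smul_mem _ _ (pq_mul_hw_mem k lam)), zero_mem _,
        Submodule.smul_mem _ _ (pq_mul_hw_mem k lam), zero_mem _]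

theorem span_range_mono : Submodule.span k (Set.range (mono k lam)) = ⊤ := by
  refine Submodule.eq_top_iff'.2 fun u => ?_
  obtain ⟨z, rfl⟩ := RingQuot.mkAlgHom_surjective k (Rel k lam) u
  suffices h : ∀ u ∈ Submodule.span k (Set.range (mono k lam)),
      mk k lam z * u ∈ Submodule.span k (Set.range (mono k lam)) by
    simpa [pq, hw] using h _ (pq_mul_hw_mem k lam (i := 0) (j := 0) (r := 0) (s := 0)
      (e := 0) (f := 0) (t := 0) (h := 0))
  induction z using FreeAlgebra.induction with
  | grade0 m =>
    intro u hu
    rw [AlgHom.commutes, ← Algebra.smul_def]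
    exact Submodule.smul_mem _ m hu
  | grade1 x => exact fun u hu => gen_mul_mem k lam x hu
  | mul y z hy hz =>
    intro u hu
    rw [map_mul, mul_assoc]
    exact hy _ (hz _ hu)
  | add y z hy hz =>
    intro u hu
    rw [map_add, add_mul]
    exact add_mem (hy _ hu) (hz _ hu)

end Spanning

instance : Fintype Gen where
  elems := ⟨([.a, .b, .c, .d, .p1, .p2, .q1, .q2] : List Gen), by simp⟩
  complete x := by cases x <;> simp [← Finset.mem_val]

theorem thm [IsAlgClosed k] [CharZero k] (lam : k) :
    Module.finrank k (U k lam) = 256 ∧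
    LinearIndependent k (mono k lam) ∧
    Submodule.span k (Set.range (mono k lam)) = ⊤ := by
  refine ⟨?_, linearIndependent_mono k lam, span_range_mono k lam⟩
  have h := Module.finrank_eq_nat_card_basis
    (Module.Basis.mk (linearIndependent_mono k lam) (span_range_mono k lam).ge)
  rw [h, Nat.card_fun, Nat.card_eq_fintype_card, Nat.card_eq_fintype_card]
  rfl

end Stmt10
end

section
/- For every λ ∈ k, the algebra U_29(λ) is 256-dimensional over k; the images of the monomials p1^i p2^j q1^k q2^l a^e b^f c^g d^h with i, j, k, l, e, f, g, h ∈ {0,1} form a k-basis. -/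
namespace Stmt11

/-- The generators `a, b, c, d, p1, p2, q1, q2`. -/
inductive Gen | a | b | c | d | p1 | p2 | q1 | q2

open Gen

variable (k : Type*) [Field k]

/-- The generators viewed inside the free algebra. -/
abbrev g (x : Gen) : FreeAlgebra k Gen := FreeAlgebra.ι k x

variable (lam : k)

/-- The defining relations of `U_29(λ)`: the `H`-relations together with the listed
relations involving `p1, p2, q1, q2`. -/
inductive Rel : FreeAlgebra k Gen → FreeAlgebra k Gen → Prop
  -- H-relations
  | haa : Rel (g k a * g k a) 1
  | hbb : Rel (g k b * g k b) 1
  | hcc : Rel (g k c * g k c) 1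
  | hab : Rel (g k a * g k b) (g k b * g k a)
  | hac : Rel (g k a * g k c) (g k c * g k a)
  | hbc : Rel (g k b * g k c) (g k c * g k b)
  | hdd : Rel (g k d * g k d) (g k a)
  | hda : Rel (g k d * g k a) (g k a * g k d)
  | hdb : Rel (g k d * g k b) (g k c * g k d)
  | hdc : Rel (g k d * g k c) (g k b * g k d)
  | ap1 : Rel (g k a * g k p1) (-(g k p1 * g k a))
  | bp1 : Rel (g k b * g k p1) (g k p1 * g k b)
  | cp1 : Rel (g k c * g k p1) (g k p1 * g k c)
  | dp1 : Rel (g k d * g k p1) (g k p2 * g k d)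
  | ap2 : Rel (g k a * g k p2) (-(g k p2 * g k a))
  | bp2 : Rel (g k b * g k p2) (g k p2 * g k b)
  | cp2 : Rel (g k c * g k p2) (g k p2 * g k c)
  | dp2 : Rel (g k d * g k p2) (-(g k p1 * g k d))
  | aq1 : Rel (g k a * g k q1) (-(g k q1 * g k a))
  | bq1 : Rel (g k b * g k q1) (g k q1 * g k b)
  | cq1 : Rel (g k c * g k q1) (g k q1 * g k c)
  | dq1 : Rel (g k d * g k q1) (g k q2 * g k d)
  | aq2 : Rel (g k a * g k q2) (-(g k q2 * g k a))
  | bq2 : Rel (g k b * g k q2) (g k q2 * g k b)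
  | cq2 : Rel (g k c * g k q2) (g k q2 * g k c)
  | dq2 : Rel (g k d * g k q2) (-(g k q1 * g k d))
  | p1p1 : Rel (g k p1 * g k p1) (0)
  | p2p2 : Rel (g k p2 * g k p2) (0)
  | p1p2 : Rel (g k p1 * g k p2 + g k p2 * g k p1) (0)
  | q1q1 : Rel (g k q1 * g k q1) (0)
  | q2q2 : Rel (g k q2 * g k q2) (0)
  | q1q2 : Rel (g k q1 * g k q2 + g k q2 * g k q1) (0)
  | p1q1 : Rel (g k p1 * g k q1 + g k q1 * g k p1) (0)
  | p2q2 : Rel (g k p2 * g k q2 + g k q2 * g k p2) (0)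
  | p1q2 : Rel (g k p1 * g k q2 + g k q2 * g k p1) (lam • (1 - g k b * g k c))
  | p2q1 : Rel (g k p2 * g k q1 + g k q1 * g k p2) (-(lam • (1 - g k b * g k c)))

/-- The algebra `U_29(λ)`. -/
abbrev U := RingQuot (Rel k lam)

/-- The quotient map. -/
noncomputable abbrev mk : FreeAlgebra k Gen →ₐ[k] U k lam :=
  RingQuot.mkAlgHom k (Rel k lam)

/-- The image of the monomial `p1^i p2^j q1^k q2^l a^e b^f c^g d^h` in `U_29(λ)`. -/
noncomputable def mono (e : Gen → Fin 2) : U k lam :=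
  mk k lam
    (g k p1 ^ (e p1).val * g k p2 ^ (e p2).val * g k q1 ^ (e q1).val * g k q2 ^ (e q2).val *
      g k a ^ (e a).val * g k b ^ (e b).val * g k c ^ (e c).val * g k d ^ (e d).val)

section Representation

/-- The coefficient space of the subalgebra generated by `a, b, c, d`, indexed by the exponents of
`a^e b^f c^g d^h`. -/
abbrev HCoeff := Fin 2 → Fin 2 → Fin 2 → Fin 2 → k

/-- The coefficient space of `U_29(λ)`, indexed by the exponents of `p1^i p2^j q1^k q2^l` and then
by those of `a^e b^f c^g d^h`. -/
abbrev Coeff := Fin 2 → Fin 2 → Fin 2 → Fin 2 → HCoeff k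

/-- Left multiplication by a generator, in terms of coefficients. -/
def actFun : Gen → Coeff k → Coeff k
  | a, v => fun i j m l e f g h =>
      (-1) ^ (i.val + j.val + m.val + l.val) * v i j m l (e + 1) f g h
  | b, v => fun i j m l e f g h => v i j m l e (f + 1) g h
  | c, v => fun i j m l e f g h => v i j m l e f (g + 1) h
  | d, v => fun i j m l e f g h =>
      (-1) ^ (i.val + m.val + i.val * j.val + m.val * l.val) *
        v j i l m (e + h + 1) g f (h + 1)
  | p1, v => fun i j m l e f g h => if i = 1 then v 0 j m l e f g h else 0
  | p2, v => fun i j m l e f g h =>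
      if j = 1 then (-1) ^ i.val * v i 0 m l e f g h else 0
  | q1, v => fun i j m l e f g h =>
      (if m = 1 then (-1) ^ (i.val + j.val) * v i j 0 l e f g h else 0) -
        (if j = 0 then
          (-1) ^ i.val * (lam * (v i 1 m l e f g h - v i 1 m l e (f + 1) (g + 1) h)) else 0)
  | q2, v => fun i j m l e f g h =>
      (if l = 1 then (-1) ^ (i.val + j.val + m.val) * v i j m 0 e f g h else 0) +
        (if i = 0 then lam * (v 1 j m l e f g h - v 1 j m l e (f + 1) (g + 1) h) else 0)

/-- Left multiplication by a generator, as a linear operator on coefficients. -/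
def act (x : Gen) : Module.End k (Coeff k) where
  toFun := actFun k lam x
  map_add' v w := by
    funext i j m l e f g h
    cases x <;> simp only [actFun, Pi.add_apply] <;> (try split_ifs) <;> ring
  map_smul' r v := by
    funext i j m l e f g h
    cases x <;> simp only [actFun, Pi.smul_apply, smul_eq_mul, RingHom.id_apply] <;>
      (try split_ifs) <;> ring

lemma act_apply (x : Gen) (v : Coeff k) : act k lam x v = actFun k lam x v := rfl

lemma fin_two_cases (x : Fin 2) : x = 0 ∨ x = 1 := by omega

lemma fin_two_add_one_add_one (x : Fin 2) : x + 1 + 1 = x := by revert x; decide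

lemma fin_two_zero_eq_add_one (x : Fin 2) : 0 = x + 1 ↔ 1 = x := by revert x; decide

lemma fin_two_add_shift (x y : Fin 2) : x + y + (y + 1) = x + 1 := by
  revert x y; decide

lemma fin_two_add_one_add_add_one (x y : Fin 2) : x + 1 + y + 1 = x + y := by
  revert x y; decide

set_option maxHeartbeats 4000000 in
lemma lift_act_rel {x y : FreeAlgebra k Gen} (hxy : Rel k lam x y) :
    FreeAlgebra.lift k (act k lam) x = FreeAlgebra.lift k (act k lam) y := by
  refine LinearMap.ext fun v => ?_
  have key : ∀ i j m l e f g h,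
      FreeAlgebra.lift k (act k lam) x v i j m l e f g h =
        FreeAlgebra.lift k (act k lam) y v i j m l e f g h := by
    intro i j m l e f g' h
    cases hxy <;>
      simp only [map_mul, map_add, map_sub, map_neg, map_smul, map_one, map_zero, g,
        FreeAlgebra.lift_ι_apply, Module.End.mul_apply, Module.End.one_apply, LinearMap.add_apply,
        LinearMap.sub_apply, LinearMap.neg_apply, LinearMap.smul_apply, LinearMap.zero_apply,
        act_apply, actFun, Pi.add_apply, Pi.sub_apply, Pi.neg_apply, Pi.smul_apply, Pi.zero_apply,
        smul_eq_mul, fin_two_add_one_add_one, fin_two_add_shift, fin_two_add_one_add_add_one] <;>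
      rcases fin_two_cases i with rfl | rfl <;> rcases fin_two_cases j with rfl | rfl <;>
      rcases fin_two_cases m with rfl | rfl <;> rcases fin_two_cases l with rfl | rfl <;>
      simp [-mul_eq_mul_left_iff] <;> ring
  funext i j m l e f g h
  exact key i j m l e f g h

/-- The representation of `U_29(λ)` on coefficients. -/
noncomputable def rep : U k lam →ₐ[k] Module.End k (Coeff k) :=
  RingQuot.liftAlgHom k ⟨FreeAlgebra.lift k (act k lam), fun _ _ h => lift_act_rel k lam h⟩

/-- The coefficients of the monomial `p1^i p2^j q1^m q2^l a^e b^f c^g d^h`. -/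
def monoCoeff (i j m l e f g h : Fin 2) : Coeff k := fun i' j' m' l' e' f' g' h' =>
  if i = i' ∧ j = j' ∧ m = m' ∧ l = l' ∧ e = e' ∧ f = f' ∧ g = g' ∧ h = h' then 1 else 0

lemma rep_mk (x : FreeAlgebra k Gen) :
    rep k lam (mk k lam x) = FreeAlgebra.lift k (act k lam) x := by
  simp [rep, mk]

lemma act_p1_pow_monoCoeff (i j m l e f g h : Fin 2) :
    (act k lam p1 ^ i.val) (monoCoeff k 0 j m l e f g h) =
      monoCoeff k i j m l e f g h := by
  rcases fin_two_cases i with rfl | rfl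
  · simp
  funext i' j' m' l' e' f' g' h'
  rcases fin_two_cases i' with rfl | rfl <;> rcases fin_two_cases j' with rfl | rfl <;>
    rcases fin_two_cases m' with rfl | rfl <;> rcases fin_two_cases l' with rfl | rfl <;>
    simp [act_apply, actFun, monoCoeff]

lemma act_p2_pow_monoCoeff (j m l e f g h : Fin 2) :
    (act k lam p2 ^ j.val) (monoCoeff k 0 0 m l e f g h) =
      monoCoeff k 0 j m l e f g h := by
  rcases fin_two_cases j with rfl | rfl
  · simp
  funext i' j' m' l' e' f' g' h'
  rcases fin_two_cases i' with rfl | rfl <;> rcases fin_two_cases j' with rfl | rfl <;>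
    rcases fin_two_cases m' with rfl | rfl <;> rcases fin_two_cases l' with rfl | rfl <;>
    simp [act_apply, actFun, monoCoeff]

lemma act_q1_pow_monoCoeff (m l e f g h : Fin 2) :
    (act k lam q1 ^ m.val) (monoCoeff k 0 0 0 l e f g h) =
      monoCoeff k 0 0 m l e f g h := by
  rcases fin_two_cases m with rfl | rfl
  · simp
  funext i' j' m' l' e' f' g' h'
  rcases fin_two_cases i' with rfl | rfl <;> rcases fin_two_cases j' with rfl | rfl <;>
    rcases fin_two_cases m' with rfl | rfl <;> rcases fin_two_cases l' with rfl | rfl <;>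
    simp [act_apply, actFun, monoCoeff]

lemma act_q2_pow_monoCoeff (l e f g h : Fin 2) :
    (act k lam q2 ^ l.val) (monoCoeff k 0 0 0 0 e f g h) =
      monoCoeff k 0 0 0 l e f g h := by
  rcases fin_two_cases l with rfl | rfl
  · simp
  funext i' j' m' l' e' f' g' h'
  rcases fin_two_cases i' with rfl | rfl <;> rcases fin_two_cases j' with rfl | rfl <;>
    rcases fin_two_cases m' with rfl | rfl <;> rcases fin_two_cases l' with rfl | rfl <;>
    simp [act_apply, actFun, monoCoeff]

lemma act_a_pow_monoCoeff (e f g h : Fin 2) :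
    (act k lam a ^ e.val) (monoCoeff k 0 0 0 0 0 f g h) =
      monoCoeff k 0 0 0 0 e f g h := by
  rcases fin_two_cases e with rfl | rfl
  · simp
  funext i' j' m' l' e' f' g' h'
  rcases fin_two_cases i' with rfl | rfl <;> rcases fin_two_cases j' with rfl | rfl <;>
    rcases fin_two_cases m' with rfl | rfl <;> rcases fin_two_cases l' with rfl | rfl <;>
    simp [act_apply, actFun, monoCoeff, fin_two_zero_eq_add_one]

lemma act_b_pow_monoCoeff (f g h : Fin 2) :
    (act k lam b ^ f.val) (monoCoeff k 0 0 0 0 0 0 g h) =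
      monoCoeff k 0 0 0 0 0 f g h := by
  rcases fin_two_cases f with rfl | rfl
  · simp
  funext i' j' m' l' e' f' g' h'
  rcases fin_two_cases i' with rfl | rfl <;> rcases fin_two_cases j' with rfl | rfl <;>
    rcases fin_two_cases m' with rfl | rfl <;> rcases fin_two_cases l' with rfl | rfl <;>
    simp [act_apply, actFun, monoCoeff, fin_two_zero_eq_add_one]

lemma act_c_pow_monoCoeff (g h : Fin 2) :
    (act k lam c ^ g.val) (monoCoeff k 0 0 0 0 0 0 0 h) =
      monoCoeff k 0 0 0 0 0 0 g h := by
  rcases fin_two_cases g with rfl | rfl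
  · simp
  funext i' j' m' l' e' f' g' h'
  rcases fin_two_cases i' with rfl | rfl <;> rcases fin_two_cases j' with rfl | rfl <;>
    rcases fin_two_cases m' with rfl | rfl <;> rcases fin_two_cases l' with rfl | rfl <;>
    simp [act_apply, actFun, monoCoeff, fin_two_zero_eq_add_one]

lemma act_d_pow_monoCoeff (h : Fin 2) :
    (act k lam d ^ h.val) (monoCoeff k 0 0 0 0 0 0 0 0) =
      monoCoeff k 0 0 0 0 0 0 0 h := by
  rcases fin_two_cases h with rfl | rfl
  · simp
  funext i' j' m' l' e' f' g' h'
  rcases fin_two_cases i' with rfl | rfl <;> rcases fin_two_cases j' with rfl | rfl <;>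
    rcases fin_two_cases m' with rfl | rfl <;> rcases fin_two_cases l' with rfl | rfl <;>
    simp [act_apply, actFun, monoCoeff, fin_two_zero_eq_add_one] <;>
    rcases fin_two_cases e' with rfl | rfl <;> rcases fin_two_cases h' with rfl | rfl <;>
    simp [and_comm]

lemma rep_mono_one (n : Gen → Fin 2) :
    rep k lam (mono k lam n) (monoCoeff k 0 0 0 0 0 0 0 0) =
      monoCoeff k (n p1) (n p2) (n q1) (n q2) (n a) (n b) (n c) (n d) := by
  rw [mono, rep_mk]
  simp only [map_mul, map_pow, g, FreeAlgebra.lift_ι_apply, Module.End.mul_apply,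
    act_p1_pow_monoCoeff, act_p2_pow_monoCoeff, act_q1_pow_monoCoeff, act_q2_pow_monoCoeff,
    act_a_pow_monoCoeff, act_b_pow_monoCoeff, act_c_pow_monoCoeff, act_d_pow_monoCoeff]

lemma linearIndependent_mono : LinearIndependent k (mono k lam) := by
  classical
  rw [linearIndependent_iff']
  intro s r hr n hn
  have h := congrArg (fun x => rep k lam x (monoCoeff k 0 0 0 0 0 0 0 0)
    (n p1) (n p2) (n q1) (n q2) (n a) (n b) (n c) (n d)) hr
  simp only [map_sum, map_smul, LinearMap.sum_apply, LinearMap.smul_apply, rep_mono_one,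
    monoCoeff,
    Finset.sum_apply, Pi.smul_apply, map_zero, LinearMap.zero_apply, Pi.zero_apply] at h
  rw [Finset.sum_eq_single n] at h
  · simpa using h
  · intro n' _ hne
    rw [if_neg, smul_zero]
    rintro ⟨h1, h2, h3, h4, h5, h6, h7, h8⟩
    exact hne (funext fun x => by cases x <;> assumption)
  · exact fun h' => absurd hn h'

end Representation

section Spanning

lemma mul_mem_span_of_forall {A : Type*} [Ring A] [Algebra k A] {S : Set A} {x : A}
    (h : ∀ t ∈ S, x * t ∈ Submodule.span k S) {t : A} (ht : t ∈ Submodule.span k S) :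
    x * t ∈ Submodule.span k S := by
  have : Submodule.span k S ≤ (Submodule.span k S).comap (LinearMap.mulLeft k x) :=
    Submodule.span_le.2 h
  exact this ht

variable {k} {A : Type*} [Ring A] [Algebra k A] (φ : FreeAlgebra k Gen →ₐ[k] A)

/-- The image of a generator. -/
def u (x : Gen) : A := φ (g k x)

variable {lam : k}

lemma u_mul_u_eq (hφ : ∀ ⦃x y⦄, Rel k lam x y → φ x = φ y)
    {x y : Gen} {r : FreeAlgebra k Gen} (h : Rel k lam (g k x * g k y) r) :
    ∀ t : A, u φ x * (u φ y * t) = φ r * t := by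
  intro t
  rw [← hφ h, map_mul, mul_assoc]; rfl

lemma u_mul_u_add_eq (hφ : ∀ ⦃x y⦄, Rel k lam x y → φ x = φ y)
    {x y : Gen} {r : FreeAlgebra k Gen}
    (h : Rel k lam (g k x * g k y + g k y * g k x) r) :
    ∀ t : A, u φ y * (u φ x * t) =
      φ r * t - u φ x * (u φ y * t) := by
  intro t
  rw [eq_sub_iff_add_eq', ← hφ h]
  simp only [map_add, map_mul, mul_assoc, add_mul]; rfl

/-- The monomials `a^e b^f c^g d^h`. -/
def hmono (e f g h : Fin 2) : A :=
  u φ a ^ e.val * (u φ b ^ f.val * (u φ c ^ g.val * u φ d ^ h.val))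

/-- The span of the monomials `a^e b^f c^g d^h`. -/
def hspan : Submodule k A :=
  Submodule.span k {t | ∃ e f g h, t = hmono φ e f g h}

lemma hrel (hφ : ∀ ⦃x y⦄, Rel k lam x y → φ x = φ y) (t : A) :
    u φ a * (u φ a * t) = t ∧ u φ b * (u φ b * t) = t ∧
    u φ c * (u φ c * t) = t ∧
    u φ b * (u φ a * t) = u φ a * (u φ b * t) ∧
    u φ c * (u φ a * t) = u φ a * (u φ c * t) ∧
    u φ c * (u φ b * t) = u φ b * (u φ c * t) ∧
    u φ d * (u φ d * t) = u φ a * t ∧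
    u φ d * (u φ a * t) = u φ a * (u φ d * t) ∧
    u φ d * (u φ b * t) = u φ c * (u φ d * t) ∧
    u φ d * (u φ c * t) = u φ b * (u φ d * t) := by
  have h1 := u_mul_u_eq φ hφ .haa t
  have h2 := u_mul_u_eq φ hφ .hbb t
  have h3 := u_mul_u_eq φ hφ .hcc t
  have h4 := u_mul_u_eq φ hφ .hab t
  have h5 := u_mul_u_eq φ hφ .hac t
  have h6 := u_mul_u_eq φ hφ .hbc t
  have h7 := u_mul_u_eq φ hφ .hdd t
  have h8 := u_mul_u_eq φ hφ .hda t
  have h9 := u_mul_u_eq φ hφ .hdb t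
  have h10 := u_mul_u_eq φ hφ .hdc t
  simp only [map_one, map_mul, one_mul, mul_assoc] at h1 h2 h3 h4 h5 h6 h7 h8 h9 h10
  exact ⟨h1, h2, h3, h4.symm, h5.symm, h6.symm, h7, h8, h9, h10⟩

lemma mul_mem_hspan (hφ : ∀ ⦃x y⦄, Rel k lam x y → φ x = φ y)
    {x : Gen} (hx : x = a ∨ x = b ∨ x = c ∨ x = d) {t : A}
    (ht : t ∈ hspan φ) : u φ x * t ∈ hspan φ := by
  refine mul_mem_span_of_forall k ?_ ht
  rintro _ ⟨e, f, g, h, rfl⟩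
  apply Submodule.subset_span
  have hr := hrel φ hφ
  have hr1 := hrel φ hφ 1
  simp only [mul_one] at hr1
  have key : ∃ e' f' g' h', u φ x * hmono φ e f g h = hmono φ e' f' g' h' := by
    rcases hx with rfl | rfl | rfl | rfl
    · exact ⟨e + 1, f, g, h, by
        rcases fin_two_cases e with rfl | rfl <;> simp [hmono, hr]⟩
    · exact ⟨e, f + 1, g, h, by
        rcases fin_two_cases e with rfl | rfl <;> rcases fin_two_cases f with rfl | rfl <;>
          simp [hmono, hr]⟩
    · exact ⟨e, f, g + 1, h, by
        rcases fin_two_cases e with rfl | rfl <;> rcases fin_two_cases f with rfl | rfl <;>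
          rcases fin_two_cases g with rfl | rfl <;> simp [hmono, hr]⟩
    · exact ⟨e + h, g, f, h + 1, by
        rcases fin_two_cases e with rfl | rfl <;> rcases fin_two_cases f with rfl | rfl <;>
          rcases fin_two_cases g with rfl | rfl <;> rcases fin_two_cases h with rfl | rfl <;>
          simp [hmono, hr, hr1]⟩
  exact key

lemma pqrel (hφ : ∀ ⦃x y⦄, Rel k lam x y → φ x = φ y) (t : A) :
    u φ a * (u φ p1 * t) = -(u φ p1 * (u φ a * t)) ∧
    u φ b * (u φ p1 * t) = u φ p1 * (u φ b * t) ∧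
    u φ c * (u φ p1 * t) = u φ p1 * (u φ c * t) ∧
    u φ d * (u φ p1 * t) = u φ p2 * (u φ d * t) ∧
    u φ p1 * (u φ p1 * t) = 0 ∧
    u φ a * (u φ p2 * t) = -(u φ p2 * (u φ a * t)) ∧
    u φ b * (u φ p2 * t) = u φ p2 * (u φ b * t) ∧
    u φ c * (u φ p2 * t) = u φ p2 * (u φ c * t) ∧
    u φ d * (u φ p2 * t) = -(u φ p1 * (u φ d * t)) ∧
    u φ p2 * (u φ p2 * t) = 0 ∧
    u φ a * (u φ q1 * t) = -(u φ q1 * (u φ a * t)) ∧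
    u φ b * (u φ q1 * t) = u φ q1 * (u φ b * t) ∧
    u φ c * (u φ q1 * t) = u φ q1 * (u φ c * t) ∧
    u φ d * (u φ q1 * t) = u φ q2 * (u φ d * t) ∧
    u φ q1 * (u φ q1 * t) = 0 ∧
    u φ a * (u φ q2 * t) = -(u φ q2 * (u φ a * t)) ∧
    u φ b * (u φ q2 * t) = u φ q2 * (u φ b * t) ∧
    u φ c * (u φ q2 * t) = u φ q2 * (u φ c * t) ∧
    u φ d * (u φ q2 * t) = -(u φ q1 * (u φ d * t)) ∧
    u φ q2 * (u φ q2 * t) = 0 ∧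
    u φ p2 * (u φ p1 * t) = -(u φ p1 * (u φ p2 * t)) ∧
    u φ q2 * (u φ q1 * t) = -(u φ q1 * (u φ q2 * t)) ∧
    u φ q1 * (u φ p1 * t) = -(u φ p1 * (u φ q1 * t)) ∧
    u φ q2 * (u φ p2 * t) = -(u φ p2 * (u φ q2 * t)) ∧
    u φ q2 * (u φ p1 * t) = lam • (t - u φ b * (u φ c * t)) - u φ p1 * (u φ q2 * t) ∧
    u φ q1 * (u φ p2 * t) = -(lam • (t - u φ b * (u φ c * t))) - u φ p2 * (u φ q1 * t) := by
  have hbc : φ (lam • (1 - g k b * g k c)) * t =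
      lam • (t - u φ b * (u φ c * t)) := by
    simp only [map_smul, map_sub, map_mul, map_one, smul_mul_assoc, sub_mul, one_mul, mul_assoc]
    rfl
  refine ⟨?_, ?_, ?_, ?_, ?_, ?_, ?_, ?_, ?_, ?_, ?_, ?_, ?_, ?_, ?_, ?_, ?_, ?_, ?_, ?_, ?_, ?_, ?_, ?_, ?_,
    ?_⟩
  · have h := u_mul_u_eq φ hφ .ap1 t
    simpa only [u, map_neg, map_mul, map_zero, neg_mul, zero_mul, mul_assoc] using h
  · have h := u_mul_u_eq φ hφ .bp1 t
    simpa only [u, map_neg, map_mul, map_zero, neg_mul, zero_mul, mul_assoc] using h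
  · have h := u_mul_u_eq φ hφ .cp1 t
    simpa only [u, map_neg, map_mul, map_zero, neg_mul, zero_mul, mul_assoc] using h
  · have h := u_mul_u_eq φ hφ .dp1 t
    simpa only [u, map_neg, map_mul, map_zero, neg_mul, zero_mul, mul_assoc] using h
  · have h := u_mul_u_eq φ hφ .p1p1 t
    simpa only [u, map_neg, map_mul, map_zero, neg_mul, zero_mul, mul_assoc] using h
  · have h := u_mul_u_eq φ hφ .ap2 t
    simpa only [u, map_neg, map_mul, map_zero, neg_mul, zero_mul, mul_assoc] using h
  · have h := u_mul_u_eq φ hφ .bp2 t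
    simpa only [u, map_neg, map_mul, map_zero, neg_mul, zero_mul, mul_assoc] using h
  · have h := u_mul_u_eq φ hφ .cp2 t
    simpa only [u, map_neg, map_mul, map_zero, neg_mul, zero_mul, mul_assoc] using h
  · have h := u_mul_u_eq φ hφ .dp2 t
    simpa only [u, map_neg, map_mul, map_zero, neg_mul, zero_mul, mul_assoc] using h
  · have h := u_mul_u_eq φ hφ .p2p2 t
    simpa only [u, map_neg, map_mul, map_zero, neg_mul, zero_mul, mul_assoc] using h
  · have h := u_mul_u_eq φ hφ .aq1 t
    simpa only [u, map_neg, map_mul, map_zero, neg_mul, zero_mul, mul_assoc] using h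
  · have h := u_mul_u_eq φ hφ .bq1 t
    simpa only [u, map_neg, map_mul, map_zero, neg_mul, zero_mul, mul_assoc] using h
  · have h := u_mul_u_eq φ hφ .cq1 t
    simpa only [u, map_neg, map_mul, map_zero, neg_mul, zero_mul, mul_assoc] using h
  · have h := u_mul_u_eq φ hφ .dq1 t
    simpa only [u, map_neg, map_mul, map_zero, neg_mul, zero_mul, mul_assoc] using h
  · have h := u_mul_u_eq φ hφ .q1q1 t
    simpa only [u, map_neg, map_mul, map_zero, neg_mul, zero_mul, mul_assoc] using h
  · have h := u_mul_u_eq φ hφ .aq2 t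
    simpa only [u, map_neg, map_mul, map_zero, neg_mul, zero_mul, mul_assoc] using h
  · have h := u_mul_u_eq φ hφ .bq2 t
    simpa only [u, map_neg, map_mul, map_zero, neg_mul, zero_mul, mul_assoc] using h
  · have h := u_mul_u_eq φ hφ .cq2 t
    simpa only [u, map_neg, map_mul, map_zero, neg_mul, zero_mul, mul_assoc] using h
  · have h := u_mul_u_eq φ hφ .dq2 t
    simpa only [u, map_neg, map_mul, map_zero, neg_mul, zero_mul, mul_assoc] using h
  · have h := u_mul_u_eq φ hφ .q2q2 t
    simpa only [u, map_neg, map_mul, map_zero, neg_mul, zero_mul, mul_assoc] using h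
  · have h := u_mul_u_add_eq φ hφ .p1p2 t
    simpa only [map_neg, neg_mul, hbc, map_zero, zero_mul, zero_sub] using h
  · have h := u_mul_u_add_eq φ hφ .q1q2 t
    simpa only [map_neg, neg_mul, hbc, map_zero, zero_mul, zero_sub] using h
  · have h := u_mul_u_add_eq φ hφ .p1q1 t
    simpa only [map_neg, neg_mul, hbc, map_zero, zero_mul, zero_sub] using h
  · have h := u_mul_u_add_eq φ hφ .p2q2 t
    simpa only [map_neg, neg_mul, hbc, map_zero, zero_mul, zero_sub] using h
  · have h := u_mul_u_add_eq φ hφ .p1q2 t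
    simpa only [map_neg, neg_mul, hbc, map_zero, zero_mul, zero_sub] using h
  · have h := u_mul_u_add_eq φ hφ .p2q1 t
    simpa only [map_neg, neg_mul, hbc, map_zero, zero_mul, zero_sub] using h

/-- The product of `p1^i p2^j q1^m q2^l` with `w`. -/
def pqmul (i j m l : Fin 2) (w : A) : A :=
  u φ p1 ^ i.val * (u φ p2 ^ j.val * (u φ q1 ^ m.val * (u φ q2 ^ l.val * w)))

/-- The span of the products of `p1^i p2^j q1^m q2^l` with elements of `hspan`. -/
def pqspan : Submodule k A :=
  Submodule.span k {t | ∃ i j m l, ∃ w ∈ hspan φ, t = pqmul φ i j m l w}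

set_option maxHeartbeats 2000000 in
lemma mul_mem_pqspan (hφ : ∀ ⦃x y⦄, Rel k lam x y → φ x = φ y)
    (x : Gen) {t : A} (ht : t ∈ pqspan φ) :
    u φ x * t ∈ pqspan φ := by
  refine mul_mem_span_of_forall k ?_ ht
  rintro _ ⟨i, j, m, l, w, hw, rfl⟩
  change _ ∈ pqspan φ
  have mem (i j m l : Fin 2) {w : A} (hw : w ∈ hspan φ) :
      pqmul φ i j m l w ∈ pqspan φ := Submodule.subset_span ⟨i, j, m, l, w, hw, rfl⟩
  have ha : u φ a * w ∈ hspan φ := mul_mem_hspan φ hφ (by simp) hw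
  have hb : u φ b * w ∈ hspan φ := mul_mem_hspan φ hφ (by simp) hw
  have hc : u φ c * w ∈ hspan φ := mul_mem_hspan φ hφ (by simp) hw
  have hd : u φ d * w ∈ hspan φ := mul_mem_hspan φ hφ (by simp) hw
  have hbc : u φ b * (u φ c * w) ∈ hspan φ := mul_mem_hspan φ hφ (by simp) hc
  have m0000 {w : A} (hw : w ∈ hspan φ) :
      w ∈ pqspan φ := by
    simpa [pqmul] using mem 0 0 0 0 hw
  have m0001 {w : A} (hw : w ∈ hspan φ) :
      u φ q2 * w ∈ pqspan φ := by
    simpa [pqmul] using mem 0 0 0 1 hw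
  have m0010 {w : A} (hw : w ∈ hspan φ) :
      u φ q1 * w ∈ pqspan φ := by
    simpa [pqmul] using mem 0 0 1 0 hw
  have m0011 {w : A} (hw : w ∈ hspan φ) :
      u φ q1 * (u φ q2 * w) ∈ pqspan φ := by
    simpa [pqmul] using mem 0 0 1 1 hw
  have m0100 {w : A} (hw : w ∈ hspan φ) :
      u φ p2 * w ∈ pqspan φ := by
    simpa [pqmul] using mem 0 1 0 0 hw
  have m0101 {w : A} (hw : w ∈ hspan φ) :
      u φ p2 * (u φ q2 * w) ∈ pqspan φ := by
    simpa [pqmul] using mem 0 1 0 1 hw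
  have m0110 {w : A} (hw : w ∈ hspan φ) :
      u φ p2 * (u φ q1 * w) ∈ pqspan φ := by
    simpa [pqmul] using mem 0 1 1 0 hw
  have m0111 {w : A} (hw : w ∈ hspan φ) :
      u φ p2 * (u φ q1 * (u φ q2 * w)) ∈ pqspan φ := by
    simpa [pqmul] using mem 0 1 1 1 hw
  have m1000 {w : A} (hw : w ∈ hspan φ) :
      u φ p1 * w ∈ pqspan φ := by
    simpa [pqmul] using mem 1 0 0 0 hw
  have m1001 {w : A} (hw : w ∈ hspan φ) :
      u φ p1 * (u φ q2 * w) ∈ pqspan φ := by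
    simpa [pqmul] using mem 1 0 0 1 hw
  have m1010 {w : A} (hw : w ∈ hspan φ) :
      u φ p1 * (u φ q1 * w) ∈ pqspan φ := by
    simpa [pqmul] using mem 1 0 1 0 hw
  have m1011 {w : A} (hw : w ∈ hspan φ) :
      u φ p1 * (u φ q1 * (u φ q2 * w)) ∈ pqspan φ := by
    simpa [pqmul] using mem 1 0 1 1 hw
  have m1100 {w : A} (hw : w ∈ hspan φ) :
      u φ p1 * (u φ p2 * w) ∈ pqspan φ := by
    simpa [pqmul] using mem 1 1 0 0 hw
  have m1101 {w : A} (hw : w ∈ hspan φ) :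
      u φ p1 * (u φ p2 * (u φ q2 * w)) ∈ pqspan φ := by
    simpa [pqmul] using mem 1 1 0 1 hw
  have m1110 {w : A} (hw : w ∈ hspan φ) :
      u φ p1 * (u φ p2 * (u φ q1 * w)) ∈ pqspan φ := by
    simpa [pqmul] using mem 1 1 1 0 hw
  have m1111 {w : A} (hw : w ∈ hspan φ) :
      u φ p1 * (u φ p2 * (u φ q1 * (u φ q2 * w))) ∈ pqspan φ := by
    simpa [pqmul] using mem 1 1 1 1 hw
  have hr := pqrel φ hφ
  rcases fin_two_cases i with rfl | rfl <;> rcases fin_two_cases j with rfl | rfl <;>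
    rcases fin_two_cases m with rfl | rfl <;> rcases fin_two_cases l with rfl | rfl <;>
    cases x <;>
    simp only [pqmul, Fin.val_zero, Fin.val_one, pow_zero, pow_one, one_mul, hr, mul_neg, neg_neg,
      mul_sub, mul_smul_comm, mul_zero, neg_zero, sub_zero] <;>
    repeat' first
      | assumption
      | apply zero_mem
      | apply neg_mem
      | apply sub_mem
      | apply Submodule.smul_mem
      | apply m1111
      | apply m1110
      | apply m1101
      | apply m1100
      | apply m1011
      | apply m1010
      | apply m1001
      | apply m1000
      | apply m0111
      | apply m0110
      | apply m0101
      | apply m0100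
      | apply m0011
      | apply m0010
      | apply m0001
      | apply m0000

lemma pqspan_eq_top (hφ : ∀ ⦃x y⦄, Rel k lam x y → φ x = φ y)
    (hsurj : Function.Surjective φ) : pqspan φ = ⊤ := by
  have hclosed (x : FreeAlgebra k Gen) :
      ∀ t ∈ pqspan φ, φ x * t ∈ pqspan φ := by
    induction x using FreeAlgebra.induction with
    | grade0 r =>
      intro t ht
      rw [AlgHom.commutes, ← Algebra.smul_def]
      exact Submodule.smul_mem _ _ ht
    | grade1 x => exact fun t ht => mul_mem_pqspan φ hφ x ht
    | mul x y hx hy =>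
      intro t ht
      rw [map_mul, mul_assoc]
      exact hx _ (hy _ ht)
    | add x y hx hy =>
      intro t ht
      rw [map_add, add_mul]
      exact add_mem (hx _ ht) (hy _ ht)
  have hone : (1 : A) ∈ pqspan φ :=
    Submodule.subset_span ⟨0, 0, 0, 0, 1,
      Submodule.subset_span ⟨0, 0, 0, 0, by simp [hmono]⟩, by simp [pqmul]⟩
  refine Submodule.eq_top_iff'.2 fun t => ?_
  obtain ⟨x, rfl⟩ := hsurj t
  simpa using hclosed x 1 hone

lemma span_range_eq_top (hφ : ∀ ⦃x y⦄, Rel k lam x y → φ x = φ y)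
    (hsurj : Function.Surjective φ) :
    Submodule.span k (Set.range fun n : Gen → Fin 2 => pqmul φ (n p1) (n p2) (n q1) (n q2)
      (hmono φ (n a) (n b) (n c) (n d))) = ⊤ := by
  rw [eq_top_iff, ← pqspan_eq_top φ hφ hsurj, pqspan, Submodule.span_le]
  rintro _ ⟨i, j, m, l, w, hw, rfl⟩
  rw [SetLike.mem_coe]
  induction hw using Submodule.span_induction with
  | mem w hw =>
    obtain ⟨e, f, g', h, rfl⟩ := hw
    let n : Gen → Fin 2
      | p1 => i | p2 => j | q1 => m | q2 => l | a => e | b => f | c => g' | d => h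
    exact Submodule.subset_span ⟨n, rfl⟩
  | zero => simp [pqmul]
  | add x y _ _ hx hy =>
    simp only [pqmul, mul_add] at hx hy ⊢
    exact add_mem hx hy
  | smul r x _ hx =>
    simp only [pqmul, mul_smul_comm] at hx ⊢
    exact Submodule.smul_mem _ r hx

end Spanning

lemma span_range_mono : Submodule.span k (Set.range (mono k lam)) = ⊤ := by
  rw [← span_range_eq_top (mk k lam) (fun _ _ h => RingQuot.mkAlgHom_rel k h)
    (RingQuot.mkAlgHom_surjective k (Rel k lam))]
  congr 2
  funext n
  simp only [mono, pqmul, hmono, u, map_mul, map_pow, mul_assoc]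

/-- Enumeration of the generators. -/
def genEquiv : Fin 8 ≃ Gen where
  toFun := ![a, b, c, d, p1, p2, q1, q2]
  invFun
    | a => 0 | b => 1 | c => 2 | d => 3 | p1 => 4 | p2 => 5 | q1 => 6 | q2 => 7
  left_inv i := by fin_cases i <;> rfl
  right_inv x := by cases x <;> rfl

theorem thm [IsAlgClosed k] [CharZero k] (lam : k) :
    Module.finrank k (U k lam) = 256 ∧
    LinearIndependent k (mono k lam) ∧
    Submodule.span k (Set.range (mono k lam)) = ⊤ := by
  refine ⟨?_, linearIndependent_mono k lam, span_range_mono k lam⟩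
  have : Finite Gen := Finite.of_equiv _ genEquiv
  rw [Module.finrank_eq_nat_card_basis
    (Module.Basis.mk (linearIndependent_mono k lam) (span_range_mono k lam).ge),
    Nat.card_fun, ← Nat.card_congr genEquiv]
  simp

end Stmt11
end

section
/- For all λ, μ, α ∈ k, the algebra U_38(λ,μ,α) is 256-dimensional over k; the images of the monomials p1^i p2^j q1^k q2^l a^e b^f c^g d^h with i, j, k, l, e, f, g, h ∈ {0,1} form a k-basis. -/
namespace Stmt12

/-- The generators `a, b, c, d, p1, p2, q1, q2`. -/
inductive Gen | a | b | c | d | p1 | p2 | q1 | q2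

open Gen

variable (k : Type*) [Field k]

/-- The generators viewed inside the free algebra. -/
abbrev g (x : Gen) : FreeAlgebra k Gen := FreeAlgebra.ι k x

variable (lam mu alp : k)

/-- The defining relations of `U_38(λ,μ,α)`: the `H`-relations together with the listed
relations involving `p1, p2, q1, q2`. -/
inductive Rel : FreeAlgebra k Gen → FreeAlgebra k Gen → Prop
  -- H-relations
  | haa : Rel (g k a * g k a) 1
  | hbb : Rel (g k b * g k b) 1
  | hcc : Rel (g k c * g k c) 1
  | hab : Rel (g k a * g k b) (g k b * g k a)
  | hac : Rel (g k a * g k c) (g k c * g k a)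
  | hbc : Rel (g k b * g k c) (g k c * g k b)
  | hdd : Rel (g k d * g k d) (g k a)
  | hda : Rel (g k d * g k a) (g k a * g k d)
  | hdb : Rel (g k d * g k b) (g k c * g k d)
  | hdc : Rel (g k d * g k c) (g k b * g k d)
  | ap1 : Rel (g k a * g k p1) (g k p1 * g k a)
  | bp1 : Rel (g k b * g k p1) (-(g k p1 * g k b))
  | cp1 : Rel (g k c * g k p1) (-(g k p1 * g k c))
  | dp1 : Rel (g k d * g k p1) (g k p1 * g k d)
  | ap2 : Rel (g k a * g k p2) (g k p2 * g k a)
  | bp2 : Rel (g k b * g k p2) (g k p2 * g k b)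
  | cp2 : Rel (g k c * g k p2) (g k p2 * g k c)
  | dp2 : Rel (g k d * g k p2) (-(g k p2 * g k d))
  | aq1 : Rel (g k a * g k q1) (g k q1 * g k a)
  | bq1 : Rel (g k b * g k q1) (-(g k q1 * g k b))
  | cq1 : Rel (g k c * g k q1) (-(g k q1 * g k c))
  | dq1 : Rel (g k d * g k q1) (g k q1 * g k d)
  | aq2 : Rel (g k a * g k q2) (g k q2 * g k a)
  | bq2 : Rel (g k b * g k q2) (g k q2 * g k b)
  | cq2 : Rel (g k c * g k q2) (g k q2 * g k c)
  | dq2 : Rel (g k d * g k q2) (-(g k q2 * g k d))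
  | p1p1 : Rel (g k p1 * g k p1) (lam • (g k a * g k b * g k c + g k a - 2))
  | p2p2 : Rel (g k p2 * g k p2) (lam • (g k a * g k b * g k c - g k a))
  | p1p2 : Rel (g k p1 * g k p2 + g k p2 * g k p1) (0)
  | q1q1 : Rel (g k q1 * g k q1) (mu • (g k a * g k b * g k c + g k a - 2))
  | q2q2 : Rel (g k q2 * g k q2) (mu • (g k a * g k b * g k c - g k a))
  | q1q2 : Rel (g k q1 * g k q2 + g k q2 * g k q1) (0)
  | p1q1 : Rel (g k p1 * g k q1 + g k q1 * g k p1) (alp • (g k a * g k b * g k c + g k a - 2))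
  | p2q2 : Rel (g k p2 * g k q2 + g k q2 * g k p2) (alp • (g k a * g k b * g k c - g k a))
  | p1q2 : Rel (g k p1 * g k q2 + g k q2 * g k p1) (0)
  | p2q1 : Rel (g k p2 * g k q1 + g k q1 * g k p2) (0)

/-- The algebra `U_38(λ,μ,α)`. -/
abbrev U := RingQuot (Rel k lam mu alp)

/-- The quotient map. -/
noncomputable abbrev mk : FreeAlgebra k Gen →ₐ[k] U k lam mu alp :=
  RingQuot.mkAlgHom k (Rel k lam mu alp)

/-- The image of the monomial `p1^i p2^j q1^k q2^l a^e b^f c^g d^h` in `U_38(λ,μ,α)`. -/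
noncomputable def mono (e : Gen → Fin 2) : U k lam mu alp :=
  mk k lam mu alp
    (g k p1 ^ (e p1).val * g k p2 ^ (e p2).val * g k q1 ^ (e q1).val * g k q2 ^ (e q2).val *
      g k a ^ (e a).val * g k b ^ (e b).val * g k c ^ (e c).val * g k d ^ (e d).val)

section Spanning

variable {k} {A : Type*} [Ring A] [Algebra k A]

/-- The elements `x` with `x * N ⊆ N`. -/
def leftStabilizer (N : Submodule k A) : Subalgebra k A where
  carrier := {x | ∀ n ∈ N, x * n ∈ N}
  mul_mem' hx hy n hn := by rw [mul_assoc]; exact hx _ (hy n hn)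
  add_mem' hx hy n hn := by rw [add_mul]; exact N.add_mem (hx n hn) (hy n hn)
  algebraMap_mem' r n hn := by rw [← Algebra.smul_def]; exact N.smul_mem r hn

/-- The submodule `N + p N`. -/
def quadExt (p : A) (N : Submodule k A) : Submodule k A :=
  N ⊔ N.map (LinearMap.mulLeft k p)

lemma mem_leftStabilizer_quadExt {N : Submodule k A} {p x y z : A}
    (hx : x ∈ leftStabilizer N) (hy : y ∈ leftStabilizer N) (hz : z ∈ leftStabilizer N)
    (h : x * p = p * y + z) : x ∈ leftStabilizer (quadExt p N) := by
  intro n hn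
  obtain ⟨m, hm, m', hm', rfl⟩ := Submodule.mem_sup.1 hn
  obtain ⟨l, hl, rfl⟩ := Submodule.mem_map.1 hm'
  have : x * (m + p * l) = (x * m + z * l) + p * (y * l) := by
    rw [mul_add, ← mul_assoc, h]; noncomm_ring
  rw [LinearMap.mulLeft_apply, this]
  exact Submodule.add_mem_sup (N.add_mem (hx m hm) (hz l hl))
    (Submodule.mem_map_of_mem (f := LinearMap.mulLeft k p) (hy l hl))

lemma mem_leftStabilizer_quadExt_of_commute {N : Submodule k A} {p x : A}
    (hx : x ∈ leftStabilizer N) (h : x * p = p * x) : x ∈ leftStabilizer (quadExt p N) :=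
  mem_leftStabilizer_quadExt hx hx (zero_mem _) (by rw [h, add_zero])

lemma mem_leftStabilizer_quadExt_of_anticommutator {N : Submodule k A} {p x z : A}
    (hx : x ∈ leftStabilizer N) (hz : z ∈ leftStabilizer N) (h : p * x + x * p = z) :
    x ∈ leftStabilizer (quadExt p N) :=
  mem_leftStabilizer_quadExt hx (neg_mem hx) hz (by rw [← h, mul_neg, neg_add_cancel_left])

lemma mem_leftStabilizer_quadExt_of_anticommute {N : Submodule k A} {p x : A}
    (hx : x ∈ leftStabilizer N) (h : x * p = -(p * x)) : x ∈ leftStabilizer (quadExt p N) :=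
  mem_leftStabilizer_quadExt_of_anticommutator hx (zero_mem _) (by rw [h, add_neg_cancel])

lemma self_mem_leftStabilizer_quadExt {N : Submodule k A} {p : A}
    (h : p * p ∈ leftStabilizer N) : p ∈ leftStabilizer (quadExt p N) := by
  intro n hn
  obtain ⟨m, hm, m', hm', rfl⟩ := Submodule.mem_sup.1 hn
  obtain ⟨l, hl, rfl⟩ := Submodule.mem_map.1 hm'
  rw [LinearMap.mulLeft_apply, mul_add, ← mul_assoc, add_comm]
  exact Submodule.add_mem_sup (h l hl) (Submodule.mem_map_of_mem (f := LinearMap.mulLeft k p) hm)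

lemma quadExt_le {N M : Submodule k A} {p : A}
    (h : ∀ i : Fin 2, N ≤ M.comap (LinearMap.mulLeft k (p ^ (i : ℕ)))) : quadExt p N ≤ M := by
  refine sup_le (fun n hn => ?_) (Submodule.map_le_iff_le_comap.2 fun n hn => ?_)
  · simpa using h 0 hn
  · simpa using h 1 hn

end Spanning

section GroupWords

variable {A : Type*} [Monoid A]

lemma mul_pow_fin_two {x : A} (hx : x * x = 1) (i : Fin 2) :
    x * x ^ (i : ℕ) = x ^ ((i + 1 : Fin 2) : ℕ) := by
  fin_cases i <;> simp [hx]

/-- The relations of `H` on four elements of a monoid. -/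
structure HRel (a b c d : A) : Prop where
  aa : a * a = 1
  bb : b * b = 1
  cc : c * c = 1
  ab : a * b = b * a
  ac : a * c = c * a
  bc : b * c = c * b
  dd : d * d = a
  da : d * a = a * d
  db : d * b = c * d
  dc : d * c = b * d

/-- The monomial `a^e b^f c^g d^h`. -/
def hMono (a b c d : A) (e f g h : Fin 2) : A :=
  a ^ (e : ℕ) * (b ^ (f : ℕ) * (c ^ (g : ℕ) * d ^ (h : ℕ)))

variable {a b c d : A} (e f g h : Fin 2)

lemma HRel.a_mul (H : HRel a b c d) :
    a * hMono a b c d e f g h = hMono a b c d (e + 1) f g h := by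
  rw [hMono, ← mul_assoc, mul_pow_fin_two H.aa, hMono]

lemma HRel.b_mul (H : HRel a b c d) :
    b * hMono a b c d e f g h = hMono a b c d e (f + 1) g h := by
  have h1 : b * a ^ (e : ℕ) = a ^ (e : ℕ) * b := (Commute.pow_right H.ab.symm _).eq
  rw [hMono, ← mul_assoc, h1, mul_assoc, ← mul_assoc b, mul_pow_fin_two H.bb, hMono]

lemma HRel.c_mul (H : HRel a b c d) :
    c * hMono a b c d e f g h = hMono a b c d e f (g + 1) h := by
  have h1 : c * a ^ (e : ℕ) = a ^ (e : ℕ) * c := (Commute.pow_right H.ac.symm _).eq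
  have h2 : c * b ^ (f : ℕ) = b ^ (f : ℕ) * c := (Commute.pow_right H.bc.symm _).eq
  rw [hMono, ← mul_assoc, h1, mul_assoc, ← mul_assoc c, h2, mul_assoc, ← mul_assoc c,
    mul_pow_fin_two H.cc, hMono]

lemma HRel.d_mul (H : HRel a b c d) :
    d * hMono a b c d e f g h = hMono a b c d (e + h) g f (h + 1) := by
  have h1 : d * a ^ (e : ℕ) = a ^ (e : ℕ) * d := (Commute.pow_right H.da _).eq
  have h2 : d * b ^ (f : ℕ) = c ^ (f : ℕ) * d := (SemiconjBy.pow_right H.db _).eq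
  have h3 : d * c ^ (g : ℕ) = b ^ (g : ℕ) * d := (SemiconjBy.pow_right H.dc _).eq
  have h4 : c ^ (f : ℕ) * b ^ (g : ℕ) = b ^ (g : ℕ) * c ^ (f : ℕ) :=
    (Commute.pow_pow H.bc.symm _ _).eq
  have h5 : d * hMono a b c d e f g h
      = a ^ (e : ℕ) * (b ^ (g : ℕ) * (c ^ (f : ℕ) * (d * d ^ (h : ℕ)))) := by
    rw [hMono, ← mul_assoc, h1, mul_assoc, ← mul_assoc d, h2, mul_assoc, ← mul_assoc d, h3,
      mul_assoc, ← mul_assoc (c ^ _), h4, mul_assoc]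
  rw [h5]
  match h with
  | 0 => simp [hMono]
  | 1 =>
    have h6 : b ^ (g : ℕ) * (c ^ (f : ℕ) * a) = a * (b ^ (g : ℕ) * c ^ (f : ℕ)) := by
      rw [← mul_assoc]
      exact ((Commute.pow_right H.ab _).mul_right (Commute.pow_right H.ac _)).eq.symm
    rw [Fin.val_one, pow_one, H.dd, h6, ← mul_assoc, (Commute.self_pow a _).eq.symm,
      mul_pow_fin_two H.aa]
    simp [hMono]

end GroupWords

section Extension

variable {k}

/-- Elements `x j` (`n ≤ j`) satisfying Clifford-type relations twisted by the group generated by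
`a, b, c, d`. -/
structure CliffordRep (n : ℕ) (ε η s t r : Fin 4 → k) (Q : Fin 4 → Fin 4 → k)
    {S : Type*} [Ring S] [Algebra k S] (a b c d : S) (x : Fin 4 → S) : Prop
    extends HRel a b c d where
  ax : ∀ j : Fin 4, n ≤ j → a * x j = x j * a
  bx : ∀ j : Fin 4, n ≤ j → b * x j = ε j • (x j * b)
  cx : ∀ j : Fin 4, n ≤ j → c * x j = ε j • (x j * c)
  dx : ∀ j : Fin 4, n ≤ j → d * x j = η j • (x j * d)
  sq : ∀ j : Fin 4, n ≤ j → x j * x j = r j • (a * b * c + s j • a + t j • 1)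
  anti : ∀ i j : Fin 4, n ≤ i → i < j →
    x i * x j + x j * x i = Q i j • (a * b * c + s i • a + t i • 1)

/-- The `2 × 2` matrix `M` is block upper triangular with upper left entry `m`. -/
structure IsUpper {S : Type*} [Ring S] (M : Matrix (Fin 2) (Fin 2) S) (m : S) : Prop where
  zero : M 1 0 = 0
  corner : M 0 0 = m

namespace IsUpper

variable {S : Type*} [Ring S] {M N : Matrix (Fin 2) (Fin 2) S} {m n : S}

lemma one : IsUpper (1 : Matrix (Fin 2) (Fin 2) S) 1 := ⟨by simp, by simp⟩

lemma mul (hM : IsUpper M m) (hN : IsUpper N n) : IsUpper (M * N) (m * n) :=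
  ⟨by simp [Matrix.mul_apply, Fin.sum_univ_two, hM.zero, hN.zero],
   by simp [Matrix.mul_apply, Fin.sum_univ_two, hM.corner, hN.corner, hN.zero]⟩

lemma pow (hM : IsUpper M m) (i : ℕ) : IsUpper (M ^ i) (m ^ i) := by
  induction i with
  | zero => simpa using one
  | succ i ih => simpa [pow_succ] using ih.mul hM

lemma hMono {a b c d : S} {a' b' c' d' : Matrix (Fin 2) (Fin 2) S} (ha : IsUpper a' a)
    (hb : IsUpper b' b) (hc : IsUpper c' c) (hd : IsUpper d' d) (e f g h : Fin 2) :
    IsUpper (Stmt12.hMono a' b' c' d' e f g h) (Stmt12.hMono a b c d e f g h) :=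
  (ha.pow _).mul ((hb.pow _).mul ((hc.pow _).mul (hd.pow _)))

lemma companion_pow_mul (hM : IsUpper M m) (u : S) (e i : Fin 2) :
    ((!![0, u; 1, 0] : Matrix (Fin 2) (Fin 2) S) ^ (e : ℕ) * M) i 0 = if i = e then m else 0 := by
  fin_cases e <;> fin_cases i <;>
    simp [Matrix.mul_apply, Fin.sum_univ_two, hM.zero, hM.corner]

end IsUpper

lemma CliffordRep.exists_extension {i₀ : Fin 4} {ε η s t r : Fin 4 → k} {Q : Fin 4 → Fin 4 → k}
    (hε : ∀ j, ε j * ε j = 1) (hη : ∀ j, η j * η j = 1)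
    (hQε : ∀ i j, Q i j * (ε i * ε j) = Q i j) (hQη : ∀ i j, Q i j * (η i * η j) = Q i j)
    {S : Type*} [Ring S] [Algebra k S] {a b c d : S} {x : Fin 4 → S}
    (H : CliffordRep (i₀ + 1) ε η s t r Q a b c d x) :
    ∃ (a' b' c' d' : Matrix (Fin 2) (Fin 2) S) (x' : Fin 4 → Matrix (Fin 2) (Fin 2) S),
      CliffordRep i₀ ε η s t r Q a' b' c' d' x' ∧
      IsUpper a' a ∧ IsUpper b' b ∧ IsUpper c' c ∧ IsUpper d' d ∧
      (∀ j, i₀ < j → IsUpper (x' j) (x j)) ∧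
      ∀ (M : Matrix (Fin 2) (Fin 2) S) (m : S), IsUpper M m → ∀ e i : Fin 2,
        (x' i₀ ^ (e : ℕ) * M) i 0 = if i = e then m else 0 := by
  set z : S := a * b * c + s i₀ • a + t i₀ • 1 with hz
  have comm_z : ∀ w, Commute w (a * b * c) → Commute w a → w * z = z * w := fun w h1 h2 =>
    ((h1.add_right (h2.smul_right _)).add_right ((Commute.one_right w).smul_right _)).eq
  have hab : Commute a b := H.ab
  have hac : Commute a c := H.ac
  have hbc : Commute b c := H.bc
  have haz : a * z = z * a :=
    comm_z a (((Commute.refl a).mul_right hab).mul_right hac) (Commute.refl a)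
  have hbz : b * z = z * b :=
    comm_z b ((hab.symm.mul_right (Commute.refl b)).mul_right hbc) hab.symm
  have hcz : c * z = z * c :=
    comm_z c ((hac.symm.mul_right hbc.symm).mul_right (Commute.refl c)) hac.symm
  have hdz : d * z = z * d := by
    refine comm_z d ?_ H.da
    have h : SemiconjBy d (a * b * c) (a * c * b) :=
      (SemiconjBy.mul_right H.da H.db).mul_right H.dc
    rwa [mul_assoc a c b, ← H.bc, ← mul_assoc] at h
  have hxz : ∀ j, i₀ < j → x j * z = z * x j := by
    intro j hj
    refine comm_z (x j) (Eq.symm ?_) (H.ax j hj).symm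
    rw [mul_assoc, H.cx j hj, mul_smul_comm, mul_assoc, ← mul_assoc b, H.bx j hj, smul_mul_assoc,
      mul_smul_comm, smul_smul, hε, one_smul, mul_assoc, ← mul_assoc, H.ax j hj]
    simp only [mul_assoc]
  let x' : Fin 4 → Matrix (Fin 2) (Fin 2) S := fun j =>
    if j = i₀ then !![0, r i₀ • z; 1, 0] else !![x j, Q i₀ j • z; 0, -x j]
  have hx'0 : x' i₀ = !![0, r i₀ • z; 1, 0] := by simp [x']
  have hx'1 : ∀ j, i₀ < j → x' j = !![x j, Q i₀ j • z; 0, -x j] := fun j hj => by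
    simp [x', hj.ne']
  have split : ∀ j : Fin 4, (i₀ : ℕ) ≤ j → j = i₀ ∨ i₀ < j := fun j hj => by
    rcases (Fin.le_def.2 hj).eq_or_lt with h | h
    · exact .inl h.symm
    · exact .inr h
  refine ⟨!![a, 0; 0, a], !![b, 0; 0, ε i₀ • b], !![c, 0; 0, ε i₀ • c], !![d, 0; 0, η i₀ • d],
    x', ?_, ⟨rfl, rfl⟩, ⟨rfl, rfl⟩, ⟨rfl, rfl⟩, ⟨rfl, rfl⟩, ?_, ?_⟩
  · have hz' : ∀ u v : k, (!![a, 0; 0, a] * !![b, 0; 0, ε i₀ • b] * !![c, 0; 0, ε i₀ • c] +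
        u • !![a, 0; 0, a] + v • 1 : Matrix (Fin 2) (Fin 2) S) =
        !![a * b * c + u • a + v • 1, 0; 0, a * b * c + u • a + v • 1] := by
      intro u v
      simp [Matrix.one_fin_two, smul_smul, hε]
    refine ⟨⟨?_, ?_, ?_, ?_, ?_, ?_, ?_, ?_, ?_, ?_⟩, ?_, ?_, ?_, ?_, ?_, ?_⟩
    · simp [Matrix.one_fin_two, H.aa]
    · simp [Matrix.one_fin_two, H.bb, smul_smul, hε]
    · simp [Matrix.one_fin_two, H.cc, smul_smul, hε]
    · simp [H.ab]
    · simp [H.ac]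
    · simp [H.bc]
    · simp [H.dd, smul_smul, hη]
    · simp [H.da]
    · simp [H.db, smul_smul, mul_comm]
    · simp [H.dc, smul_smul, mul_comm]
    · intro j hj
      rcases split j hj with rfl | h
      · simp [hx'0, haz]
      · simp [hx'1 j h, haz, H.ax j h]
    · intro j hj
      rcases split j hj with rfl | h
      · have h (u : k) : ε j * (u * ε j) = u := by rw [mul_left_comm, hε, mul_one]
        simp [hx'0, hbz, smul_smul, h]
      · have h' : ε j * (Q i₀ j * ε i₀) = Q i₀ j := by linear_combination hQε i₀ j
        simp [hx'1 j h, hbz, H.bx j h, smul_smul, h', mul_comm (ε j) (ε i₀)]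
    · intro j hj
      rcases split j hj with rfl | h
      · have h (u : k) : ε j * (u * ε j) = u := by rw [mul_left_comm, hε, mul_one]
        simp [hx'0, hcz, smul_smul, h]
      · have h' : ε j * (Q i₀ j * ε i₀) = Q i₀ j := by linear_combination hQε i₀ j
        simp [hx'1 j h, hcz, H.cx j h, smul_smul, h', mul_comm (ε j) (ε i₀)]
    · intro j hj
      rcases split j hj with rfl | h
      · have h (u : k) : η j * (u * η j) = u := by rw [mul_left_comm, hη, mul_one]
        simp [hx'0, hdz, smul_smul, h]
      · have h' : η j * (Q i₀ j * η i₀) = Q i₀ j := by linear_combination hQη i₀ j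
        simp [hx'1 j h, hdz, H.dx j h, smul_smul, h', mul_comm (η j) (η i₀)]
    · intro j hj
      rw [hz']
      rcases split j hj with rfl | h
      · simp [hx'0, ← hz]
      · simp [hx'1 j h, H.sq j h, hxz j h]
    · intro i j hi hj
      rw [hz']
      rcases split i hi with rfl | h
      · simp [hx'0, hx'1 j hj, ← hz, hxz j hj]
      · have hj' := h.trans hj
        have h1 := H.anti i j h hj
        simp [hx'1 i h, hx'1 j hj', h1, hxz i h, hxz j hj']
  · intro j hj
    rw [hx'1 j hj]
    exact ⟨rfl, rfl⟩
  · intro M m hM e i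
    rw [hx'0]
    exact hM.companion_pow_mul _ e i

end Extension

section Model

open Equiv

lemma hRel_perm : HRel (swap 4 6 * swap 5 7) (swap 0 1) (swap 2 3)
    (swap 0 2 * swap 1 3 * (swap 4 5 * swap 5 6 * swap 6 7) : Perm (Fin 8)) := by
  constructor <;> decide

/-- The elements of `H`, realized as a permutation group on eight letters. -/
def hPerm (e f g h : Fin 2) : Perm (Fin 8) :=
  hMono (swap 4 6 * swap 5 7) (swap 0 1) (swap 2 3)
    (swap 0 2 * swap 1 3 * (swap 4 5 * swap 5 6 * swap 6 7)) e f g h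

lemma hPerm_injective : ∀ e f g h e' f' g' h' : Fin 2,
    hPerm e f g h = hPerm e' f' g' h' → e = e' ∧ f = f' ∧ g = g' ∧ h = h' := by
  decide

lemma HRel.map {A B : Type*} [Monoid A] [Monoid B] (φ : A →* B) {a b c d : A}
    (H : HRel a b c d) : HRel (φ a) (φ b) (φ c) (φ d) := by
  constructor <;> simp only [← map_mul, H.aa, H.bb, H.cc, H.ab, H.ac, H.bc, H.dd, H.da, H.db,
    H.dc, map_one]

lemma map_hMono {A B F : Type*} [Monoid A] [Monoid B] [FunLike F A B] [MonoidHomClass F A B]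
    (φ : F) (a b c d : A) (e f g h : Fin 2) :
    φ (hMono a b c d e f g h) = hMono (φ a) (φ b) (φ c) (φ d) e f g h := by
  simp [hMono]

end Model

section Presentation

variable {k lam mu alp}

/-- The coefficients of the anticommutators of `p1, p2, q1, q2`. -/
def antiCoeff (alp : k) : Fin 4 → Fin 4 → k :=
  ![![0, 0, alp, 0], ![0, 0, 0, alp], 0, 0]

lemma exists_hom {S : Type*} [Ring S] [Algebra k S] {a' b' c' d' : S} {x : Fin 4 → S}
    (H : CliffordRep 0 ![-1, 1, -1, 1] ![1, -1, 1, -1] ![1, -1, 1, -1] ![-2, 0, -2, 0]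
      ![lam, lam, mu, mu] (antiCoeff alp) a' b' c' d' x) :
    ∃ φ : U k lam mu alp →ₐ[k] S,
      φ (mk k lam mu alp (g k a)) = a' ∧ φ (mk k lam mu alp (g k b)) = b' ∧
      φ (mk k lam mu alp (g k c)) = c' ∧ φ (mk k lam mu alp (g k d)) = d' ∧
      φ (mk k lam mu alp (g k p1)) = x 0 ∧ φ (mk k lam mu alp (g k p2)) = x 1 ∧
      φ (mk k lam mu alp (g k q1)) = x 2 ∧ φ (mk k lam mu alp (g k q2)) = x 3 := by
  let f : Gen → S := fun
    | a => a' | b => b' | c => c' | d => d' | p1 => x 0 | p2 => x 1 | q1 => x 2 | q2 => x 3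
  have hax := fun j => H.ax j (Nat.zero_le _)
  have hbx := fun j => H.bx j (Nat.zero_le _)
  have hcx := fun j => H.cx j (Nat.zero_le _)
  have hdx := fun j => H.dx j (Nat.zero_le _)
  have hsq := fun j => H.sq j (Nat.zero_le _)
  have hanti := fun i j => H.anti i j (Nat.zero_le _)
  have h2 : algebraMap k S 2 = 2 := map_ofNat _ 2
  have hf : ∀ ⦃u v⦄, Rel k lam mu alp u v → FreeAlgebra.lift k f u = FreeAlgebra.lift k f v := by
    intro u v h
    cases h <;> simp only [map_mul, map_add, map_sub, map_neg, map_smul, map_one, map_zero,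
      map_ofNat, FreeAlgebra.lift_ι_apply, f]
    case haa => exact H.aa
    case hbb => exact H.bb
    case hcc => exact H.cc
    case hab => exact H.ab
    case hac => exact H.ac
    case hbc => exact H.bc
    case hdd => exact H.dd
    case hda => exact H.da
    case hdb => exact H.db
    case hdc => exact H.dc
    case ap1 => exact hax 0
    case ap2 => exact hax 1
    case aq1 => exact hax 2
    case aq2 => exact hax 3
    case bp1 => simpa using hbx 0
    case bp2 => simpa using hbx 1
    case bq1 => simpa using hbx 2
    case bq2 => simpa using hbx 3
    case cp1 => simpa using hcx 0
    case cp2 => simpa using hcx 1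
    case cq1 => simpa using hcx 2
    case cq2 => simpa using hcx 3
    case dp1 => simpa using hdx 0
    case dp2 => simpa using hdx 1
    case dq1 => simpa using hdx 2
    case dq2 => simpa using hdx 3
    case p1p1 => simpa [← Algebra.algebraMap_eq_smul_one, h2, ← sub_eq_add_neg] using hsq 0
    case p2p2 => simpa [← sub_eq_add_neg] using hsq 1
    case q1q1 => simpa [← Algebra.algebraMap_eq_smul_one, h2, ← sub_eq_add_neg] using hsq 2
    case q2q2 => simpa [← sub_eq_add_neg] using hsq 3
    case p1p2 => simpa [antiCoeff] using hanti 0 1 (by decide)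
    case q1q2 => simpa [antiCoeff] using hanti 2 3 (by decide)
    case p1q2 => simpa [antiCoeff] using hanti 0 3 (by decide)
    case p2q1 => simpa [antiCoeff] using hanti 1 2 (by decide)
    case p1q1 =>
      simpa [antiCoeff, ← Algebra.algebraMap_eq_smul_one, h2, ← sub_eq_add_neg] using
        hanti 0 2 (by decide)
    case p2q2 => simpa [antiCoeff, ← sub_eq_add_neg] using hanti 1 3 (by decide)
  refine ⟨RingQuot.liftAlgHom k ⟨FreeAlgebra.lift k f, hf⟩, ?_⟩
  simp only [RingQuot.liftAlgHom_mkAlgHom_apply, FreeAlgebra.lift_ι_apply, f, and_self]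

end Presentation

section Basis

variable {k}

/-- The image in `U` of a generator. -/
noncomputable abbrev gen (lam mu alp : k) (x : Gen) : U k lam mu alp := mk k lam mu alp (g k x)

variable (lam mu alp : k)

lemma mono_eq (e : Gen → Fin 2) :
    mono k lam mu alp e = gen lam mu alp p1 ^ (e p1 : ℕ) * (gen lam mu alp p2 ^ (e p2 : ℕ) *
      (gen lam mu alp q1 ^ (e q1 : ℕ) * (gen lam mu alp q2 ^ (e q2 : ℕ) *
        hMono (gen lam mu alp a) (gen lam mu alp b) (gen lam mu alp c) (gen lam mu alp d)
          (e a) (e b) (e c) (e d)))) := by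
  simp only [mono, hMono, map_mul, map_pow, mul_assoc]

lemma hRel_gen :
    HRel (gen lam mu alp a) (gen lam mu alp b) (gen lam mu alp c) (gen lam mu alp d) := by
  have R := fun {u v} (h : Rel k lam mu alp u v) => RingQuot.mkAlgHom_rel k h
  constructor
  · simpa using R .haa
  · simpa using R .hbb
  · simpa using R .hcc
  · simpa using R .hab
  · simpa using R .hac
  · simpa using R .hbc
  · simpa using R .hdd
  · simpa using R .hda
  · simpa using R .hdb
  · simpa using R .hdc

lemma eq_top_of_gen_mem_leftStabilizer {N : Submodule k (U k lam mu alp)}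
    (h1 : 1 ∈ N) (h : ∀ x, gen lam mu alp x ∈ leftStabilizer N) : N = ⊤ := by
  have key : ∀ u : FreeAlgebra k Gen, mk k lam mu alp u ∈ leftStabilizer N := by
    intro u
    induction u with
    | grade0 r => simp
    | grade1 x => exact h x
    | mul u v hu hv => rw [map_mul]; exact mul_mem hu hv
    | add u v hu hv => rw [map_add]; exact add_mem hu hv
  refine eq_top_iff.2 fun y _ => ?_
  obtain ⟨u, rfl⟩ := RingQuot.mkAlgHom_surjective k (Rel k lam mu alp) y
  simpa using key u 1 h1

lemma span_mono : Submodule.span k (Set.range (mono k lam mu alp)) = ⊤ := by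
  have H := hRel_gen lam mu alp
  have R := fun {u v} (h : Rel k lam mu alp u v) => RingQuot.mkAlgHom_rel k h
  set u := gen lam mu alp
  have h2 : RingQuot.mkAlgHom k (Rel k lam mu alp) 2 = 2 := map_ofNat _ 2
  let N₀ : Submodule k (U k lam mu alp) := Submodule.span k (Set.range
    fun e : Fin 2 × Fin 2 × Fin 2 × Fin 2 =>
      hMono (u a) (u b) (u c) (u d) e.1 e.2.1 e.2.2.1 e.2.2.2)
  have stab₀ : ∀ w : U k lam mu alp, (∀ e f g h, ∃ e' f' g' h',
      w * hMono (u a) (u b) (u c) (u d) e f g h = hMono (u a) (u b) (u c) (u d) e' f' g' h') →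
      w ∈ leftStabilizer N₀ := by
    intro w hw n hn
    have : N₀ ≤ N₀.comap (LinearMap.mulLeft k w) := by
      refine Submodule.span_le.2 ?_
      rintro _ ⟨⟨e, f, g, h⟩, rfl⟩
      obtain ⟨e', f', g', h', he⟩ := hw e f g h
      exact Submodule.subset_span ⟨(e', f', g', h'), he.symm⟩
    exact this hn
  let N₁ := quadExt (u q2) N₀
  let N₂ := quadExt (u q1) N₁
  let N₃ := quadExt (u p2) N₂
  let N₄ := quadExt (u p1) N₃
  have z1 : ∀ (N : Submodule k (U k lam mu alp)) (r : k), u a ∈ leftStabilizer N →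
      u b ∈ leftStabilizer N → u c ∈ leftStabilizer N →
      r • (u a * u b * u c + u a - 2) ∈ leftStabilizer N := fun N r ha hb hc =>
    Subalgebra.smul_mem _ (sub_mem (add_mem (mul_mem (mul_mem ha hb) hc) ha) (ofNat_mem _ 2)) r
  have z2 : ∀ (N : Submodule k (U k lam mu alp)) (r : k), u a ∈ leftStabilizer N →
      u b ∈ leftStabilizer N → u c ∈ leftStabilizer N →
      r • (u a * u b * u c - u a) ∈ leftStabilizer N := fun N r ha hb hc =>
    Subalgebra.smul_mem _ (sub_mem (mul_mem (mul_mem ha hb) hc) ha) r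
  have a0 : u a ∈ leftStabilizer N₀ := stab₀ _ fun e f g h => ⟨_, _, _, _, H.a_mul e f g h⟩
  have b0 : u b ∈ leftStabilizer N₀ := stab₀ _ fun e f g h => ⟨_, _, _, _, H.b_mul e f g h⟩
  have c0 : u c ∈ leftStabilizer N₀ := stab₀ _ fun e f g h => ⟨_, _, _, _, H.c_mul e f g h⟩
  have d0 : u d ∈ leftStabilizer N₀ := stab₀ _ fun e f g h => ⟨_, _, _, _, H.d_mul e f g h⟩
  have a1 : u a ∈ leftStabilizer N₁ :=
    mem_leftStabilizer_quadExt_of_commute a0 (by simpa using R .aq2)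
  have b1 : u b ∈ leftStabilizer N₁ :=
    mem_leftStabilizer_quadExt_of_commute b0 (by simpa using R .bq2)
  have c1 : u c ∈ leftStabilizer N₁ :=
    mem_leftStabilizer_quadExt_of_commute c0 (by simpa using R .cq2)
  have d1 : u d ∈ leftStabilizer N₁ :=
    mem_leftStabilizer_quadExt_of_anticommute d0 (by simpa using R .dq2)
  have q21 : u q2 ∈ leftStabilizer N₁ := self_mem_leftStabilizer_quadExt (by
    have h : u q2 * u q2 = mu • (u a * u b * u c - u a) := by simpa using R .q2q2
    rw [h]; exact z2 _ _ a0 b0 c0)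
  have a2 : u a ∈ leftStabilizer N₂ :=
    mem_leftStabilizer_quadExt_of_commute a1 (by simpa using R .aq1)
  have b2 : u b ∈ leftStabilizer N₂ :=
    mem_leftStabilizer_quadExt_of_anticommute b1 (by simpa using R .bq1)
  have c2 : u c ∈ leftStabilizer N₂ :=
    mem_leftStabilizer_quadExt_of_anticommute c1 (by simpa using R .cq1)
  have d2 : u d ∈ leftStabilizer N₂ :=
    mem_leftStabilizer_quadExt_of_commute d1 (by simpa using R .dq1)
  have q22 : u q2 ∈ leftStabilizer N₂ :=
    mem_leftStabilizer_quadExt_of_anticommutator q21 (zero_mem _) (by simpa using R .q1q2)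
  have q12 : u q1 ∈ leftStabilizer N₂ := self_mem_leftStabilizer_quadExt (by
    have h : u q1 * u q1 = mu • (u a * u b * u c + u a - 2) := by simpa [h2] using R .q1q1
    rw [h]; exact z1 _ _ a1 b1 c1)
  have a3 : u a ∈ leftStabilizer N₃ :=
    mem_leftStabilizer_quadExt_of_commute a2 (by simpa using R .ap2)
  have b3 : u b ∈ leftStabilizer N₃ :=
    mem_leftStabilizer_quadExt_of_commute b2 (by simpa using R .bp2)
  have c3 : u c ∈ leftStabilizer N₃ :=
    mem_leftStabilizer_quadExt_of_commute c2 (by simpa using R .cp2)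
  have d3 : u d ∈ leftStabilizer N₃ :=
    mem_leftStabilizer_quadExt_of_anticommute d2 (by simpa using R .dp2)
  have q23 : u q2 ∈ leftStabilizer N₃ :=
    mem_leftStabilizer_quadExt_of_anticommutator q22 (z2 _ alp a2 b2 c2) (by simpa using R .p2q2)
  have q13 : u q1 ∈ leftStabilizer N₃ :=
    mem_leftStabilizer_quadExt_of_anticommutator q12 (zero_mem _) (by simpa using R .p2q1)
  have p23 : u p2 ∈ leftStabilizer N₃ := self_mem_leftStabilizer_quadExt (by
    have h : u p2 * u p2 = lam • (u a * u b * u c - u a) := by simpa using R .p2p2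
    rw [h]; exact z2 _ _ a2 b2 c2)
  have top : N₄ = ⊤ := by
    refine eq_top_of_gen_mem_leftStabilizer lam mu alp ?_ ?_
    · exact Submodule.mem_sup_left (Submodule.mem_sup_left (Submodule.mem_sup_left
        (Submodule.mem_sup_left (Submodule.subset_span ⟨0, by simp [hMono]⟩))))
    · rintro (_ | _ | _ | _ | _ | _ | _ | _)
      · exact mem_leftStabilizer_quadExt_of_commute a3 (by simpa using R .ap1)
      · exact mem_leftStabilizer_quadExt_of_anticommute b3 (by simpa using R .bp1)
      · exact mem_leftStabilizer_quadExt_of_anticommute c3 (by simpa using R .cp1)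
      · exact mem_leftStabilizer_quadExt_of_commute d3 (by simpa using R .dp1)
      · refine self_mem_leftStabilizer_quadExt ?_
        have h : u p1 * u p1 = lam • (u a * u b * u c + u a - 2) := by simpa [h2] using R .p1p1
        rw [h]; exact z1 _ _ a3 b3 c3
      · exact mem_leftStabilizer_quadExt_of_anticommutator p23 (zero_mem _) (by simpa using R .p1p2)
      · exact mem_leftStabilizer_quadExt_of_anticommutator q13 (z1 _ alp a3 b3 c3)
          (by simpa [h2] using R .p1q1)
      · exact mem_leftStabilizer_quadExt_of_anticommutator q23 (zero_mem _) (by simpa using R .p1q2)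
  rw [← top_le_iff, ← top]
  refine quadExt_le fun i => quadExt_le fun j => quadExt_le fun m => quadExt_le fun l =>
    Submodule.span_le.2 ?_
  rintro _ ⟨⟨e, f, g, h⟩, rfl⟩
  refine Submodule.subset_span ⟨fun
    | a => e | b => f | c => g | d => h | p1 => i | p2 => j | q1 => m | q2 => l, ?_⟩
  rw [mono_eq]
  rfl

/-- `Gen` has eight elements. -/
def genEquiv : Gen ≃ Fin 8 where
  toFun | a => 0 | b => 1 | c => 2 | d => 3 | p1 => 4 | p2 => 5 | q1 => 6 | q2 => 7
  invFun := ![a, b, c, d, p1, p2, q1, q2]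
  left_inv x := by cases x <;> rfl
  right_inv i := by fin_cases i <;> rfl

open Classical in
lemma exists_dual (e' : Gen → Fin 2) : ∃ L : U k lam mu alp →ₗ[k] k,
    L (mono k lam mu alp e') = 1 ∧ ∀ e, e ≠ e' → L (mono k lam mu alp e) = 0 := by
  have hε : ∀ j, (![-1, 1, -1, 1] : Fin 4 → k) j * ![-1, 1, -1, 1] j = 1 := by
    intro j; fin_cases j <;> simp
  have hη : ∀ j, (![1, -1, 1, -1] : Fin 4 → k) j * ![1, -1, 1, -1] j = 1 := by
    intro j; fin_cases j <;> simp
  have hQε : ∀ i j, antiCoeff alp i j * ((![-1, 1, -1, 1] : Fin 4 → k) i * ![-1, 1, -1, 1] j) =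
      antiCoeff alp i j := by
    intro i j; fin_cases i <;> fin_cases j <;> simp [antiCoeff]
  have hQη : ∀ i j, antiCoeff alp i j * ((![1, -1, 1, -1] : Fin 4 → k) i * ![1, -1, 1, -1] j) =
      antiCoeff alp i j := by
    intro i j; fin_cases i <;> fin_cases j <;> simp [antiCoeff]
  have H₀ := hRel_perm.map (MonoidAlgebra.of k _)
  have C₀ : CliffordRep (k := k) ((3 : Fin 4) + 1) ![-1, 1, -1, 1] ![1, -1, 1, -1] ![1, -1, 1, -1]
      ![-2, 0, -2, 0] ![lam, lam, mu, mu] (antiCoeff alp) _ _ _ _ 0 :=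
    { H₀ with
      ax := fun j hj => absurd j.2 (not_lt.2 hj)
      bx := fun j hj => absurd j.2 (not_lt.2 hj)
      cx := fun j hj => absurd j.2 (not_lt.2 hj)
      dx := fun j hj => absurd j.2 (not_lt.2 hj)
      sq := fun j hj => absurd j.2 (not_lt.2 hj)
      anti := fun j _ hj _ => absurd j.2 (not_lt.2 hj) }
  obtain ⟨a₁, b₁, c₁, d₁, x₁, C₁, ha₁, hb₁, hc₁, hd₁, -, h₁⟩ :=
    C₀.exists_extension hε hη hQε hQη
  obtain ⟨a₂, b₂, c₂, d₂, x₂, C₂, ha₂, hb₂, hc₂, hd₂, hx₂, h₂⟩ :=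
    CliffordRep.exists_extension (i₀ := 2) hε hη hQε hQη C₁
  obtain ⟨a₃, b₃, c₃, d₃, x₃, C₃, ha₃, hb₃, hc₃, hd₃, hx₃, h₃⟩ :=
    CliffordRep.exists_extension (i₀ := 1) hε hη hQε hQη C₂
  obtain ⟨a₄, b₄, c₄, d₄, x₄, C₄, ha₄, hb₄, hc₄, hd₄, hx₄, h₄⟩ :=
    CliffordRep.exists_extension (i₀ := 0) hε hη hQε hQη C₃
  obtain ⟨φ, φa, φb, φc, φd, φp1, φp2, φq1, φq2⟩ := exists_hom C₄
  let L : U k lam mu alp →ₗ[k] k :=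
    { toFun := fun y => (φ y (e' p1) 0 (e' p2) 0 (e' q1) 0 (e' q2) 0).coeff
        (hPerm (e' a) (e' b) (e' c) (e' d))
      map_add' := fun y z => by simp
      map_smul' := fun r y => by simp }
  have hL : ∀ e, L (mono k lam mu alp e) = if e = e' then 1 else 0 := by
    intro e
    have u₁ := IsUpper.hMono ha₁ hb₁ hc₁ hd₁ (e a) (e b) (e c) (e d)
    have u₂ := IsUpper.hMono ha₂ hb₂ hc₂ hd₂ (e a) (e b) (e c) (e d)
    have u₃ := IsUpper.hMono ha₃ hb₃ hc₃ hd₃ (e a) (e b) (e c) (e d)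
    have u₄ := IsUpper.hMono ha₄ hb₄ hc₄ hd₄ (e a) (e b) (e c) (e d)
    have v₂ := ((hx₂ 3 (by decide)).pow (e q2)).mul u₂
    have v₃ := ((hx₃ 2 (by decide)).pow (e q1)).mul (((hx₃ 3 (by decide)).pow (e q2)).mul u₃)
    have v₄ := ((hx₄ 1 (by decide)).pow (e p2)).mul
      (((hx₄ 2 (by decide)).pow (e q1)).mul (((hx₄ 3 (by decide)).pow (e q2)).mul u₄))
    have hφ : φ (mono k lam mu alp e) (e' p1) 0 (e' p2) 0 (e' q1) 0 (e' q2) 0 =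
        if e' p1 = e p1 ∧ e' p2 = e p2 ∧ e' q1 = e q1 ∧ e' q2 = e q2 then
          MonoidAlgebra.of k _ (hPerm (e a) (e b) (e c) (e d)) else 0 := by
      rw [mono_eq]
      simp only [map_mul, map_pow, map_hMono, φa, φb, φc, φd, φp1, φp2, φq1, φq2, hPerm]
      rw [h₄ _ _ v₄]
      split_ifs with h h' h'
      · rw [h₃ _ _ v₃, if_pos h'.2.1, h₂ _ _ v₂, if_pos h'.2.2.1, h₁ _ _ u₁, if_pos h'.2.2.2]
        simp only [map_mul]
      · rw [h₃ _ _ v₃]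
        split_ifs with h3
        · rw [h₂ _ _ v₂]
          split_ifs with h2
          · rw [h₁ _ _ u₁, if_neg fun h1 => h' ⟨h, h3, h2, h1⟩]
          · rfl
        · rfl
      · exact absurd h'.1 h
      · rfl
    change (φ (mono k lam mu alp e) (e' p1) 0 (e' p2) 0 (e' q1) 0 (e' q2) 0).coeff _ = _
    rw [hφ]
    by_cases he : e = e'
    · subst he
      rw [if_pos rfl, if_pos ⟨rfl, rfl, rfl, rfl⟩, MonoidAlgebra.of_apply,
        MonoidAlgebra.coeff_single]
      exact Finsupp.single_eq_same
    · rw [if_neg he]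
      split_ifs with h
      · have hne : hPerm (e a) (e b) (e c) (e d) ≠ hPerm (e' a) (e' b) (e' c) (e' d) := by
          intro h'
          obtain ⟨ha, hb, hc, hd⟩ := hPerm_injective _ _ _ _ _ _ _ _ h'
          obtain ⟨hp1, hp2, hq1, hq2⟩ := h
          refine he (funext ?_)
          rintro (_ | _ | _ | _ | _ | _ | _ | _)
          exacts [ha, hb, hc, hd, hp1.symm, hp2.symm, hq1.symm, hq2.symm]
        simp [Finsupp.single_eq_of_ne' hne]
      · rfl
  exact ⟨L, by simp [hL], fun e he => by simp [hL, he]⟩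

lemma linearIndependent_mono : LinearIndependent k (mono k lam mu alp) := by
  choose L h1 h0 using exists_dual lam mu alp
  exact LinearIndependent.of_pairwise_dual_eq_zero_one _ L (fun e' e h => h0 e' e h.symm) h1

end Basis

theorem thm [IsAlgClosed k] [CharZero k] (lam mu alp : k) :
    Module.finrank k (U k lam mu alp) = 256 ∧
    LinearIndependent k (mono k lam mu alp) ∧
    Submodule.span k (Set.range (mono k lam mu alp)) = ⊤ := by
  have hli := linearIndependent_mono lam mu alp
  have hspan := span_mono lam mu alp
  refine ⟨?_, hli, hspan⟩
  rw [Module.finrank_eq_nat_card_basis (Module.Basis.mk hli hspan.ge),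
    Nat.card_congr (genEquiv.arrowCongr (Equiv.refl (Fin 2)))]
  simp

end Stmt12
end

section
/- For all λ, μ, α ∈ k, the algebra U_39(λ,μ,α) is 256-dimensional over k; the images of the monomials p1^i p2^j q1^k q2^l a^e b^f c^g d^h with i, j, k, l, e, f, g, h ∈ {0,1} form a k-basis. -/
namespace Stmt13

/-- The generators `a, b, c, d, p1, p2, q1, q2`. -/
inductive Gen | a | b | c | d | p1 | p2 | q1 | q2

open Gen

variable (k : Type*) [Field k]

/-- The generators viewed inside the free algebra. -/
abbrev g (x : Gen) : FreeAlgebra k Gen := FreeAlgebra.ι k x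

variable (lam mu alp : k)

/-- The defining relations of `U_39(λ,μ,α)`: the `H`-relations together with the listed
relations involving `p1, p2, q1, q2`. -/
inductive Rel : FreeAlgebra k Gen → FreeAlgebra k Gen → Prop
  -- H-relations
  | haa : Rel (g k a * g k a) 1
  | hbb : Rel (g k b * g k b) 1
  | hcc : Rel (g k c * g k c) 1
  | hab : Rel (g k a * g k b) (g k b * g k a)
  | hac : Rel (g k a * g k c) (g k c * g k a)
  | hbc : Rel (g k b * g k c) (g k c * g k b)
  | hdd : Rel (g k d * g k d) (g k a)
  | hda : Rel (g k d * g k a) (g k a * g k d)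
  | hdb : Rel (g k d * g k b) (g k c * g k d)
  | hdc : Rel (g k d * g k c) (g k b * g k d)
  | ap1 : Rel (g k a * g k p1) (g k p1 * g k a)
  | bp1 : Rel (g k b * g k p1) (-(g k p1 * g k b))
  | cp1 : Rel (g k c * g k p1) (-(g k p1 * g k c))
  | dp1 : Rel (g k d * g k p1) (g k p1 * g k d)
  | ap2 : Rel (g k a * g k p2) (g k p2 * g k a)
  | bp2 : Rel (g k b * g k p2) (g k p2 * g k b)
  | cp2 : Rel (g k c * g k p2) (g k p2 * g k c)
  | dp2 : Rel (g k d * g k p2) (-(g k p2 * g k d))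
  | aq1 : Rel (g k a * g k q1) (g k q1 * g k a)
  | bq1 : Rel (g k b * g k q1) (-(g k q1 * g k b))
  | cq1 : Rel (g k c * g k q1) (-(g k q1 * g k c))
  | dq1 : Rel (g k d * g k q1) (g k q1 * g k d)
  | aq2 : Rel (g k a * g k q2) (g k q2 * g k a)
  | bq2 : Rel (g k b * g k q2) (g k q2 * g k b)
  | cq2 : Rel (g k c * g k q2) (g k q2 * g k c)
  | dq2 : Rel (g k d * g k q2) (-(g k q2 * g k d))
  | p1p1 : Rel (g k p1 * g k p1) (lam • (g k a * g k b * g k c + g k a - 2))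
  | p2p2 : Rel (g k p2 * g k p2) (lam • (g k a * g k b * g k c - g k a))
  | p1p2 : Rel (g k p1 * g k p2 + g k p2 * g k p1) (0)
  | q1q1 : Rel (g k q1 * g k q1) (mu • (g k a * g k b * g k c + g k a - 2))
  | q2q2 : Rel (g k q2 * g k q2) (mu • (g k a * g k b * g k c - g k a))
  | q1q2 : Rel (g k q1 * g k q2 + g k q2 * g k q1) (0)
  | p1q1 : Rel (g k p1 * g k q1 + g k q1 * g k p1) (alp • (1 - g k b * g k c))
  | p2q2 : Rel (g k p2 * g k q2 + g k q2 * g k p2) (alp • (1 - g k b * g k c))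
  | p1q2 : Rel (g k p1 * g k q2 + g k q2 * g k p1) (0)
  | p2q1 : Rel (g k p2 * g k q1 + g k q1 * g k p2) (0)

/-- The algebra `U_39(λ,μ,α)`. -/
abbrev U := RingQuot (Rel k lam mu alp)

/-- The quotient map. -/
noncomputable abbrev mk : FreeAlgebra k Gen →ₐ[k] U k lam mu alp :=
  RingQuot.mkAlgHom k (Rel k lam mu alp)

/-- The image of the monomial `p1^i p2^j q1^k q2^l a^e b^f c^g d^h` in `U_39(λ,μ,α)`. -/
noncomputable def mono (e : Gen → Fin 2) : U k lam mu alp :=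
  mk k lam mu alp
    (g k p1 ^ (e p1).val * g k p2 ^ (e p2).val * g k q1 ^ (e q1).val * g k q2 ^ (e q2).val *
      g k a ^ (e a).val * g k b ^ (e b).val * g k c ^ (e c).val * g k d ^ (e d).val)

section System

variable {k} {B : Type*} [Ring B] [Algebra k B]

/-- The evaluation `r₀ + r₁ a + r₂ bc + r₃ abc`. -/
def evalCoeff (a b c : B) (r : Fin 4 → k) : B :=
  r 0 • (1 : B) + r 1 • a + r 2 • (b * c) + r 3 • (a * b * c)

/-- The `H`-relations for four elements of a ring. -/
structure HRelations (a b c d : B) : Prop where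
  aa : a * a = 1
  bb : b * b = 1
  cc : c * c = 1
  ab : a * b = b * a
  ac : a * c = c * a
  bc : b * c = c * b
  dd : d * d = a
  da : d * a = a * d
  db : d * b = c * d
  dc : d * c = b * d

/-- Elements `x i` which commute with `a, b, c, d` up to the signs `s i, t i` and whose
anticommutators are the elements `q i j` of the span of `1, a, bc, abc`. -/
structure CliffordRelations {n : ℕ} (s t : Fin n → k) (q : Fin n → Fin n → Fin 4 → k)
    (a b c d : B) (x : Fin n → B) : Prop extends HRelations a b c d where
  ax : ∀ i, a * x i = x i * a
  bx : ∀ i, b * x i = s i • (x i * b)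
  cx : ∀ i, c * x i = s i • (x i * c)
  dx : ∀ i, d * x i = t i • (x i * d)
  xx : ∀ i j, x i * x j + x j * x i = evalCoeff a b c (q i j)

/-- Compatibility conditions on the parameters of `CliffordRelations`. -/
structure Admissible {n : ℕ} (s t : Fin n → k) (q : Fin n → Fin n → Fin 4 → k) : Prop where
  ss : ∀ i, s i * s i = 1
  tt : ∀ i, t i * t i = 1
  symm : ∀ i j, q i j = q j i
  eq_zero : ∀ i j, s i ≠ s j ∨ t i ≠ t j → q i j = 0

/-- The monomial in the `x i`. -/
def xMono {n : ℕ} (x : Fin n → B) (f : Fin n → Fin 2) : B :=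
  (List.ofFn fun i => x i ^ (f i).val).prod

/-- The monomial in `a, b, c, d`. -/
def hMono (a b c d : B) (f : Fin 4 → Fin 2) : B :=
  a ^ (f 0).val * b ^ (f 1).val * c ^ (f 2).val * d ^ (f 3).val

/-- The family of all ordered monomials. -/
def fullMono {n : ℕ} (a b c d : B) (x : Fin n → B) (f : (Fin n → Fin 2) × (Fin 4 → Fin 2)) : B :=
  xMono x f.1 * hMono a b c d f.2

lemma xMono_succ {n : ℕ} (x : Fin (n + 1) → B) (f : Fin (n + 1) → Fin 2) :
    xMono x f = x 0 ^ (f 0).val * xMono (fun i => x i.succ) (fun i => f i.succ) := by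
  simp [xMono, List.ofFn_succ]

lemma CliffordRelations.tail {n : ℕ} {s t : Fin (n + 1) → k}
    {q : Fin (n + 1) → Fin (n + 1) → Fin 4 → k} {a b c d : B} {x : Fin (n + 1) → B}
    (h : CliffordRelations s t q a b c d x) :
    CliffordRelations (fun i => s i.succ) (fun i => t i.succ) (fun i j => q i.succ j.succ)
      a b c d (fun i => x i.succ) where
  toHRelations := h.toHRelations
  ax _ := h.ax _
  bx _ := h.bx _
  cx _ := h.cx _
  dx _ := h.dx _
  xx _ _ := h.xx _ _

lemma Admissible.tail {n : ℕ} {s t : Fin (n + 1) → k}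
    {q : Fin (n + 1) → Fin (n + 1) → Fin 4 → k} (h : Admissible s t q) :
    Admissible (fun i => s i.succ) (fun i => t i.succ) (fun i j => q i.succ j.succ) where
  ss _ := h.ss _
  tt _ := h.tt _
  symm _ _ := h.symm _ _
  eq_zero _ _ := h.eq_zero _ _

/-! ### Spanning -/

/-- The elements whose left multiplication preserves a given subspace. -/
def leftStabilizer (S : Submodule k B) : Subalgebra k B where
  carrier := {y | ∀ m ∈ S, y * m ∈ S}
  mul_mem' {y z} hy hz m hm := by
    rw [mul_assoc]
    exact hy _ (hz _ hm)
  add_mem' {y z} hy hz m hm := by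
    rw [add_mul]
    exact S.add_mem (hy _ hm) (hz _ hm)
  algebraMap_mem' r m hm := by
    rw [← Algebra.smul_def]
    exact S.smul_mem _ hm

lemma mem_leftStabilizer_span {ι : Type*} {v : ι → B} {y : B}
    (h : ∀ i, y * v i ∈ Submodule.span k (Set.range v)) :
    y ∈ leftStabilizer (Submodule.span k (Set.range v)) := by
  intro m hm
  induction hm using Submodule.span_induction with
  | mem z hz => obtain ⟨i, rfl⟩ := hz; exact h i
  | zero => simp
  | add z w _ _ hz hw => rw [mul_add]; exact Submodule.add_mem _ hz hw
  | smul r z _ hz => rw [mul_smul_comm]; exact Submodule.smul_mem _ _ hz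

lemma evalCoeff_mem {S : Subalgebra k B} {a b c : B} (ha : a ∈ S) (hb : b ∈ S) (hc : c ∈ S)
    (r : Fin 4 → k) : evalCoeff a b c r ∈ S :=
  add_mem (add_mem (add_mem (S.smul_mem (one_mem S) _) (S.smul_mem ha _))
    (S.smul_mem (mul_mem hb hc) _)) (S.smul_mem (mul_mem (mul_mem ha hb) hc) _)

lemma HRelations.exists_mul_hMono {a b c d : B} (h : HRelations a b c d) (f : Fin 4 → Fin 2) :
    (∃ f', a * hMono a b c d f = hMono a b c d f') ∧
    (∃ f', b * hMono a b c d f = hMono a b c d f') ∧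
    (∃ f', c * hMono a b c d f = hMono a b c d f') ∧
    ∃ f', d * hMono a b c d f = hMono a b c d f' := by
  have step {y : B} (hy : y * y = 1) (i : Fin 2) : y * y ^ i.val = y ^ (i + 1).val := by
    fin_cases i <;> simp [hy]
  have hba (i : ℕ) : b * a ^ i = a ^ i * b := (Commute.pow_right h.ab.symm i : Commute b _)
  have hca (i : ℕ) : c * a ^ i = a ^ i * c := (Commute.pow_right h.ac.symm i : Commute c _)
  have hcb (i : ℕ) : c * b ^ i = b ^ i * c := (Commute.pow_right h.bc.symm i : Commute c _)
  have hda (i : ℕ) : d * a ^ i = a ^ i * d := (Commute.pow_right h.da i : Commute d _)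
  have hdb (i : ℕ) : d * b ^ i = c ^ i * d := (SemiconjBy.pow_right h.db i : SemiconjBy d _ _)
  have hdc (i : ℕ) : d * c ^ i = b ^ i * d := (SemiconjBy.pow_right h.dc i : SemiconjBy d _ _)
  have hcb' (i j : ℕ) : c ^ i * b ^ j = b ^ j * c ^ i :=
    (Commute.pow_pow h.bc.symm i j : Commute (c ^ i) _)
  have hac (i j l : ℕ) : b ^ i * c ^ j * a ^ l = a ^ l * (b ^ i * c ^ j) :=
    (((Commute.pow_pow h.ab.symm i l : Commute (b ^ i) (a ^ l)).mul_left
      (Commute.pow_pow h.ac.symm j l : Commute (c ^ j) (a ^ l))) : Commute _ _)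
  refine ⟨⟨![f 0 + 1, f 1, f 2, f 3], ?_⟩, ⟨![f 0, f 1 + 1, f 2, f 3], ?_⟩,
    ⟨![f 0, f 1, f 2 + 1, f 3], ?_⟩, ⟨![f 0 + f 3, f 2, f 1, f 3 + 1], ?_⟩⟩
  · simp only [hMono, ← mul_assoc, step h.aa]
    rfl
  · simp only [hMono, ← mul_assoc, hba]
    rw [mul_assoc (a ^ _) b, step h.bb]
    rfl
  · simp only [hMono, ← mul_assoc, hca]
    rw [mul_assoc (a ^ _) c, hcb, mul_assoc, mul_assoc, mul_assoc, ← mul_assoc c, step h.cc]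
    simp [mul_assoc]
  · have hd : d * d ^ (f 3).val = a ^ (f 3).val * d ^ (f 3 + 1).val := by
      generalize f 3 = i
      fin_cases i <;> simp [h.dd]
    have ha : a ^ (f 0).val * a ^ (f 3).val = a ^ (f 0 + f 3).val := by
      generalize f 0 = i
      generalize f 3 = j
      fin_cases i <;> fin_cases j <;> simp [h.aa]
    calc d * hMono a b c d f
        = (d * a ^ (f 0).val) * b ^ (f 1).val * c ^ (f 2).val * d ^ (f 3).val := by
          simp only [hMono, mul_assoc]
      _ = a ^ (f 0).val * (d * b ^ (f 1).val) * c ^ (f 2).val * d ^ (f 3).val := by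
          simp only [hda, mul_assoc]
      _ = a ^ (f 0).val * c ^ (f 1).val * (d * c ^ (f 2).val) * d ^ (f 3).val := by
          simp only [hdb, mul_assoc]
      _ = a ^ (f 0).val * (c ^ (f 1).val * b ^ (f 2).val) * (d * d ^ (f 3).val) := by
          simp only [hdc, mul_assoc]
      _ = a ^ (f 0).val * (b ^ (f 2).val * c ^ (f 1).val * a ^ (f 3).val) * d ^ (f 3 + 1).val := by
          simp only [hd, hcb', mul_assoc]
      _ = (a ^ (f 0).val * a ^ (f 3).val) * (b ^ (f 2).val * c ^ (f 1).val) *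
            d ^ (f 3 + 1).val := by
          simp only [hac, mul_assoc]
      _ = hMono a b c d ![f 0 + f 3, f 2, f 1, f 3 + 1] := by
          rw [ha]
          simp [hMono, mul_assoc]

lemma mul_self_eq_evalCoeff [CharZero k] {n : ℕ} {s t : Fin n → k}
    {q : Fin n → Fin n → Fin 4 → k} {a b c d : B} {x : Fin n → B}
    (h : CliffordRelations s t q a b c d x) (i : Fin n) :
    x i * x i = evalCoeff a b c ((2⁻¹ : k) • q i i) := by
  have h2 : (2 : k) ≠ 0 := two_ne_zero
  have hx : (2 : k) • (x i * x i) = evalCoeff a b c (q i i) := by rw [two_smul, h.xx]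
  rw [← inv_smul_smul₀ h2 (x i * x i), hx]
  simp [evalCoeff, smul_smul]

theorem CliffordRelations.mem_leftStabilizer [CharZero k] {a b c d : B} :
    ∀ {n : ℕ} {s t : Fin n → k} {q : Fin n → Fin n → Fin 4 → k} {x : Fin n → B},
    CliffordRelations s t q a b c d x →
    let S := leftStabilizer (Submodule.span k (Set.range (fullMono a b c d x)))
    a ∈ S ∧ b ∈ S ∧ c ∈ S ∧ d ∈ S ∧ ∀ i, x i ∈ S
  | 0, s, t, q, x, h => by
    have hmem {y : B} (hy : ∀ f, ∃ f', y * hMono a b c d f = hMono a b c d f') :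
        y ∈ leftStabilizer (Submodule.span k (Set.range (fullMono a b c d x))) := by
      refine mem_leftStabilizer_span fun f => ?_
      obtain ⟨f', hf'⟩ := hy f.2
      refine Submodule.subset_span ⟨(f.1, f'), ?_⟩
      simp [fullMono, xMono, hf']
    exact ⟨hmem fun f => (h.exists_mul_hMono f).1, hmem fun f => (h.exists_mul_hMono f).2.1,
      hmem fun f => (h.exists_mul_hMono f).2.2.1, hmem fun f => (h.exists_mul_hMono f).2.2.2,
      fun i => i.elim0⟩
  | n + 1, s, t, q, x, h => by
    obtain ⟨ha, hb, hc, hd, hx⟩ := h.tail.mem_leftStabilizer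
    set T := Submodule.span k (Set.range (fullMono a b c d fun i => x i.succ))
    set S := Submodule.span k (Set.range (fullMono a b c d x))
    have hTS : ∀ m ∈ T, m ∈ S := by
      refine fun m hm => Submodule.span_le.2 ?_ hm
      rintro _ ⟨f, rfl⟩
      refine Submodule.subset_span ⟨(Fin.cons 0 f.1, f.2), ?_⟩
      simp [fullMono, xMono_succ]
    have hxTS : ∀ m ∈ T, x 0 * m ∈ S := by
      intro m hm
      refine (Submodule.span_le (p := S.comap (LinearMap.mulLeft k (x 0)))).2 ?_ hm
      rintro _ ⟨f, rfl⟩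
      refine Submodule.subset_span ⟨(Fin.cons 1 f.1, f.2), ?_⟩
      simp [fullMono, xMono_succ, mul_assoc]
    have key {y y' y'' : B} (hy : ∀ m ∈ T, y * m ∈ S) (hy' : y' ∈ leftStabilizer T)
        (hy'' : y'' ∈ leftStabilizer T) (he : y * x 0 = x 0 * y' + y'') :
        y ∈ leftStabilizer S := by
      refine mem_leftStabilizer_span fun f => ?_
      have hw : xMono (fun i => x i.succ) (fun i => f.1 i.succ) * hMono a b c d f.2 ∈ T :=
        Submodule.subset_span ⟨(fun i => f.1 i.succ, f.2), rfl⟩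
      rw [fullMono, xMono_succ]
      rcases Fin.exists_fin_two.1 ⟨f.1 0, rfl⟩ with h0 | h0
      · simpa [h0] using hy _ hw
      · rw [h0]
        simp only [Fin.val_one, pow_one]
        rw [mul_assoc, ← mul_assoc, he, add_mul, mul_assoc]
        exact S.add_mem (hxTS _ (hy' _ hw)) (hTS _ (hy'' _ hw))
    have hz := zero_mem (leftStabilizer T)
    refine ⟨key (fun m hm => hTS _ (ha _ hm)) ha hz ?_,
      key (fun m hm => hTS _ (hb _ hm)) ((leftStabilizer T).smul_mem hb (s 0)) hz ?_,
      key (fun m hm => hTS _ (hc _ hm)) ((leftStabilizer T).smul_mem hc (s 0)) hz ?_,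
      key (fun m hm => hTS _ (hd _ hm)) ((leftStabilizer T).smul_mem hd (t 0)) hz ?_,
      Fin.cases ?_ fun i => ?_⟩
    · simp [h.ax]
    · simp [h.bx]
    · simp [h.cx]
    · simp [h.dx]
    · refine key hxTS hz (evalCoeff_mem ha hb hc ((2⁻¹ : k) • q 0 0)) ?_
      rw [mul_self_eq_evalCoeff h, mul_zero, zero_add]
    · refine key (fun m hm => hTS _ (hx i _ hm)) (neg_mem (hx i))
        (evalCoeff_mem ha hb hc (q i.succ 0)) ?_
      rw [← h.xx]
      noncomm_ring

/-! ### Linear independence -/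

lemma prod_ofFn_firstColumn {m : ℕ} (M : Fin m → Matrix (Fin 2) (Fin 2) B) (y : Fin m → B)
    (h : ∀ i, M i 0 0 = y i ∧ M i 1 0 = 0) :
    (List.ofFn M).prod 0 0 = (List.ofFn y).prod ∧ (List.ofFn M).prod 1 0 = 0 := by
  induction m with
  | zero => simp
  | succ m ih =>
    obtain ⟨h1, h2⟩ := ih (fun i => M i.succ) (fun i => y i.succ) fun i => h _
    simp [List.ofFn_succ, Matrix.mul_apply, h, h1, h2]

lemma commute_evalCoeff {a b c y : B} (ha : Commute y a) (hbc : Commute y (b * c))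
    (r : Fin 4 → k) : Commute y (evalCoeff a b c r) := by
  unfold evalCoeff
  rw [mul_assoc a b c]
  exact ((((Commute.one_right y).smul_right _).add_right (ha.smul_right _)).add_right
    (hbc.smul_right _)).add_right ((ha.mul_right hbc).smul_right _)

lemma HRelations.commute_evalCoeff {a b c d : B} (h : HRelations a b c d) (r : Fin 4 → k) :
    Commute a (evalCoeff a b c r) ∧ Commute b (evalCoeff a b c r) ∧
    Commute c (evalCoeff a b c r) ∧ Commute d (evalCoeff a b c r) := by
  have hab : Commute a b := h.ab
  have hac : Commute a c := h.ac
  have hbc : Commute b c := h.bc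
  refine ⟨Stmt13.commute_evalCoeff (.refl a) (hab.mul_right hac) r,
    Stmt13.commute_evalCoeff hab.symm ((Commute.refl b).mul_right hbc) r,
    Stmt13.commute_evalCoeff hac.symm (hbc.symm.mul_right (.refl c)) r,
    Stmt13.commute_evalCoeff h.da ?_ r⟩
  change d * (b * c) = b * c * d
  rw [← mul_assoc, h.db, mul_assoc, h.dc, ← mul_assoc, h.bc]

lemma CliffordRelations.commute_evalCoeff {n : ℕ} {s t : Fin n → k}
    {q : Fin n → Fin n → Fin 4 → k} {a b c d : B} {x : Fin n → B}
    (h : CliffordRelations s t q a b c d x) (hs : ∀ i, s i * s i = 1) (i : Fin n)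
    (r : Fin 4 → k) : Commute (x i) (evalCoeff a b c r) := by
  refine Stmt13.commute_evalCoeff (h.ax i).symm ?_ r
  change x i * (b * c) = b * c * x i
  rw [mul_assoc b c, h.cx, mul_smul_comm, ← mul_assoc b, h.bx, smul_mul_assoc, smul_smul, hs,
    one_smul, mul_assoc]

/-- The diagonal matrix with entries `y` and `r • y`. -/
def twist (r : k) (y : B) : Matrix (Fin 2) (Fin 2) B := !![y, 0; 0, r • y]

lemma twist_mul_twist (r r' : k) (y y' : B) :
    twist r y * twist r' y' = twist (r * r') (y * y') := by
  simp [twist, smul_smul]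

lemma twist_one_one : twist (1 : k) (1 : B) = 1 := by
  simp [twist, Matrix.one_fin_two]

lemma evalCoeff_twist {u : k} (hu : u * u = 1) (a b c : B) (r : Fin 4 → k) :
    evalCoeff (twist (1 : k) a) (twist u b) (twist u c) r = twist (1 : k) (evalCoeff a b c r) := by
  have e : twist (1 : k) (evalCoeff a b c r) = r 0 • twist (1 : k) (1 : B) +
      r 1 • twist (1 : k) a + r 2 • twist (1 : k) (b * c) + r 3 • twist (1 : k) (a * b * c) := by
    ext i j
    fin_cases i <;> fin_cases j <;> simp [twist, evalCoeff]
  rw [e, evalCoeff, twist_mul_twist, twist_mul_twist, twist_mul_twist, one_mul, hu, twist_one_one]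

lemma HRelations.twist {a b c d : B} (h : HRelations a b c d) {u v : k} (hu : u * u = 1)
    (hv : v * v = 1) :
    HRelations (twist (1 : k) a) (twist u b) (twist u c) (twist v d) := by
  constructor <;> simp only [twist_mul_twist, hu, hv, mul_one, one_mul, h.aa, h.bb, h.cc, h.dd,
    twist_one_one]
  · rw [h.ab]
  · rw [h.ac]
  · rw [h.bc]
  · rw [h.da]
  · rw [h.db, mul_comm]
  · rw [h.dc, mul_comm]

/-- Matrices which extend a system of `n` elements satisfying `CliffordRelations` by one element:
left multiplication on `B ⊕ x₀ B`. -/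
def extend {n : ℕ} (q : Fin (n + 1) → Fin (n + 1) → Fin 4 → k) (a b c : B) (x : Fin n → B) :
    Fin (n + 1) → Matrix (Fin 2) (Fin 2) B :=
  Fin.cons !![0, evalCoeff a b c ((2⁻¹ : k) • q 0 0); 1, 0]
    fun i => !![x i, evalCoeff a b c (q i.succ 0); 0, -x i]

theorem CliffordRelations.extend [CharZero k] {n : ℕ} {s t : Fin (n + 1) → k}
    {q : Fin (n + 1) → Fin (n + 1) → Fin 4 → k} (hq : Admissible s t q) {a b c d : B}
    {x : Fin n → B}
    (h : CliffordRelations (fun i => s i.succ) (fun i => t i.succ)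
      (fun i j => q i.succ j.succ) a b c d x) :
    CliffordRelations s t q (twist (1 : k) a) (twist (s 0) b) (twist (s 0) c) (twist (t 0) d)
      (extend q a b c x) where
  toHRelations := h.toHRelations.twist (hq.ss 0) (hq.tt 0)
  ax := by
    refine Fin.cases ?_ fun i => ?_
    · simp [Stmt13.extend, twist, ((h.toHRelations.commute_evalCoeff _).1).eq]
    · simp [Stmt13.extend, twist, ((h.toHRelations.commute_evalCoeff _).1).eq, h.ax]
  bx := by
    refine Fin.cases ?_ fun i => ?_
    · simp [Stmt13.extend, twist, ((h.toHRelations.commute_evalCoeff _).2.1).eq, smul_smul, hq.ss]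
    · have e : b * evalCoeff a b c (q i.succ 0) =
          (s i.succ * s 0) • (evalCoeff a b c (q i.succ 0) * b) := by
        by_cases hs : s i.succ = s 0
        · rw [hs, hq.ss, one_smul, ((h.toHRelations.commute_evalCoeff _).2.1).eq]
        · simp [hq.eq_zero _ _ (.inl hs), evalCoeff]
      simp [Stmt13.extend, twist, e, h.bx, smul_smul, mul_comm]
  cx := by
    refine Fin.cases ?_ fun i => ?_
    · simp [Stmt13.extend, twist, ((h.toHRelations.commute_evalCoeff _).2.2.1).eq, smul_smul,
        hq.ss]
    · have e : c * evalCoeff a b c (q i.succ 0) =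
          (s i.succ * s 0) • (evalCoeff a b c (q i.succ 0) * c) := by
        by_cases hs : s i.succ = s 0
        · rw [hs, hq.ss, one_smul, ((h.toHRelations.commute_evalCoeff _).2.2.1).eq]
        · simp [hq.eq_zero _ _ (.inl hs), evalCoeff]
      simp [Stmt13.extend, twist, e, h.cx, smul_smul, mul_comm]
  dx := by
    refine Fin.cases ?_ fun i => ?_
    · simp [Stmt13.extend, twist, ((h.toHRelations.commute_evalCoeff _).2.2.2).eq, smul_smul,
        hq.tt]
    · have e : d * evalCoeff a b c (q i.succ 0) =
          (t i.succ * t 0) • (evalCoeff a b c (q i.succ 0) * d) := by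
        by_cases ht : t i.succ = t 0
        · rw [ht, hq.tt, one_smul, ((h.toHRelations.commute_evalCoeff _).2.2.2).eq]
        · simp [hq.eq_zero _ _ (.inr ht), evalCoeff]
      simp [Stmt13.extend, twist, e, h.dx, smul_smul, mul_comm]
  xx := by
    have hx (i : Fin n) (r : Fin 4 → k) : x i * evalCoeff a b c r = evalCoeff a b c r * x i :=
      h.commute_evalCoeff (fun i => hq.ss i.succ) i r
    have hhalf (r : Fin 4 → k) : evalCoeff a b c ((2⁻¹ : k) • r) +
        evalCoeff a b c ((2⁻¹ : k) • r) = evalCoeff a b c r := by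
      rw [← two_smul k]
      simp [evalCoeff, smul_smul]
    have hxx (i j : Fin n) : x i * x j + x j * x i = evalCoeff a b c (q i.succ j.succ) := h.xx i j
    refine Fin.cases (Fin.cases ?_ fun j => ?_) fun i => Fin.cases ?_ fun j => ?_ <;>
      rw [evalCoeff_twist (hq.ss 0)]
    · simp [Stmt13.extend, twist, hhalf]
    · simp [Stmt13.extend, twist, hx, hq.symm 0]
    · simp [Stmt13.extend, twist, hx]
    · simp [Stmt13.extend, twist, hx, hxx]

lemma pow_firstColumn {M : Matrix (Fin 2) (Fin 2) B} {y : B} (h0 : M 0 0 = y) (h1 : M 1 0 = 0)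
    (i : Fin 2) : (M ^ i.val) 0 0 = y ^ i.val ∧ (M ^ i.val) 1 0 = 0 := by
  fin_cases i <;> simp [h0, h1]

lemma hMono_eq_prod (a b c d : B) (f : Fin 4 → Fin 2) :
    hMono a b c d f =
      (List.ofFn ![a ^ (f 0).val, b ^ (f 1).val, c ^ (f 2).val, d ^ (f 3).val]).prod := by
  simp [hMono, List.ofFn_succ, mul_assoc]

lemma hMono_twist_firstColumn (u v w r : k) (a b c d : B) (f : Fin 4 → Fin 2) :
    hMono (twist u a) (twist v b) (twist w c) (twist r d) f 0 0 = hMono a b c d f ∧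
    hMono (twist u a) (twist v b) (twist w c) (twist r d) f 1 0 = 0 := by
  rw [hMono_eq_prod, hMono_eq_prod]
  refine prod_ofFn_firstColumn _ _ fun i => ?_
  fin_cases i <;> exact pow_firstColumn (by simp [twist]) (by simp [twist]) _

theorem linearIndependent_extend {n : ℕ} (q : Fin (n + 1) → Fin (n + 1) → Fin 4 → k)
    (u v w r : k) {a b c d : B} {x : Fin n → B}
    (h : LinearIndependent k (fullMono a b c d x)) :
    LinearIndependent k
      (fullMono (twist u a) (twist v b) (twist w c) (twist r d) (extend q a b c x)) := by
  let L : Matrix (Fin 2) (Fin 2) B →ₗ[k] Fin 2 → B :=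
    { toFun M i := M i 0
      map_add' _ _ := rfl
      map_smul' _ _ := rfl }
  refine LinearIndependent.of_comp L ?_
  have hsingle := Pi.linearIndependent_single (R := k) (fun _ : Fin 2 => fullMono a b c d x)
    fun _ => h
  let φ (f : (Fin (n + 1) → Fin 2) × (Fin 4 → Fin 2)) :
      Σ _ : Fin 2, (Fin n → Fin 2) × (Fin 4 → Fin 2) := ⟨f.1 0, fun i => f.1 i.succ, f.2⟩
  have hφ : Function.Injective φ := by
    rintro ⟨f, f'⟩ ⟨g, g'⟩ hfg
    simp only [φ, Sigma.mk.injEq, heq_eq_eq, Prod.mk.injEq] at hfg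
    obtain ⟨h0, h1, rfl⟩ := hfg
    refine Prod.ext (funext (Fin.cases h0 fun i => congrFun h1 i)) rfl
  suffices e : L ∘ fullMono (twist u a) (twist v b) (twist w c) (twist r d) (extend q a b c x) =
      (fun ji : Σ _ : Fin 2, (Fin n → Fin 2) × (Fin 4 → Fin 2) =>
        Pi.single ji.1 (fullMono a b c d x ji.2)) ∘ φ by
    rw [e]
    exact hsingle.comp φ hφ
  funext f
  obtain ⟨hx0, hx1⟩ := prod_ofFn_firstColumn
    (fun i : Fin n => extend q a b c x i.succ ^ (f.1 i.succ).val)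
    (fun i => x i ^ (f.1 i.succ).val)
    fun i => pow_firstColumn (by simp [extend]) (by simp [extend]) _
  obtain ⟨hh0, hh1⟩ := hMono_twist_firstColumn u v w r a b c d f.2
  change L (fullMono _ _ _ _ _ f) = Pi.single (f.1 0) (fullMono a b c d x (_, f.2))
  rw [fullMono, xMono_succ, mul_assoc]
  rw [← xMono] at hx0 hx1
  have hm0 : (xMono (fun i => extend q a b c x i.succ) (fun i => f.1 i.succ) *
      hMono (twist u a) (twist v b) (twist w c) (twist r d) f.2) 0 0 =
      fullMono a b c d x (fun i => f.1 i.succ, f.2) := by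
    rw [Matrix.mul_apply, Fin.sum_univ_two, hx0, hh0, hh1, mul_zero, add_zero]
    rfl
  have hm1 : (xMono (fun i => extend q a b c x i.succ) (fun i => f.1 i.succ) *
      hMono (twist u a) (twist v b) (twist w c) (twist r d) f.2) 1 0 = 0 := by
    rw [Matrix.mul_apply, Fin.sum_univ_two, hx1, hh1, zero_mul, mul_zero, add_zero]
  generalize xMono (fun i => extend q a b c x i.succ) (fun i => f.1 i.succ) *
      hMono (twist u a) (twist v b) (twist w c) (twist r d) f.2 = M at hm0 hm1
  generalize f.1 0 = e
  funext i
  change (extend q a b c x 0 ^ e.val * M) i 0 = _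
  rw [Matrix.mul_apply, Fin.sum_univ_two, hm0, hm1]
  fin_cases e <;> fin_cases i <;> simp [extend]

end System

/-- The permutation of `(ℤ/2)³` by which `a` acts. -/
def permA : Equiv.Perm (ZMod 2 × ZMod 2 × ZMod 2) where
  toFun p := (p.1 + 1, p.2.1, p.2.2)
  invFun p := (p.1 + 1, p.2.1, p.2.2)
  left_inv := by decide
  right_inv := by decide

/-- The permutation of `(ℤ/2)³` by which `b` acts. -/
def permB : Equiv.Perm (ZMod 2 × ZMod 2 × ZMod 2) where
  toFun p := (p.1, p.2.1 + p.2.2, p.2.2)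
  invFun p := (p.1, p.2.1 + p.2.2, p.2.2)
  left_inv := by decide
  right_inv := by decide

/-- The permutation of `(ℤ/2)³` by which `c` acts. -/
def permC : Equiv.Perm (ZMod 2 × ZMod 2 × ZMod 2) where
  toFun p := (p.1, p.2.1 + p.2.2 + 1, p.2.2)
  invFun p := (p.1, p.2.1 + p.2.2 + 1, p.2.2)
  left_inv := by decide
  right_inv := by decide

/-- The permutation of `(ℤ/2)³` by which `d` acts. -/
def permD : Equiv.Perm (ZMod 2 × ZMod 2 × ZMod 2) where
  toFun p := (p.1 + p.2.2, p.2.1, p.2.2 + 1)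
  invFun p := (p.1 + p.2.2 + 1, p.2.1, p.2.2 + 1)
  left_inv := by decide
  right_inv := by decide

lemma perm_mono_injective : Function.Injective fun f : Fin 4 → Fin 2 =>
    permA ^ (f 0).val * permB ^ (f 1).val * permC ^ (f 2).val * permD ^ (f 3).val := by
  have key : ∀ e₀ e₁ e₂ e₃ f₀ f₁ f₂ f₃ : Fin 2,
      (permA ^ e₀.val * permB ^ e₁.val * permC ^ e₂.val * permD ^ e₃.val) (0, 0, 0) =
        (permA ^ f₀.val * permB ^ f₁.val * permC ^ f₂.val * permD ^ f₃.val) (0, 0, 0) →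
      (permA ^ e₀.val * permB ^ e₁.val * permC ^ e₂.val * permD ^ e₃.val) (0, 0, 1) =
        (permA ^ f₀.val * permB ^ f₁.val * permC ^ f₂.val * permD ^ f₃.val) (0, 0, 1) →
      e₀ = f₀ ∧ e₁ = f₁ ∧ e₂ = f₂ ∧ e₃ = f₃ := by
    decide
  intro e f h
  obtain ⟨h0, h1, h2, h3⟩ := key _ _ _ _ _ _ _ _ (DFunLike.congr_fun h _) (DFunLike.congr_fun h _)
  funext i
  fin_cases i <;> assumption

lemma hRelations_perm :
    HRelations (MonoidAlgebra.of k _ permA) (MonoidAlgebra.of k _ permB)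
      (MonoidAlgebra.of k _ permC) (MonoidAlgebra.of k _ permD) := by
  constructor <;> simp only [← map_mul, ← map_one (MonoidAlgebra.of k _)] <;> congr 1 <;>
    exact Equiv.ext (by decide)

lemma linearIndependent_hMono_perm : LinearIndependent k
    (hMono (MonoidAlgebra.of k _ permA) (MonoidAlgebra.of k _ permB)
      (MonoidAlgebra.of k _ permC) (MonoidAlgebra.of k _ permD)) := by
  have h : LinearIndependent k (MonoidAlgebra.of k (Equiv.Perm (ZMod 2 × ZMod 2 × ZMod 2))) :=
    (MonoidAlgebra.basis _ k).linearIndependent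
  convert h.comp _ perm_mono_injective using 1
  funext f
  simp only [hMono, Function.comp_apply, map_mul, map_pow]

theorem exists_cliffordRelations {k : Type u} [Field k] [CharZero k] : ∀ {n : ℕ}
    {s t : Fin n → k} {q : Fin n → Fin n → Fin 4 → k}, Admissible s t q →
    ∃ (B : Type u) (_ : Ring B) (_ : Algebra k B) (a b c d : B) (x : Fin n → B),
      CliffordRelations s t q a b c d x ∧ LinearIndependent k (fullMono a b c d x)
  | 0, s, t, q, _ => by
    refine ⟨MonoidAlgebra k (Equiv.Perm (ZMod 2 × ZMod 2 × ZMod 2)), inferInstance, inferInstance,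
      MonoidAlgebra.of k _ permA, MonoidAlgebra.of k _ permB, MonoidAlgebra.of k _ permC,
      MonoidAlgebra.of k _ permD, Fin.elim0, ⟨hRelations_perm k, fun i => i.elim0,
        fun i => i.elim0, fun i => i.elim0, fun i => i.elim0, fun i => i.elim0⟩, ?_⟩
    have hinj : Function.Injective
        (Prod.snd : (Fin 0 → Fin 2) × (Fin 4 → Fin 2) → (Fin 4 → Fin 2)) := fun e f h =>
      Prod.ext (Subsingleton.elim _ _) h
    suffices e : fullMono (MonoidAlgebra.of k _ permA) (MonoidAlgebra.of k _ permB)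
        (MonoidAlgebra.of k _ permC) (MonoidAlgebra.of k _ permD) Fin.elim0 =
        hMono (MonoidAlgebra.of k _ permA) (MonoidAlgebra.of k _ permB)
          (MonoidAlgebra.of k _ permC) (MonoidAlgebra.of k _ permD) ∘ Prod.snd by
      rw [e]
      exact (linearIndependent_hMono_perm k).comp _ hinj
    funext f
    simp [fullMono, xMono]
  | n + 1, s, t, q, hq => by
    obtain ⟨B, _, _, a, b, c, d, x, h, hli⟩ := exists_cliffordRelations hq.tail
    exact ⟨Matrix (Fin 2) (Fin 2) B, inferInstance, inferInstance, _, _, _, _, _, h.extend hq,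
      linearIndependent_extend q _ _ _ _ hli⟩

/-! ### The algebra `U_39(λ,μ,α)` -/

/-- The anticommutators of `p1, p2, q1, q2`. -/
def anticomm (lam mu alp : k) : Fin 4 → Fin 4 → Fin 4 → k :=
  ![![![-4 * lam, 2 * lam, 0, 2 * lam], 0, ![alp, 0, -alp, 0], 0],
    ![0, ![0, -2 * lam, 0, 2 * lam], 0, ![alp, 0, -alp, 0]],
    ![![alp, 0, -alp, 0], 0, ![-4 * mu, 2 * mu, 0, 2 * mu], 0],
    ![0, ![alp, 0, -alp, 0], 0, ![0, -2 * mu, 0, 2 * mu]]]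

section evalCoeff

variable {k} {B : Type*} [Ring B] [Algebra k B] (u v w : B) (r : k)

lemma evalCoeff_zero : evalCoeff u v w (0 : Fin 4 → k) = 0 := by
  simp [evalCoeff]

lemma evalCoeff_one_sub : evalCoeff u v w ![r, 0, -r, 0] = r • (1 - v * w) := by
  simp [evalCoeff, sub_eq_add_neg]

lemma evalCoeff_mul_sub : evalCoeff u v w ![0, -2 * r, 0, 2 * r] =
    r • (u * v * w - u) + r • (u * v * w - u) := by
  simp only [evalCoeff, Matrix.cons_val]
  module

lemma evalCoeff_mul_add_sub : evalCoeff u v w ![-4 * r, 2 * r, 0, 2 * r] =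
    r • (u * v * w + u - 2) + r • (u * v * w + u - 2) := by
  rw [show (2 : B) = (2 : k) • 1 by rw [two_smul, one_add_one_eq_two]]
  simp only [evalCoeff, Matrix.cons_val]
  module

end evalCoeff

lemma admissible_anticomm :
    Admissible ![-1, 1, -1, 1] ![1, -1, 1, -1] (anticomm k lam mu alp) where
  ss i := by fin_cases i <;> simp
  tt i := by fin_cases i <;> simp
  symm i j := by fin_cases i <;> fin_cases j <;> rfl
  eq_zero i j h := by fin_cases i <;> fin_cases j <;> first | rfl | simp at h

/-- The images of the generators under a homomorphism respecting the defining relations. -/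
lemma cliffordRelations_of_rel {B : Type*} [Ring B] [Algebra k B] (φ : FreeAlgebra k Gen →ₐ[k] B)
    (rel : ∀ {y z}, Rel k lam mu alp y z → φ y = φ z) :
    CliffordRelations ![-1, 1, -1, 1] ![1, -1, 1, -1] (anticomm k lam mu alp)
      (φ (g k a)) (φ (g k b)) (φ (g k c)) (φ (g k d))
      ![φ (g k p1), φ (g k p2), φ (g k q1), φ (g k q2)] := by
  have add_self {y z : FreeAlgebra k Gen} (h : Rel k lam mu alp y z) :
      φ y + φ y = φ z + φ z := by
    rw [rel h]
  have two : φ 2 = 2 := map_ofNat φ 2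
  refine ⟨?_, ?_, ?_, ?_, ?_, ?_⟩
  · constructor <;> simp only [← map_mul, ← map_one φ] <;> exact rel (by constructor)
  · intro i
    fin_cases i
    exacts [by simpa using rel .ap1, by simpa using rel .ap2, by simpa using rel .aq1,
      by simpa using rel .aq2]
  · intro i
    fin_cases i
    exacts [by simpa using rel .bp1, by simpa using rel .bp2, by simpa using rel .bq1,
      by simpa using rel .bq2]
  · intro i
    fin_cases i
    exacts [by simpa using rel .cp1, by simpa using rel .cp2, by simpa using rel .cq1,
      by simpa using rel .cq2]
  · intro i
    fin_cases i
    exacts [by simpa using rel .dp1, by simpa using rel .dp2, by simpa using rel .dq1,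
      by simpa using rel .dq2]
  · intro i j
    fin_cases i <;> fin_cases j <;>
      simp only [anticomm, Fin.zero_eta, Fin.mk_one, Fin.reduceFinMk, Matrix.cons_val,
        evalCoeff_mul_add_sub, evalCoeff_mul_sub, evalCoeff_one_sub, evalCoeff_zero]
    exacts [by simpa [two] using add_self .p1p1,
      by simpa using rel .p1p2,
      by simpa using rel .p1q1,
      by simpa using rel .p1q2,
      by simpa [add_comm] using rel .p1p2,
      by simpa using add_self .p2p2,
      by simpa using rel .p2q1,
      by simpa using rel .p2q2,
      by simpa [add_comm] using rel .p1q1,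
      by simpa [add_comm] using rel .p2q1,
      by simpa [two] using add_self .q1q1,
      by simpa using rel .q1q2,
      by simpa [add_comm] using rel .p1q2,
      by simpa [add_comm] using rel .p2q2,
      by simpa [add_comm] using rel .q1q2,
      by simpa using add_self .q2q2]

lemma cliffordRelations_mk :
    CliffordRelations ![-1, 1, -1, 1] ![1, -1, 1, -1] (anticomm k lam mu alp)
      (mk k lam mu alp (g k a)) (mk k lam mu alp (g k b)) (mk k lam mu alp (g k c))
      (mk k lam mu alp (g k d))
      ![mk k lam mu alp (g k p1), mk k lam mu alp (g k p2), mk k lam mu alp (g k q1),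
        mk k lam mu alp (g k q2)] :=
  cliffordRelations_of_rel k lam mu alp (mk k lam mu alp) fun h => RingQuot.mkAlgHom_rel k h

/-- Exponent vectors, split according to the two groups of generators. -/
def exponentEquiv : (Gen → Fin 2) ≃ (Fin 4 → Fin 2) × (Fin 4 → Fin 2) where
  toFun e := (![e p1, e p2, e q1, e q2], ![e a, e b, e c, e d])
  invFun f := fun
    | p1 => f.1 0 | p2 => f.1 1 | q1 => f.1 2 | q2 => f.1 3
    | a => f.2 0 | b => f.2 1 | c => f.2 2 | d => f.2 3
  left_inv e := by
    funext i
    cases i <;> rfl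
  right_inv f := by
    refine Prod.ext (funext fun i => ?_) (funext fun i => ?_) <;> fin_cases i <;> rfl

lemma mono_eq_fullMono : mono k lam mu alp =
    fullMono (mk k lam mu alp (g k a)) (mk k lam mu alp (g k b)) (mk k lam mu alp (g k c))
      (mk k lam mu alp (g k d))
      ![mk k lam mu alp (g k p1), mk k lam mu alp (g k p2), mk k lam mu alp (g k q1),
        mk k lam mu alp (g k q2)] ∘ exponentEquiv := by
  funext e
  simp [mono, fullMono, xMono, hMono, exponentEquiv, List.ofFn_succ, mul_assoc]

/-- A system of elements satisfying the relations defines a representation of `U_39(λ,μ,α)`. -/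
lemma exists_lift [CharZero k] {B : Type*} [Ring B] [Algebra k B] {a' b' c' d' : B}
    {x : Fin 4 → B}
    (h : CliffordRelations ![-1, 1, -1, 1] ![1, -1, 1, -1] (anticomm k lam mu alp) a' b' c' d' x) :
    ∃ φ : U k lam mu alp →ₐ[k] B,
      ∀ e, φ (mono k lam mu alp e) = fullMono a' b' c' d' x (exponentEquiv e) := by
  let v : Gen → B := fun
    | a => a' | b => b' | c => c' | d => d' | p1 => x 0 | p2 => x 1 | q1 => x 2 | q2 => x 3
  have half {m m' : B} (h : m + m = m' + m') : m = m' := by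
    rw [← two_smul k, ← two_smul k m'] at h
    exact smul_right_injective B (two_ne_zero (α := k)) h
  have hv : ∀ ⦃y z⦄, Rel k lam mu alp y z → FreeAlgebra.lift k v y = FreeAlgebra.lift k v z := by
    intro y z hyz
    cases hyz <;> simp only [map_mul, map_one, map_neg, map_add, map_sub, map_smul, map_zero,
      map_ofNat, FreeAlgebra.lift_ι_apply, v]
    exacts [h.aa, h.bb, h.cc, h.ab, h.ac, h.bc, h.dd, h.da, h.db, h.dc,
      by simpa using h.ax 0, by simpa using h.bx 0, by simpa using h.cx 0, by simpa using h.dx 0,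
      by simpa using h.ax 1, by simpa using h.bx 1, by simpa using h.cx 1, by simpa using h.dx 1,
      by simpa using h.ax 2, by simpa using h.bx 2, by simpa using h.cx 2, by simpa using h.dx 2,
      by simpa using h.ax 3, by simpa using h.bx 3, by simpa using h.cx 3, by simpa using h.dx 3,
      half ((h.xx 0 0).trans (evalCoeff_mul_add_sub ..)),
      half ((h.xx 1 1).trans (evalCoeff_mul_sub ..)),
      (h.xx 0 1).trans (evalCoeff_zero ..),
      half ((h.xx 2 2).trans (evalCoeff_mul_add_sub ..)),
      half ((h.xx 3 3).trans (evalCoeff_mul_sub ..)),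
      (h.xx 2 3).trans (evalCoeff_zero ..),
      (h.xx 0 2).trans (evalCoeff_one_sub ..),
      (h.xx 1 3).trans (evalCoeff_one_sub ..),
      (h.xx 0 3).trans (evalCoeff_zero ..),
      (h.xx 1 2).trans (evalCoeff_zero ..)]
  refine ⟨RingQuot.liftAlgHom k ⟨FreeAlgebra.lift k v, hv⟩, fun e => ?_⟩
  simp [mono, fullMono, xMono, hMono, exponentEquiv, List.ofFn_succ, mul_assoc, v]

theorem thm [IsAlgClosed k] [CharZero k] (lam mu alp : k) :
    Module.finrank k (U k lam mu alp) = 256 ∧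
    LinearIndependent k (mono k lam mu alp) ∧
    Submodule.span k (Set.range (mono k lam mu alp)) = ⊤ := by
  have h := cliffordRelations_mk k lam mu alp
  have hspan : Submodule.span k (Set.range (mono k lam mu alp)) = ⊤ := by
    rw [mono_eq_fullMono, exponentEquiv.surjective.range_comp]
    obtain ⟨ha, hb, hc, hd, hx⟩ := h.mem_leftStabilizer
    refine Submodule.eq_top_iff'.2 fun u => ?_
    obtain ⟨w, rfl⟩ := RingQuot.mkAlgHom_surjective k (Rel k lam mu alp) u
    rw [← mul_one (RingQuot.mkAlgHom k (Rel k lam mu alp) w)]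
    refine (?_ : mk k lam mu alp w ∈ leftStabilizer _) 1 (Submodule.subset_span ⟨(0, 0), ?_⟩)
    · induction w using FreeAlgebra.induction with
      | grade0 r => simp
      | grade1 i =>
        cases i
        exacts [ha, hb, hc, hd, hx 0, hx 1, hx 2, hx 3]
      | mul y z hy hz => simpa using mul_mem hy hz
      | add y z hy hz => simpa using add_mem hy hz
    · simp [fullMono, xMono, hMono]
  have hli : LinearIndependent k (mono k lam mu alp) := by
    obtain ⟨B, _, _, a', b', c', d', x, hB, hv⟩ :=
      exists_cliffordRelations (admissible_anticomm k lam mu alp)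
    obtain ⟨φ, hφ⟩ := exists_lift k lam mu alp hB
    refine LinearIndependent.of_comp φ.toLinearMap ?_
    rw [show φ.toLinearMap ∘ mono k lam mu alp = fullMono a' b' c' d' x ∘ exponentEquiv from funext hφ]
    exact hv.comp _ exponentEquiv.injective
  refine ⟨?_, hli, hspan⟩
  rw [Module.finrank_eq_nat_card_basis (Module.Basis.mk hli hspan.ge),
    Nat.card_congr exponentEquiv]
  simp

end Stmt13
end

section
/- For all λ, μ, α ∈ k, the algebra U_41(λ,μ,α) is 256-dimensional over k; the images of the monomials p1^i p2^j q1^k q2^l a^e b^f c^g d^h with i, j, k, l, e, f, g, h ∈ {0,1} form a k-basis. -/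
namespace Stmt14

/-- The generators `a, b, c, d, p1, p2, q1, q2`. -/
inductive Gen | a | b | c | d | p1 | p2 | q1 | q2

open Gen

variable (k : Type*) [Field k]

/-- The generators viewed inside the free algebra. -/
abbrev g (x : Gen) : FreeAlgebra k Gen := FreeAlgebra.ι k x

variable (lam mu alp : k)

/-- The defining relations of `U_41(λ,μ,α)`: the `H`-relations together with the listed
relations involving `p1, p2, q1, q2`. -/
inductive Rel : FreeAlgebra k Gen → FreeAlgebra k Gen → Prop
  -- H-relations
  | haa : Rel (g k a * g k a) 1
  | hbb : Rel (g k b * g k b) 1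
  | hcc : Rel (g k c * g k c) 1
  | hab : Rel (g k a * g k b) (g k b * g k a)
  | hac : Rel (g k a * g k c) (g k c * g k a)
  | hbc : Rel (g k b * g k c) (g k c * g k b)
  | hdd : Rel (g k d * g k d) (g k a)
  | hda : Rel (g k d * g k a) (g k a * g k d)
  | hdb : Rel (g k d * g k b) (g k c * g k d)
  | hdc : Rel (g k d * g k c) (g k b * g k d)
  | ap1 : Rel (g k a * g k p1) (g k p1 * g k a)
  | bp1 : Rel (g k b * g k p1) (g k p1 * g k b)
  | cp1 : Rel (g k c * g k p1) (g k p1 * g k c)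
  | dp1 : Rel (g k d * g k p1) (-(g k p1 * g k d))
  | ap2 : Rel (g k a * g k p2) (g k p2 * g k a)
  | bp2 : Rel (g k b * g k p2) (-(g k p2 * g k b))
  | cp2 : Rel (g k c * g k p2) (-(g k p2 * g k c))
  | dp2 : Rel (g k d * g k p2) (-(g k p2 * g k d))
  | aq1 : Rel (g k a * g k q1) (g k q1 * g k a)
  | bq1 : Rel (g k b * g k q1) (g k q1 * g k b)
  | cq1 : Rel (g k c * g k q1) (g k q1 * g k c)
  | dq1 : Rel (g k d * g k q1) (-(g k q1 * g k d))
  | aq2 : Rel (g k a * g k q2) (g k q2 * g k a)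
  | bq2 : Rel (g k b * g k q2) (-(g k q2 * g k b))
  | cq2 : Rel (g k c * g k q2) (-(g k q2 * g k c))
  | dq2 : Rel (g k d * g k q2) (-(g k q2 * g k d))
  | p1p1 : Rel (g k p1 * g k p1) (lam • (g k a * g k b * g k c + g k a - 2))
  | p2p2 : Rel (g k p2 * g k p2) (lam • (g k a - g k a * g k b * g k c))
  | p1p2 : Rel (g k p1 * g k p2 + g k p2 * g k p1) (0)
  | q1q1 : Rel (g k q1 * g k q1) (mu • (g k a * g k b * g k c + g k a - 2))
  | q2q2 : Rel (g k q2 * g k q2) (mu • (g k a - g k a * g k b * g k c))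
  | q1q2 : Rel (g k q1 * g k q2 + g k q2 * g k q1) (0)
  | p1q1 : Rel (g k p1 * g k q1 + g k q1 * g k p1) (alp • (g k a * g k b * g k c + g k a - 2))
  | p2q2 : Rel (g k p2 * g k q2 + g k q2 * g k p2) (alp • (g k a - g k a * g k b * g k c))
  | p1q2 : Rel (g k p1 * g k q2 + g k q2 * g k p1) (0)
  | p2q1 : Rel (g k p2 * g k q1 + g k q1 * g k p2) (0)

/-- The algebra `U_41(λ,μ,α)`. -/
abbrev U := RingQuot (Rel k lam mu alp)

/-- The quotient map. -/
noncomputable abbrev mk : FreeAlgebra k Gen →ₐ[k] U k lam mu alp :=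
  RingQuot.mkAlgHom k (Rel k lam mu alp)

/-- The image of the monomial `p1^i p2^j q1^k q2^l a^e b^f c^g d^h` in `U_41(λ,μ,α)`. -/
noncomputable def mono (e : Gen → Fin 2) : U k lam mu alp :=
  mk k lam mu alp
    (g k p1 ^ (e p1).val * g k p2 ^ (e p2).val * g k q1 ^ (e q1).val * g k q2 ^ (e q2).val *
      g k a ^ (e a).val * g k b ^ (e b).val * g k c ^ (e c).val * g k d ^ (e d).val)

section Representation

/-- The underlying space of the regular representation: families of coefficients of
`p1^i p2^j q1^m q2^n a^e b^f c^g d^h`. -/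
abbrev V := Bool → Bool → Bool → Bool → Bool → Bool → Bool → Bool → k

/-- The sign attached to an exponent. -/
def sgn : Bool → k
  | true => -1
  | false => 1

/-- Multiplication by `a b c + a - 2` on coefficients. -/
def tMul (F : V k) : V k := fun i j m n e f g h =>
  F i j m n (!e) (!f) (!g) h + F i j m n (!e) f g h - (F i j m n e f g h + F i j m n e f g h)

/-- Multiplication by `a - a b c` on coefficients. -/
def sMul (F : V k) : V k := fun i j m n e f g h =>
  F i j m n (!e) f g h - F i j m n (!e) (!f) (!g) h

/-- Left multiplication by a generator on coefficients. -/
def opFun : Gen → V k → V k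
  | .a, F => fun i j m n e f g h => F i j m n (!e) f g h
  | .b, F => fun i j m n e f g h => sgn k j * sgn k n * F i j m n e (!f) g h
  | .c, F => fun i j m n e f g h => sgn k j * sgn k n * F i j m n e f (!g) h
  | .d, F => fun i j m n e f g h =>
      sgn k i * sgn k j * sgn k m * sgn k n * F i j m n (if h then e else !e) g f (!h)
  | .p1, F => fun i j m n e f g h =>
      if i then F false j m n e f g h else lam * tMul k F true j m n e f g h
  | .p2, F => fun i j m n e f g h => sgn k i *
      (if j then F i false m n e f g h else lam * sMul k F i true m n e f g h)
  | .q1, F => fun i j m n e f g h => sgn k i * sgn k j *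
      (if m then F i j false n e f g h else mu * tMul k F i j true n e f g h) +
      (if i then 0 else alp * tMul k F true j m n e f g h)
  | .q2, F => fun i j m n e f g h => sgn k i * sgn k j * sgn k m *
      (if n then F i j m false e f g h else mu * sMul k F i j m true e f g h) +
      sgn k i * (if j then 0 else alp * sMul k F i true m n e f g h)

/-- Left multiplication by a generator, as a linear map. -/
def op (x : Gen) : Module.End k (V k) where
  toFun := opFun k lam mu alp x
  map_add' F G := by
    funext i j m n e f g h
    cases x <;> simp only [opFun, tMul, sMul, Pi.add_apply] <;> (try split_ifs) <;> ring
  map_smul' r F := by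
    funext i j m n e f g h
    cases x <;> simp only [opFun, tMul, sMul, Pi.smul_apply, smul_eq_mul, RingHom.id_apply] <;>
      (try split_ifs) <;> ring

/-- The representation of the free algebra on coefficients. -/
noncomputable def freeRep : FreeAlgebra k Gen →ₐ[k] Module.End k (V k) :=
  FreeAlgebra.lift k (op k lam mu alp)

lemma op_apply (x : Gen) (F : V k) : op k lam mu alp x F = opFun k lam mu alp x F := rfl

lemma two_apply (F : V k) : (2 : Module.End k (V k)) F = F + F := by
  rw [← one_add_one_eq_two, LinearMap.add_apply, Module.End.one_apply]

set_option maxHeartbeats 4000000 in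
lemma freeRep_rel ⦃x y : FreeAlgebra k Gen⦄ (hxy : Rel k lam mu alp x y) :
    freeRep k lam mu alp x = freeRep k lam mu alp y := by
  refine LinearMap.ext fun F => ?_
  funext i j m n e f g h
  cases hxy <;>
    simp only [freeRep, map_mul, map_add, map_sub, map_neg, map_smul, map_one, map_zero, map_ofNat,
      FreeAlgebra.lift_ι_apply, Module.End.mul_apply, LinearMap.add_apply, LinearMap.sub_apply,
      LinearMap.neg_apply, LinearMap.smul_apply, Module.End.one_apply, LinearMap.zero_apply,
      two_apply, op_apply, Pi.add_apply, Pi.sub_apply, Pi.neg_apply, Pi.smul_apply,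
      Pi.zero_apply, smul_eq_mul, opFun, tMul, sMul] <;>
    cases i <;> cases j <;> cases m <;> cases n <;> cases h <;> simp [sgn] <;> ring

/-- The representation of `U_41(λ,μ,α)` on coefficients. -/
noncomputable def rep : U k lam mu alp →ₐ[k] Module.End k (V k) :=
  RingQuot.liftAlgHom k ⟨freeRep k lam mu alp, freeRep_rel k lam mu alp⟩

lemma rep_mk_ι (x : Gen) : rep k lam mu alp (mk k lam mu alp (g k x)) = op k lam mu alp x := by
  simp [rep, mk, freeRep]

/-- The coefficient family of a single monomial. -/
def delta (i' j' m' n' e' f' g' h' : Bool) : V k := fun i j m n e f g h =>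
  if i = i' ∧ j = j' ∧ m = m' ∧ n = n' ∧ e = e' ∧ f = f' ∧ g = g' ∧ h = h' then 1 else 0

lemma op_d_delta : op k lam mu alp d (delta k false false false false false false false false) =
    delta k false false false false false false false true := by
  funext i j m n e f g h
  cases i <;> cases j <;> cases m <;> cases n <;> cases h <;>
    (simp [op_apply, opFun, delta, sgn]; try grind)

lemma op_c_delta (h' : Bool) :
    op k lam mu alp c (delta k false false false false false false false h') =
      delta k false false false false false false true h' := by
  funext i j m n e f g h
  cases j <;> cases n <;> simp [op_apply, opFun, delta, sgn]

lemma op_b_delta (g' h' : Bool) :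
    op k lam mu alp b (delta k false false false false false false g' h') =
      delta k false false false false false true g' h' := by
  funext i j m n e f g h
  cases j <;> cases n <;> simp [op_apply, opFun, delta, sgn]

lemma op_a_delta (f' g' h' : Bool) :
    op k lam mu alp a (delta k false false false false false f' g' h') =
      delta k false false false false true f' g' h' := by
  funext i j m n e f g h
  simp [op_apply, opFun, delta]

lemma op_q2_delta (e' f' g' h' : Bool) :
    op k lam mu alp q2 (delta k false false false false e' f' g' h') =
      delta k false false false true e' f' g' h' := by
  funext i j m n e f g h
  cases i <;> cases j <;> cases m <;> cases n <;> simp [op_apply, opFun, delta, sgn, sMul]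

lemma op_q1_delta (n' e' f' g' h' : Bool) :
    op k lam mu alp q1 (delta k false false false n' e' f' g' h') =
      delta k false false true n' e' f' g' h' := by
  funext i j m n e f g h
  cases i <;> cases j <;> cases m <;> simp [op_apply, opFun, delta, sgn, tMul]

lemma op_p2_delta (m' n' e' f' g' h' : Bool) :
    op k lam mu alp p2 (delta k false false m' n' e' f' g' h') =
      delta k false true m' n' e' f' g' h' := by
  funext i j m n e f g h
  cases i <;> cases j <;> simp [op_apply, opFun, delta, sgn, sMul]

lemma op_p1_delta (j' m' n' e' f' g' h' : Bool) :
    op k lam mu alp p1 (delta k false j' m' n' e' f' g' h') =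
      delta k true j' m' n' e' f' g' h' := by
  funext i j m n e f g h
  cases i <;> simp [op_apply, opFun, delta, tMul]

lemma op_pow_apply (x : Gen) (r : Fin 2) {v : Bool → V k}
    (hv : op k lam mu alp x (v false) = v true) :
    (op k lam mu alp x ^ r.val) (v false) = v (r == 1) := by
  fin_cases r <;> simp [hv]

lemma rep_mono_apply (e : Gen → Fin 2) :
    rep k lam mu alp (mono k lam mu alp e)
      (delta k false false false false false false false false) =
    delta k (e p1 == 1) (e p2 == 1) (e q1 == 1) (e q2 == 1)
      (e a == 1) (e b == 1) (e c == 1) (e d == 1) := by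
  simp only [mono, map_mul, map_pow, rep_mk_ι, Module.End.mul_apply]
  rw [op_pow_apply k lam mu alp d (e d) (v := delta k _ _ _ _ _ _ _) (op_d_delta k lam mu alp),
    op_pow_apply k lam mu alp c (e c) (v := fun g' => delta k _ _ _ _ _ _ g' _)
      (op_c_delta k lam mu alp _),
    op_pow_apply k lam mu alp b (e b) (v := fun f' => delta k _ _ _ _ _ f' _ _)
      (op_b_delta k lam mu alp _ _),
    op_pow_apply k lam mu alp a (e a) (v := fun e' => delta k _ _ _ _ e' _ _ _)
      (op_a_delta k lam mu alp _ _ _),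
    op_pow_apply k lam mu alp q2 (e q2) (v := fun n' => delta k _ _ _ n' _ _ _ _)
      (op_q2_delta k lam mu alp _ _ _ _),
    op_pow_apply k lam mu alp q1 (e q1) (v := fun m' => delta k _ _ m' _ _ _ _ _)
      (op_q1_delta k lam mu alp _ _ _ _ _),
    op_pow_apply k lam mu alp p2 (e p2) (v := fun j' => delta k _ j' _ _ _ _ _ _)
      (op_p2_delta k lam mu alp _ _ _ _ _ _),
    op_pow_apply k lam mu alp p1 (e p1) (v := fun i' => delta k i' _ _ _ _ _ _ _)
      (op_p1_delta k lam mu alp _ _ _ _ _ _ _)]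

/-- The coefficients of an element in the monomials. -/
noncomputable def coeffs : U k lam mu alp →ₗ[k] ((Gen → Fin 2) → k) where
  toFun u := fun e => rep k lam mu alp u
    (delta k false false false false false false false false)
    (e p1 == 1) (e p2 == 1) (e q1 == 1) (e q2 == 1) (e a == 1) (e b == 1) (e c == 1) (e d == 1)
  map_add' u v := by
    funext e
    simp
  map_smul' r u := by
    funext e
    simp

lemma beq_one_inj {r s : Fin 2} : ((r == 1) = (s == 1)) ↔ r = s := by
  revert r s
  decide

open Classical in
lemma coeffs_mono (e : Gen → Fin 2) : coeffs k lam mu alp (mono k lam mu alp e) =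
    Pi.single e 1 := by
  funext e'
  have he : (e' p1 = e p1 ∧ e' p2 = e p2 ∧ e' q1 = e q1 ∧ e' q2 = e q2 ∧
      e' a = e a ∧ e' b = e b ∧ e' c = e c ∧ e' d = e d) ↔ e' = e := by
    refine ⟨fun h => ?_, fun h => by simp [h]⟩
    funext x
    cases x <;> simp [h]
  change rep k lam mu alp (mono k lam mu alp e) _ _ _ _ _ _ _ _ _ = _
  rw [rep_mono_apply]
  simp only [delta, beq_one_inj, he, Pi.single_apply]

lemma linearIndependent_mono : LinearIndependent k (mono k lam mu alp) := by
  classical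
  refine LinearIndependent.of_comp (coeffs k lam mu alp) ?_
  have h : coeffs k lam mu alp ∘ mono k lam mu alp = fun e => Pi.single e 1 :=
    funext (coeffs_mono k lam mu alp)
  rw [h]
  exact Pi.linearIndependent_single_one _ _

instance : Fintype Gen where
  elems := ⟨[a, b, c, d, p1, p2, q1, q2], by simp⟩
  complete x := by cases x <;> simp

end Representation

section Span

variable {k} {A : Type*} [Ring A] [Algebra k A]

/-- The elements whose left multiplication preserves a subspace. -/
def stab (W : Submodule k A) : Subalgebra k A where
  carrier := {u | ∀ w ∈ W, u * w ∈ W}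
  mul_mem' hu hv w hw := by
    rw [mul_assoc]
    exact hu _ (hv _ hw)
  add_mem' hu hv w hw := by
    rw [add_mul]
    exact W.add_mem (hu _ hw) (hv _ hw)
  algebraMap_mem' r w hw := by
    rw [← Algebra.smul_def]
    exact W.smul_mem r hw

lemma mem_stab_span {S : Set A} {y : A} (h : ∀ s ∈ S, y * s ∈ Submodule.span k S) :
    y ∈ stab (Submodule.span k S) := by
  intro w hw
  induction hw using Submodule.span_induction with
  | mem s hs => exact h s hs
  | zero => simp
  | add u v _ _ hu hv =>
    rw [mul_add]
    exact Submodule.add_mem _ hu hv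
  | smul r u _ hu =>
    rw [mul_smul_comm]
    exact Submodule.smul_mem _ r hu

/-- The set `S` together with its left translate by `x`. -/
def dbl (x : A) (S : Set A) : Set A := {y | ∃ i : Fin 2, ∃ s ∈ S, y = x ^ i.val * s}

lemma subset_dbl (x : A) (S : Set A) : S ⊆ dbl x S := fun s hs => ⟨0, s, hs, by simp⟩

lemma mul_mem_span_dbl {x w : A} {S : Set A} (hw : w ∈ Submodule.span k S) :
    x * w ∈ Submodule.span k (dbl x S) := by
  induction hw using Submodule.span_induction with
  | mem s hs => exact Submodule.subset_span ⟨1, s, hs, by simp⟩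
  | zero => simp
  | add u v _ _ hu hv =>
    rw [mul_add]
    exact Submodule.add_mem _ hu hv
  | smul r u _ hu =>
    rw [mul_smul_comm]
    exact Submodule.smul_mem _ r hu

lemma mem_stab_dbl {x y r : A} {S : Set A} (ε : k) (hy : y ∈ stab (Submodule.span k S))
    (hr : r ∈ stab (Submodule.span k S)) (h : y * x = ε • (x * y) + r) :
    y ∈ stab (Submodule.span k (dbl x S)) := by
  refine mem_stab_span ?_
  rintro _ ⟨i, s, hs, rfl⟩
  have hs' : s ∈ Submodule.span k S := Submodule.subset_span hs
  have hle := Submodule.span_mono (R := k) (subset_dbl x S)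
  fin_cases i
  · simpa using hle (hy s hs')
  · have : y * (x * s) = ε • (x * (y * s)) + r * s := by
      rw [← mul_assoc, h, add_mul, smul_mul_assoc, mul_assoc]
    simpa [this] using Submodule.add_mem _
      (Submodule.smul_mem _ ε (mul_mem_span_dbl (hy s hs'))) (hle (hr s hs'))

lemma self_mem_stab_dbl {x : A} {S : Set A} (h : x * x ∈ stab (Submodule.span k S)) :
    x ∈ stab (Submodule.span k (dbl x S)) := by
  refine mem_stab_span ?_
  rintro _ ⟨i, s, hs, rfl⟩
  have hs' : s ∈ Submodule.span k S := Submodule.subset_span hs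
  fin_cases i
  · simpa using mul_mem_span_dbl (x := x) hs'
  · simpa [mul_assoc] using Submodule.span_mono (R := k) (subset_dbl x S) (h s hs')

lemma mem_stab_dbl_comm {x y : A} {S : Set A} (hy : y ∈ stab (Submodule.span k S))
    (h : y * x = x * y) : y ∈ stab (Submodule.span k (dbl x S)) :=
  mem_stab_dbl 1 hy (zero_mem _) (by simpa using h)

lemma mem_stab_dbl_anticomm {x y : A} {S : Set A} (hy : y ∈ stab (Submodule.span k S))
    (h : y * x = -(x * y)) : y ∈ stab (Submodule.span k (dbl x S)) :=
  mem_stab_dbl (-1) hy (zero_mem _) (by simpa using h)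

lemma mul_pow_fin_two {x x' y : A} (h : y * x = x' * y) (i : Fin 2) (w : A) :
    y * (x ^ i.val * w) = x' ^ i.val * (y * w) := by
  fin_cases i <;> simp [← mul_assoc, h]

lemma mul_eq_of_add_eq {x y r : A} (h : x * y + y * x = r) :
    y * x = (-1 : k) • (x * y) + r := by
  rw [← h, neg_one_smul, neg_add_cancel_left]

end Span

/-- The image of a generator in `U_41(λ,μ,α)`. -/
noncomputable def gen (x : Gen) : U k lam mu alp := mk k lam mu alp (g k x)

/-- The monomials `a^e b^f c^g d^h`. -/
def groupMonos : Set (U k lam mu alp) :=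
  dbl (gen k lam mu alp a) (dbl (gen k lam mu alp b) (dbl (gen k lam mu alp c)
    (dbl (gen k lam mu alp d) {1})))

/-- All the monomials `p1^i p2^j q1^m q2^n a^e b^f c^g d^h`. -/
def monos : Set (U k lam mu alp) :=
  dbl (gen k lam mu alp p1) (dbl (gen k lam mu alp p2) (dbl (gen k lam mu alp q1)
    (dbl (gen k lam mu alp q2) (groupMonos k lam mu alp))))

lemma monos_subset : monos k lam mu alp ⊆ Set.range (mono k lam mu alp) := by
  rintro _ ⟨i, _, ⟨j, _, ⟨m, _, ⟨n, _, ⟨e, _, ⟨f, _, ⟨g, _, ⟨h, _, rfl, rfl⟩, rfl⟩, rfl⟩, rfl⟩,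
    rfl⟩, rfl⟩, rfl⟩, rfl⟩
  refine ⟨fun
    | .p1 => i | .p2 => j | .q1 => m | .q2 => n | .a => e | .b => f | .c => g | .d => h, ?_⟩
  simp [mono, gen, mul_assoc]

lemma mk_rel {x y : FreeAlgebra k Gen} (h : Rel k lam mu alp x y) :
    mk k lam mu alp x = mk k lam mu alp y :=
  RingQuot.mkAlgHom_rel k h

lemma gen_mem_stab_groupMonos :
    gen k lam mu alp a ∈ stab (Submodule.span k (groupMonos k lam mu alp)) ∧
    gen k lam mu alp b ∈ stab (Submodule.span k (groupMonos k lam mu alp)) ∧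
    gen k lam mu alp c ∈ stab (Submodule.span k (groupMonos k lam mu alp)) ∧
    gen k lam mu alp d ∈ stab (Submodule.span k (groupMonos k lam mu alp)) := by
  have haa := mk_rel k lam mu alp .haa
  have hbb := mk_rel k lam mu alp .hbb
  have hcc := mk_rel k lam mu alp .hcc
  have hab := mk_rel k lam mu alp .hab
  have hac := mk_rel k lam mu alp .hac
  have hbc := mk_rel k lam mu alp .hbc
  have hdd := mk_rel k lam mu alp .hdd
  have hda := mk_rel k lam mu alp .hda
  have hdb := mk_rel k lam mu alp .hdb
  have hdc := mk_rel k lam mu alp .hdc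
  simp only [map_mul, map_one] at haa hbb hcc hab hac hbc hdd hda hdb hdc
  change gen k lam mu alp _ * gen k lam mu alp _ = 1 at haa hbb hcc
  change gen k lam mu alp _ * gen k lam mu alp _ = gen k lam mu alp _ * gen k lam mu alp _
    at hab hac hbc hda hdb hdc
  change gen k lam mu alp _ * gen k lam mu alp _ = gen k lam mu alp _ at hdd
  have ha : gen k lam mu alp a ∈ stab (Submodule.span k (groupMonos k lam mu alp)) :=
    self_mem_stab_dbl (by rw [haa]; exact one_mem _)
  have hb : gen k lam mu alp b ∈ stab (Submodule.span k (groupMonos k lam mu alp)) :=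
    mem_stab_dbl_comm (self_mem_stab_dbl (by rw [hbb]; exact one_mem _)) hab.symm
  have hc : gen k lam mu alp c ∈ stab (Submodule.span k (groupMonos k lam mu alp)) :=
    mem_stab_dbl_comm (mem_stab_dbl_comm (self_mem_stab_dbl (by rw [hcc]; exact one_mem _))
      hbc.symm) hac.symm
  refine ⟨ha, hb, hc, mem_stab_span ?_⟩
  have hsub : dbl (gen k lam mu alp d) {1} ⊆ groupMonos k lam mu alp :=
    (subset_dbl _ _).trans ((subset_dbl _ _).trans (subset_dbl _ _))
  rintro _ ⟨e, _, ⟨f, _, ⟨g, _, ⟨h, _, rfl, rfl⟩, rfl⟩, rfl⟩, rfl⟩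
  rw [mul_pow_fin_two hda, mul_pow_fin_two hdb, mul_pow_fin_two hdc]
  refine pow_mem ha _ _ (pow_mem hc _ _ (pow_mem hb _ _ ?_))
  fin_cases h
  · exact Submodule.subset_span (hsub ⟨1, 1, rfl, by simp⟩)
  · simpa [hdd] using ha 1 (Submodule.subset_span (hsub ⟨0, 1, rfl, by simp⟩))

lemma gen_mem_stab_monos (x : Gen) :
    gen k lam mu alp x ∈ stab (Submodule.span k (monos k lam mu alp)) := by
  obtain ⟨ha, hb, hc, hd⟩ := gen_mem_stab_groupMonos k lam mu alp
  have ap1 := mk_rel k lam mu alp .ap1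
  have bp1 := mk_rel k lam mu alp .bp1
  have cp1 := mk_rel k lam mu alp .cp1
  have dp1 := mk_rel k lam mu alp .dp1
  have ap2 := mk_rel k lam mu alp .ap2
  have bp2 := mk_rel k lam mu alp .bp2
  have cp2 := mk_rel k lam mu alp .cp2
  have dp2 := mk_rel k lam mu alp .dp2
  have aq1 := mk_rel k lam mu alp .aq1
  have bq1 := mk_rel k lam mu alp .bq1
  have cq1 := mk_rel k lam mu alp .cq1
  have dq1 := mk_rel k lam mu alp .dq1
  have aq2 := mk_rel k lam mu alp .aq2
  have bq2 := mk_rel k lam mu alp .bq2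
  have cq2 := mk_rel k lam mu alp .cq2
  have dq2 := mk_rel k lam mu alp .dq2
  have p1p1 := mk_rel k lam mu alp .p1p1
  have p2p2 := mk_rel k lam mu alp .p2p2
  have p1p2 := mk_rel k lam mu alp .p1p2
  have q1q1 := mk_rel k lam mu alp .q1q1
  have q2q2 := mk_rel k lam mu alp .q2q2
  have q1q2 := mk_rel k lam mu alp .q1q2
  have p1q1 := mk_rel k lam mu alp .p1q1
  have p2q2 := mk_rel k lam mu alp .p2q2
  have p1q2 := mk_rel k lam mu alp .p1q2
  have p2q1 := mk_rel k lam mu alp .p2q1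
  simp only [map_mul, map_add, map_neg, map_zero, map_smul, map_sub, map_ofNat]
    at ap1 bp1 cp1 dp1 ap2 bp2 cp2 dp2 aq1 bq1 cq1 dq1 aq2 bq2 cq2 dq2 p1p1 p2p2 p1p2 q1q1 q2q2
      q1q2 p1q1 p2q2 p1q2 p2q1
  have tMem {S : Set (U k lam mu alp)} (r : k)
      (ha : gen k lam mu alp a ∈ stab (Submodule.span k S))
      (hb : gen k lam mu alp b ∈ stab (Submodule.span k S))
      (hc : gen k lam mu alp c ∈ stab (Submodule.span k S)) :
      r • (gen k lam mu alp a * gen k lam mu alp b * gen k lam mu alp c + gen k lam mu alp a - 2) ∈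
        stab (Submodule.span k S) :=
    Subalgebra.smul_mem _ (sub_mem (add_mem (mul_mem (mul_mem ha hb) hc) ha) (ofNat_mem _ 2)) r
  have sMem {S : Set (U k lam mu alp)} (r : k)
      (ha : gen k lam mu alp a ∈ stab (Submodule.span k S))
      (hb : gen k lam mu alp b ∈ stab (Submodule.span k S))
      (hc : gen k lam mu alp c ∈ stab (Submodule.span k S)) :
      r • (gen k lam mu alp a - gen k lam mu alp a * gen k lam mu alp b * gen k lam mu alp c) ∈
        stab (Submodule.span k S) :=
    Subalgebra.smul_mem _ (sub_mem ha (mul_mem (mul_mem ha hb) hc)) r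
  have hq2 := self_mem_stab_dbl (q2q2 ▸ sMem mu ha hb hc)
  replace ha := mem_stab_dbl_comm ha aq2
  replace hb := mem_stab_dbl_anticomm hb bq2
  replace hc := mem_stab_dbl_anticomm hc cq2
  replace hd := mem_stab_dbl_anticomm hd dq2
  have hq1 := self_mem_stab_dbl (q1q1 ▸ tMem mu ha hb hc)
  replace hq2 := mem_stab_dbl (-1) hq2 (zero_mem _) (mul_eq_of_add_eq q1q2)
  replace ha := mem_stab_dbl_comm ha aq1
  replace hb := mem_stab_dbl_comm hb bq1
  replace hc := mem_stab_dbl_comm hc cq1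
  replace hd := mem_stab_dbl_anticomm hd dq1
  have hp2 := self_mem_stab_dbl (p2p2 ▸ sMem lam ha hb hc)
  replace hq1 := mem_stab_dbl (-1) hq1 (zero_mem _) (mul_eq_of_add_eq p2q1)
  replace hq2 := mem_stab_dbl (-1) hq2 (sMem alp ha hb hc) (mul_eq_of_add_eq p2q2)
  replace ha := mem_stab_dbl_comm ha ap2
  replace hb := mem_stab_dbl_anticomm hb bp2
  replace hc := mem_stab_dbl_anticomm hc cp2
  replace hd := mem_stab_dbl_anticomm hd dp2
  cases x
  · exact mem_stab_dbl_comm ha ap1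
  · exact mem_stab_dbl_comm hb bp1
  · exact mem_stab_dbl_comm hc cp1
  · exact mem_stab_dbl_anticomm hd dp1
  · exact self_mem_stab_dbl (p1p1 ▸ tMem lam ha hb hc)
  · exact mem_stab_dbl (-1) hp2 (zero_mem _) (mul_eq_of_add_eq p1p2)
  · exact mem_stab_dbl (-1) hq1 (tMem alp ha hb hc) (mul_eq_of_add_eq p1q1)
  · exact mem_stab_dbl (-1) hq2 (zero_mem _) (mul_eq_of_add_eq p1q2)

lemma one_mem_monos : (1 : U k lam mu alp) ∈ monos k lam mu alp := by
  iterate 8 refine subset_dbl _ _ ?_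
  rfl

lemma span_mono : Submodule.span k (Set.range (mono k lam mu alp)) = ⊤ := by
  refine eq_top_iff.2 fun u _ => Submodule.span_mono (monos_subset k lam mu alp) ?_
  obtain ⟨x, rfl⟩ := RingQuot.mkAlgHom_surjective k (Rel k lam mu alp) u
  have hx : mk k lam mu alp x ∈ stab (Submodule.span k (monos k lam mu alp)) := by
    induction x using FreeAlgebra.induction with
    | grade0 r =>
      rw [AlgHom.commutes]
      exact algebraMap_mem _ r
    | grade1 x => exact gen_mem_stab_monos k lam mu alp x
    | mul x y hx hy =>
      rw [map_mul]
      exact mul_mem (hx trivial) (hy trivial)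
    | add x y hx hy =>
      rw [map_add]
      exact add_mem (hx trivial) (hy trivial)
  simpa using hx 1 (Submodule.subset_span (one_mem_monos k lam mu alp))

theorem thm [IsAlgClosed k] [CharZero k] (lam mu alp : k) :
    Module.finrank k (U k lam mu alp) = 256 ∧
    LinearIndependent k (mono k lam mu alp) ∧
    Submodule.span k (Set.range (mono k lam mu alp)) = ⊤ := by
  classical
  refine ⟨?_, linearIndependent_mono k lam mu alp, span_mono k lam mu alp⟩
  rw [Module.finrank_eq_card_basis (Module.Basis.mk (linearIndependent_mono k lam mu alp)
    (span_mono k lam mu alp).ge), Fintype.card_fun]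
  rfl

end Stmt14
end

section
/- For all λ, μ, α ∈ k, the algebra U_42(λ,μ,α) is 256-dimensional over k; the images of the monomials p1^i p2^j q1^k q2^l a^e b^f c^g d^h with i, j, k, l, e, f, g, h ∈ {0,1} form a k-basis. -/
namespace Stmt15

/-- The generators `a, b, c, d, p1, p2, q1, q2`. -/
inductive Gen | a | b | c | d | p1 | p2 | q1 | q2

open Gen

variable (k : Type*) [Field k]

/-- The generators viewed inside the free algebra. -/
abbrev g (x : Gen) : FreeAlgebra k Gen := FreeAlgebra.ι k x

variable (lam mu alp : k)

/-- The defining relations of `U_42(λ,μ,α)`: the `H`-relations together with the listed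
relations involving `p1, p2, q1, q2`. -/
inductive Rel : FreeAlgebra k Gen → FreeAlgebra k Gen → Prop
  -- H-relations
  | haa : Rel (g k a * g k a) 1
  | hbb : Rel (g k b * g k b) 1
  | hcc : Rel (g k c * g k c) 1
  | hab : Rel (g k a * g k b) (g k b * g k a)
  | hac : Rel (g k a * g k c) (g k c * g k a)
  | hbc : Rel (g k b * g k c) (g k c * g k b)
  | hdd : Rel (g k d * g k d) (g k a)
  | hda : Rel (g k d * g k a) (g k a * g k d)
  | hdb : Rel (g k d * g k b) (g k c * g k d)
  | hdc : Rel (g k d * g k c) (g k b * g k d)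
  | ap1 : Rel (g k a * g k p1) (g k p1 * g k a)
  | bp1 : Rel (g k b * g k p1) (g k p1 * g k b)
  | cp1 : Rel (g k c * g k p1) (g k p1 * g k c)
  | dp1 : Rel (g k d * g k p1) (-(g k p1 * g k d))
  | ap2 : Rel (g k a * g k p2) (g k p2 * g k a)
  | bp2 : Rel (g k b * g k p2) (-(g k p2 * g k b))
  | cp2 : Rel (g k c * g k p2) (-(g k p2 * g k c))
  | dp2 : Rel (g k d * g k p2) (-(g k p2 * g k d))
  | aq1 : Rel (g k a * g k q1) (g k q1 * g k a)
  | bq1 : Rel (g k b * g k q1) (g k q1 * g k b)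
  | cq1 : Rel (g k c * g k q1) (g k q1 * g k c)
  | dq1 : Rel (g k d * g k q1) (-(g k q1 * g k d))
  | aq2 : Rel (g k a * g k q2) (g k q2 * g k a)
  | bq2 : Rel (g k b * g k q2) (-(g k q2 * g k b))
  | cq2 : Rel (g k c * g k q2) (-(g k q2 * g k c))
  | dq2 : Rel (g k d * g k q2) (-(g k q2 * g k d))
  | p1p1 : Rel (g k p1 * g k p1) (lam • (g k a * g k b * g k c + g k a - 2))
  | p2p2 : Rel (g k p2 * g k p2) (lam • (g k a - g k a * g k b * g k c))
  | p1p2 : Rel (g k p1 * g k p2 + g k p2 * g k p1) (0)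
  | q1q1 : Rel (g k q1 * g k q1) (mu • (g k a * g k b * g k c + g k a - 2))
  | q2q2 : Rel (g k q2 * g k q2) (mu • (g k a - g k a * g k b * g k c))
  | q1q2 : Rel (g k q1 * g k q2 + g k q2 * g k q1) (0)
  | p1q1 : Rel (g k p1 * g k q1 + g k q1 * g k p1) (alp • (1 - g k b * g k c))
  | p2q2 : Rel (g k p2 * g k q2 + g k q2 * g k p2) (-(alp • (1 - g k b * g k c)))
  | p1q2 : Rel (g k p1 * g k q2 + g k q2 * g k p1) (0)
  | p2q1 : Rel (g k p2 * g k q1 + g k q1 * g k p2) (0)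

/-- The algebra `U_42(λ,μ,α)`. -/
abbrev U := RingQuot (Rel k lam mu alp)

/-- The quotient map. -/
noncomputable abbrev mk : FreeAlgebra k Gen →ₐ[k] U k lam mu alp :=
  RingQuot.mkAlgHom k (Rel k lam mu alp)

/-- The image of the monomial `p1^i p2^j q1^k q2^l a^e b^f c^g d^h` in `U_42(λ,μ,α)`. -/
noncomputable def mono (e : Gen → Fin 2) : U k lam mu alp :=
  mk k lam mu alp
    (g k p1 ^ (e p1).val * g k p2 ^ (e p2).val * g k q1 ^ (e q1).val * g k q2 ^ (e q2).val *
      g k a ^ (e a).val * g k b ^ (e b).val * g k c ^ (e c).val * g k d ^ (e d).val)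

section Representation

/-- The sign `(-1)^i`. -/
def sgn (i : Bool) : k := cond i (-1) 1

/-- Coordinate space of the regular representation of the group algebra of `⟨a, b, c, d⟩`. -/
abbrev GroupSpace := Bool → Bool → Bool → Bool → k

/-- Coordinate space of the regular representation of `U_42(λ,μ,α)`, the exponents being ordered
as in `p1^i p2^j q1^r q2^s a^e b^f c^g d^h`. -/
abbrev RegSpace := Bool → Bool → Bool → Bool → GroupSpace k

variable {k} in
/-- The action of `abc + a - 2` on the group algebra. -/
def actS (m : GroupSpace k) : GroupSpace k :=
  fun e f g h => m (!e) (!f) (!g) h + m (!e) f g h - 2 * m e f g h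

variable {k} in
/-- The action of `a - abc` on the group algebra. -/
def actT (m : GroupSpace k) : GroupSpace k :=
  fun e f g h => m (!e) f g h - m (!e) (!f) (!g) h

variable {k} in
/-- The action of `1 - bc` on the group algebra. -/
def actZ (m : GroupSpace k) : GroupSpace k :=
  fun e f g h => m e f g h - m e (!f) (!g) h

variable {k} in
/-- The action of a generator on the coordinates of the regular representation. -/
def act : Gen → RegSpace k → RegSpace k
  | a, v => fun i j r s e f g h => v i j r s (!e) f g h
  | b, v => fun i j r s e f g h => sgn k j * sgn k s * v i j r s e (!f) g h
  | c, v => fun i j r s e f g h => sgn k j * sgn k s * v i j r s e f (!g) h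
  | d, v => fun i j r s e f g h =>
      sgn k i * sgn k j * sgn k r * sgn k s * v i j r s (e ^^ !h) g f (!h)
  | p1, v => fun i j r s e f g h =>
      cond i (v false j r s e f g h) (lam * actS (v true j r s) e f g h)
  | p2, v => fun i j r s e f g h =>
      sgn k i * cond j (v i false r s e f g h) (lam * actT (v i true r s) e f g h)
  | q1, v => fun i j r s e f g h =>
      sgn k i * sgn k j * cond r (v i j false s e f g h) (mu * actS (v i j true s) e f g h) +
        cond i 0 (alp * actZ (v true j r s) e f g h)
  | q2, v => fun i j r s e f g h =>
      sgn k i * sgn k j * sgn k r *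
          cond s (v i j r false e f g h) (mu * actT (v i j r true) e f g h) -
        cond j 0 (alp * sgn k i * actZ (v i true r s) e f g h)

/-- The operator by which a generator acts in the regular representation. -/
def op (x : Gen) : Module.End k (RegSpace k) where
  toFun := act lam mu alp x
  map_add' v w := by
    ext i j r s e f g h
    cases x
    case p1 => cases i <;> simp [act, actS]; ring
    case p2 => cases j <;> simp [act, actT] <;> ring
    case q1 => cases i <;> cases r <;> simp [act, actS, actZ] <;> ring
    case q2 => cases j <;> cases s <;> simp [act, actT, actZ] <;> ring
    all_goals simp [act, mul_add]
  map_smul' t v := by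
    ext i j r s e f g h
    cases x
    case p1 => cases i <;> simp [act, actS]; ring
    case p2 => cases j <;> simp [act, actT] <;> ring
    case q1 => cases i <;> cases r <;> simp [act, actS, actZ] <;> ring
    case q2 => cases j <;> cases s <;> simp [act, actT, actZ] <;> ring
    all_goals simp [act, mul_left_comm]

theorem op_apply (x : Gen) (v : RegSpace k) : op k lam mu alp x v = act lam mu alp x v := rfl

set_option maxHeartbeats 4000000 in
theorem op_rel {x y : FreeAlgebra k Gen} (h : Rel k lam mu alp x y) :
    FreeAlgebra.lift k (op k lam mu alp) x = FreeAlgebra.lift k (op k lam mu alp) y := by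
  have two : FreeAlgebra.lift k (op k lam mu alp) 2 = (2 : k) • 1 := by
    rw [map_ofNat, ofNat_smul_eq_nsmul, nsmul_one, Nat.cast_ofNat]
  ext v i j r s e f g o
  cases h <;> simp [op_apply, act, two] <;>
    cases i <;> cases j <;> cases r <;> cases s <;>
    simp [actS, actT, actZ, sgn] <;> ring

/-- The regular representation of `U_42(λ,μ,α)`. -/
noncomputable def rep : U k lam mu alp →ₐ[k] Module.End k (RegSpace k) :=
  RingQuot.liftAlgHom k ⟨FreeAlgebra.lift k (op k lam mu alp), fun _ _ => op_rel k lam mu alp⟩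

theorem rep_mk (x : Gen) : rep k lam mu alp (mk k lam mu alp (g k x)) = op k lam mu alp x := by
  simp [rep, mk, g]

variable {k} in
/-- The vector of the standard basis of the regular representation with the given exponents. -/
def delta (i j r s e f g h : Bool) : RegSpace k := fun i' j' r' s' e' f' g' h' =>
  if i' = i ∧ j' = j ∧ r' = r ∧ s' = s ∧ e' = e ∧ f' = f ∧ g' = g ∧ h' = h then 1 else 0

/-- An exponent in `{0, 1}` as a Boolean. -/
def bit (n : Fin 2) : Bool := decide (n = 1)

theorem bit_injective : Function.Injective bit := by decide

theorem pow_bit {v w : RegSpace k} (x : Gen) (u : Bool → RegSpace k) (h0 : u false = v)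
    (h1 : u true = w) (h : op k lam mu alp x v = w) (n : Fin 2) :
    (op k lam mu alp x ^ n.val) v = u (bit n) := by
  fin_cases n <;> simp [bit, h0, h1, h]

theorem rep_mono (m : Gen → Fin 2) :
    rep k lam mu alp (mono k lam mu alp m)
        (delta false false false false false false false false) =
      delta (bit (m p1)) (bit (m p2)) (bit (m q1)) (bit (m q2))
        (bit (m a)) (bit (m b)) (bit (m c)) (bit (m d)) := by
  have hd (n : Fin 2) := pow_bit k lam mu alp d
    (fun h => delta false false false false false false false h) rfl rfl
    (by
      ext i j r s e f g h
      cases e <;> cases h <;> simp [op_apply, act, delta, sgn]; grind) n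
  have hc (h : Bool) (n : Fin 2) := pow_bit k lam mu alp c
    (fun g => delta false false false false false false g h) rfl rfl
    (by
      ext i j r s e f g h
      cases j <;> cases s <;> simp [op_apply, act, delta, sgn]) n
  have hb (g h : Bool) (n : Fin 2) := pow_bit k lam mu alp b
    (fun f => delta false false false false false f g h) rfl rfl
    (by
      ext i j r s e f g h
      cases j <;> cases s <;> simp [op_apply, act, delta, sgn]) n
  have ha (f g h : Bool) (n : Fin 2) := pow_bit k lam mu alp a
    (fun e => delta false false false false e f g h) rfl rfl
    (by
      ext i j r s e f g h
      simp [op_apply, act, delta]) n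
  have hq2 (e f g h : Bool) (n : Fin 2) := pow_bit k lam mu alp q2
    (fun s => delta false false false s e f g h) rfl rfl
    (by
      ext i j r s e f g h
      cases i <;> cases j <;> cases r <;> cases s <;>
        simp [op_apply, act, delta, sgn, actT, actZ]) n
  have hq1 (s e f g h : Bool) (n : Fin 2) := pow_bit k lam mu alp q1
    (fun r => delta false false r s e f g h) rfl rfl
    (by
      ext i j r s e f g h
      cases i <;> cases j <;> cases r <;> simp [op_apply, act, delta, sgn, actS, actZ]) n
  have hp2 (r s e f g h : Bool) (n : Fin 2) := pow_bit k lam mu alp p2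
    (fun j => delta false j r s e f g h) rfl rfl
    (by
      ext i j r s e f g h
      cases i <;> cases j <;> simp [op_apply, act, delta, sgn, actT]) n
  have hp1 (j r s e f g h : Bool) (n : Fin 2) := pow_bit k lam mu alp p1
    (fun i => delta i j r s e f g h) rfl rfl
    (by
      ext i j r s e f g h
      cases i <;> simp [op_apply, act, delta, actS]) n
  simp only [mono, map_mul, map_pow, rep_mk, Module.End.mul_apply, hd, hc, hb, ha, hq2, hq1,
    hp2, hp1]

/-- The coordinates of a vector of the regular representation, indexed by exponent functions. -/
def coords : RegSpace k →ₗ[k] (Gen → Fin 2) → k where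
  toFun v m := v (bit (m p1)) (bit (m p2)) (bit (m q1)) (bit (m q2))
    (bit (m a)) (bit (m b)) (bit (m c)) (bit (m d))
  map_add' _ _ := rfl
  map_smul' _ _ := rfl

open Classical in
theorem coords_delta (m : Gen → Fin 2) :
    coords k (delta (bit (m p1)) (bit (m p2)) (bit (m q1)) (bit (m q2))
      (bit (m a)) (bit (m b)) (bit (m c)) (bit (m d))) = Pi.single m 1 := by
  ext m'
  simp only [coords, delta, LinearMap.coe_mk, AddHom.coe_mk, bit_injective.eq_iff,
    Pi.single_apply]
  congr 1
  refine propext ⟨fun h => ?_, fun h => by simp [h]⟩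
  ext x
  cases x <;> simp [h]

theorem linearIndependent_mono : LinearIndependent k (mono k lam mu alp) := by
  classical
  refine LinearIndependent.of_comp
    (coords k ∘ₗ (LinearMap.applyₗ (delta false false false false false false false false)) ∘ₗ
      (rep k lam mu alp).toLinearMap) ?_
  convert Pi.linearIndependent_single_one (Gen → Fin 2) k using 1
  ext1 m
  simp [rep_mono, coords_delta]

end Representation

section Spanning

variable {k} {A : Type*} [Ring A] [Algebra k A]

theorem mul_mul_of_mul_eq {u v w : A} (h : u * v = w) (x : A) : u * (v * x) = w * x := by
  rw [← mul_assoc, h]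

theorem adjoin_le_span_group {a b c d : A} (haa : a * a = 1) (hbb : b * b = 1) (hcc : c * c = 1)
    (hab : a * b = b * a) (hac : a * c = c * a) (hbc : b * c = c * b) (hdd : d * d = a)
    (hda : d * a = a * d) (hdb : d * b = c * d) (hdc : d * c = b * d) :
    Subalgebra.toSubmodule (Algebra.adjoin k {a, b, c, d}) ≤ Submodule.span k (Set.range
      fun n : Fin 2 × Fin 2 × Fin 2 × Fin 2 =>
        a ^ n.1.val * b ^ n.2.1.val * c ^ n.2.2.1.val * d ^ n.2.2.2.val) := by
  set H := Submodule.span k (Set.range fun n : Fin 2 × Fin 2 × Fin 2 × Fin 2 =>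
    a ^ n.1.val * b ^ n.2.1.val * c ^ n.2.2.1.val * d ^ n.2.2.2.val) with hH
  have mem (n : Fin 2 × Fin 2 × Fin 2 × Fin 2) :
      a ^ n.1.val * b ^ n.2.1.val * c ^ n.2.2.1.val * d ^ n.2.2.2.val ∈ H :=
    Submodule.subset_span ⟨n, rfl⟩
  simp only [Prod.forall, Fin.forall_fin_two] at mem
  simp [mul_assoc] at mem
  have step (x : A) (hx : x ∈ ({a, b, c, d} : Set A)) (y : A) (hy : y ∈ H) : x * y ∈ H := by
    suffices H ≤ H.comap (LinearMap.mulLeft k x) from this hy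
    rw [hH, Submodule.span_le, ← hH]
    rintro _ ⟨⟨e, f, g, h⟩, rfl⟩
    obtain rfl | rfl | rfl | rfl := hx <;> fin_cases e <;> fin_cases f <;> fin_cases g <;>
      fin_cases h <;>
      simp [mul_assoc, haa, hbb, hcc, hdd, hda, hdb, hdc, ← hab, ← hac, ← hbc,
        mul_mul_of_mul_eq haa, mul_mul_of_mul_eq hbb, mul_mul_of_mul_eq hcc,
        mul_mul_of_mul_eq hda, mul_mul_of_mul_eq hdb,
        mul_mul_of_mul_eq hdc, mul_mul_of_mul_eq hab.symm, mul_mul_of_mul_eq hac.symm,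
        mul_mul_of_mul_eq hbc.symm, mem]
  intro x hx
  suffices ∀ y ∈ H, x * y ∈ H by simpa using this 1 mem.1.1.1.1
  induction hx using Algebra.adjoin_induction with
  | mem x hx => exact step x hx
  | algebraMap t => exact fun y hy => by simpa [← Algebra.smul_def] using H.smul_mem t hy
  | add x x' _ _ ih ih' => exact fun y hy => by simpa [add_mul] using add_mem (ih y hy) (ih' y hy)
  | mul x x' _ _ ih ih' => exact fun y hy => by simpa [mul_assoc] using ih _ (ih' y hy)

/-- Left multiplication by `x` moves past `p` up to a scalar. -/
def QuasiCommute (k : Type*) [Field k] {A : Type*} [Ring A] [Algebra k A] (x p : A) : Prop :=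
  ∃ t : k, x * p = t • (p * x)

theorem QuasiCommute.of_commute {x p : A} (h : x * p = p * x) : QuasiCommute k x p :=
  ⟨1, by rw [h, one_smul]⟩

theorem QuasiCommute.of_anticommute {x p : A} (h : x * p = -(p * x)) : QuasiCommute k x p :=
  ⟨-1, by rw [h, neg_smul, one_smul]⟩

theorem QuasiCommute.pow {x p : A} (h : QuasiCommute k x p) (n : ℕ) :
    QuasiCommute k x (p ^ n) := by
  obtain ⟨t, ht⟩ := h
  refine ⟨t ^ n, ?_⟩
  induction n with
  | zero => simp
  | succ n ih => rw [pow_succ, ← mul_assoc, ih, smul_mul_assoc, mul_assoc, ht, mul_smul_comm,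
      smul_smul, mul_assoc, pow_succ]

theorem QuasiCommute.mul {x p q : A} (hp : QuasiCommute k x p) (hq : QuasiCommute k x q) :
    QuasiCommute k x (p * q) := by
  obtain ⟨t, ht⟩ := hp
  obtain ⟨u, hu⟩ := hq
  refine ⟨t * u, ?_⟩
  rw [← mul_assoc, ht, smul_mul_assoc, mul_assoc, hu, mul_smul_comm, smul_smul, mul_assoc]

theorem clifford_mul_mem {lam mu alp : k} {P1 P2 Q1 Q2 S T Z : A} (H : Subalgebra k A)
    (W : Submodule k A)
    (hW : ∀ i j r s : Fin 2, ∀ y ∈ H,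
      P1 ^ i.val * P2 ^ j.val * Q1 ^ r.val * Q2 ^ s.val * y ∈ W)
    (hS : S ∈ H) (hT : T ∈ H) (hZ : Z ∈ H)
    (SP2 : S * P2 = P2 * S) (SQ1 : S * Q1 = Q1 * S) (SQ2 : S * Q2 = Q2 * S)
    (TQ1 : T * Q1 = Q1 * T) (TQ2 : T * Q2 = Q2 * T)
    (ZP2 : Z * P2 = P2 * Z) (ZQ1 : Z * Q1 = Q1 * Z) (ZQ2 : Z * Q2 = Q2 * Z)
    (p1p1 : P1 * P1 = lam • S) (p2p2 : P2 * P2 = lam • T)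
    (q1q1 : Q1 * Q1 = mu • S) (q2q2 : Q2 * Q2 = mu • T)
    (p2p1 : P2 * P1 = -(P1 * P2)) (q2q1 : Q2 * Q1 = -(Q1 * Q2))
    (q1p1 : Q1 * P1 = alp • Z - P1 * Q1) (q2p2 : Q2 * P2 = -(alp • Z) - P2 * Q2)
    (q2p1 : Q2 * P1 = -(P1 * Q2)) (q1p2 : Q1 * P2 = -(P2 * Q1))
    {x : A} (hx : x ∈ ({P1, P2, Q1, Q2} : Set A)) (i j r s : Fin 2) {y : A} (hy : y ∈ H) :
    x * (P1 ^ i.val * P2 ^ j.val * Q1 ^ r.val * Q2 ^ s.val * y) ∈ W := by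
  have hSy := H.mul_mem hS hy
  have hTy := H.mul_mem hT hy
  have hZy := H.mul_mem hZ hy
  simp only [Fin.forall_fin_two] at hW
  simp [mul_assoc] at hW
  obtain rfl | rfl | rfl | rfl := hx <;> fin_cases i <;> fin_cases j <;> fin_cases r <;>
    fin_cases s <;>
    simp [mul_assoc, mul_add, mul_sub, sub_mul, mul_mul_of_mul_eq SP2, mul_mul_of_mul_eq SQ1,
      mul_mul_of_mul_eq SQ2, mul_mul_of_mul_eq TQ1, mul_mul_of_mul_eq TQ2, mul_mul_of_mul_eq ZP2,
      mul_mul_of_mul_eq ZQ1, mul_mul_of_mul_eq ZQ2, mul_mul_of_mul_eq p1p1,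
      mul_mul_of_mul_eq p2p2, mul_mul_of_mul_eq q1q1, mul_mul_of_mul_eq q2q2,
      mul_mul_of_mul_eq p2p1, mul_mul_of_mul_eq q2q1, mul_mul_of_mul_eq q1p1,
      mul_mul_of_mul_eq q2p2, mul_mul_of_mul_eq q2p1, mul_mul_of_mul_eq q1p2, hW, hy] <;>
    (repeat' first
      | refine W.add_mem ?_ ?_
      | refine W.sub_mem ?_ ?_
      | refine W.neg_mem ?_
      | refine W.smul_mem _ ?_) <;>
    simp [hW, hy, hSy, hTy, hZy]

theorem group_mul_mem {P1 P2 Q1 Q2 : A} (H : Subalgebra k A) (W : Submodule k A)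
    (hW : ∀ i j r s : Fin 2, ∀ y ∈ H,
      P1 ^ i.val * P2 ^ j.val * Q1 ^ r.val * Q2 ^ s.val * y ∈ W)
    {x : A} (hx : x ∈ H) (hP1 : QuasiCommute k x P1) (hP2 : QuasiCommute k x P2)
    (hQ1 : QuasiCommute k x Q1) (hQ2 : QuasiCommute k x Q2) (i j r s : Fin 2) {y : A}
    (hy : y ∈ H) :
    x * (P1 ^ i.val * P2 ^ j.val * Q1 ^ r.val * Q2 ^ s.val * y) ∈ W := by
  obtain ⟨t, ht⟩ := (((hP1.pow i).mul (hP2.pow j)).mul (hQ1.pow r)).mul (hQ2.pow s)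
  rw [← mul_assoc, ht, smul_mul_assoc, mul_assoc _ x y]
  exact W.smul_mem t (hW i j r s _ (H.mul_mem hx hy))

theorem commute_mul_of_anticommute {x y p : A} (hx : x * p = -(p * x)) (hy : y * p = -(p * y)) :
    Commute (x * y) p := by
  rw [commute_iff_eq, mul_assoc, hy, mul_neg, ← mul_assoc, hx, neg_mul, neg_neg, mul_assoc]

theorem commute_relators {a b c p : A} (ha : Commute a p) (hbc : Commute (b * c) p) :
    Commute (a * b * c + a - 2) p ∧ Commute (a - a * b * c) p ∧ Commute (1 - b * c) p := by
  rw [mul_assoc]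
  exact ⟨((ha.mul_left hbc).add_left ha).sub_left (Commute.ofNat_left 2 p),
    ha.sub_left (ha.mul_left hbc), (Commute.one_left p).sub_left hbc⟩

variable (k) (lam mu alp : k)

/-- The image of a generator in `U_42(λ,μ,α)`. -/
noncomputable def gen (x : Gen) : U k lam mu alp := mk k lam mu alp (g k x)

theorem mk_g (x : Gen) : mk k lam mu alp (g k x) = gen k lam mu alp x := rfl

theorem mono_eq (m : Gen → Fin 2) : mono k lam mu alp m =
    gen k lam mu alp p1 ^ (m p1).val * gen k lam mu alp p2 ^ (m p2).val *
      gen k lam mu alp q1 ^ (m q1).val * gen k lam mu alp q2 ^ (m q2).val *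
      (gen k lam mu alp a ^ (m a).val * gen k lam mu alp b ^ (m b).val *
        gen k lam mu alp c ^ (m c).val * gen k lam mu alp d ^ (m d).val) := by
  simp only [mono, map_mul, map_pow, mk_g, mul_assoc]

theorem gen_mul_mem (x : Gen) {w : U k lam mu alp}
    (hw : w ∈ Submodule.span k (Set.range (mono k lam mu alp))) :
    gen k lam mu alp x * w ∈ Submodule.span k (Set.range (mono k lam mu alp)) := by
  have rel {u v : FreeAlgebra k Gen} (h : Rel k lam mu alp u v) :
      mk k lam mu alp u = mk k lam mu alp v := RingQuot.mkAlgHom_rel k h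
  have two : mk k lam mu alp 2 = 2 := map_ofNat _ 2
  have haa := rel .haa
  have hbb := rel .hbb
  have hcc := rel .hcc
  have hab := rel .hab
  have hac := rel .hac
  have hbc := rel .hbc
  have hdd := rel .hdd
  have hda := rel .hda
  have hdb := rel .hdb
  have hdc := rel .hdc
  have ap1 := rel .ap1
  have bp1 := rel .bp1
  have cp1 := rel .cp1
  have dp1 := rel .dp1
  have ap2 := rel .ap2
  have bp2 := rel .bp2
  have cp2 := rel .cp2
  have dp2 := rel .dp2
  have aq1 := rel .aq1
  have bq1 := rel .bq1
  have cq1 := rel .cq1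
  have dq1 := rel .dq1
  have aq2 := rel .aq2
  have bq2 := rel .bq2
  have cq2 := rel .cq2
  have dq2 := rel .dq2
  have p1p1 := rel .p1p1
  have p2p2 := rel .p2p2
  have p1p2 := rel .p1p2
  have q1q1 := rel .q1q1
  have q2q2 := rel .q2q2
  have q1q2 := rel .q1q2
  have p1q1 := rel .p1q1
  have p2q2 := rel .p2q2
  have p1q2 := rel .p1q2
  have p2q1 := rel .p2q1
  simp only [map_mul, map_add, map_sub, map_neg, map_smul, map_one, map_zero, two, mk_g] at *
  set W := Submodule.span k (Set.range (mono k lam mu alp)) with hWdef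
  set H := Algebra.adjoin k {gen k lam mu alp a, gen k lam mu alp b, gen k lam mu alp c,
    gen k lam mu alp d} with hH
  have memH {y} (hy : y ∈ ({gen k lam mu alp a, gen k lam mu alp b, gen k lam mu alp c,
    gen k lam mu alp d} : Set (U k lam mu alp))) : y ∈ H := Algebra.subset_adjoin hy
  have mema : gen k lam mu alp a ∈ H := memH (by simp)
  have memb : gen k lam mu alp b ∈ H := memH (by simp)
  have memc : gen k lam mu alp c ∈ H := memH (by simp)
  have memd : gen k lam mu alp d ∈ H := memH (by simp)
  have hW (i j r s : Fin 2) (y : U k lam mu alp) (hy : y ∈ H) :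
      gen k lam mu alp p1 ^ i.val * gen k lam mu alp p2 ^ j.val *
        gen k lam mu alp q1 ^ r.val * gen k lam mu alp q2 ^ s.val * y ∈ W := by
    have hy' := adjoin_le_span_group (k := k) haa hbb hcc hab hac hbc hdd hda hdb hdc hy
    suffices Submodule.span k (Set.range fun n : Fin 2 × Fin 2 × Fin 2 × Fin 2 =>
        gen k lam mu alp a ^ n.1.val * gen k lam mu alp b ^ n.2.1.val *
          gen k lam mu alp c ^ n.2.2.1.val * gen k lam mu alp d ^ n.2.2.2.val) ≤
        W.comap (LinearMap.mulLeft k (gen k lam mu alp p1 ^ i.val * gen k lam mu alp p2 ^ j.val *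
          gen k lam mu alp q1 ^ r.val * gen k lam mu alp q2 ^ s.val)) from this hy'
    rw [Submodule.span_le]
    rintro _ ⟨n, rfl⟩
    refine Submodule.subset_span ⟨fun x => match x with
      | a => n.1 | b => n.2.1 | c => n.2.2.1 | d => n.2.2.2
      | p1 => i | p2 => j | q1 => r | q2 => s, ?_⟩
    rw [mono_eq]
    rfl
  suffices W ≤ W.comap (LinearMap.mulLeft k (gen k lam mu alp x)) from this hw
  conv_lhs => rw [hWdef]
  rw [Submodule.span_le]
  rintro _ ⟨m, rfl⟩
  have memm : gen k lam mu alp a ^ (m a).val * gen k lam mu alp b ^ (m b).val *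
      gen k lam mu alp c ^ (m c).val * gen k lam mu alp d ^ (m d).val ∈ H :=
    H.mul_mem (H.mul_mem (H.mul_mem (H.pow_mem mema _) (H.pow_mem memb _)) (H.pow_mem memc _))
      (H.pow_mem memd _)
  change gen k lam mu alp x * mono k lam mu alp m ∈ W
  rw [mono_eq]
  have p2c := commute_relators ap2 (commute_mul_of_anticommute bp2 cp2)
  have q1c := commute_relators aq1 (Commute.mul_left bq1 cq1)
  have q2c := commute_relators aq2 (commute_mul_of_anticommute bq2 cq2)
  have clifford := fun {x} hx =>
    clifford_mul_mem (lam := lam) (mu := mu) (alp := alp) (x := x) H W hW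
      (S := gen k lam mu alp a * gen k lam mu alp b * gen k lam mu alp c + gen k lam mu alp a - 2)
      (T := gen k lam mu alp a - gen k lam mu alp a * gen k lam mu alp b * gen k lam mu alp c)
      (Z := 1 - gen k lam mu alp b * gen k lam mu alp c)
      (H.sub_mem (H.add_mem (H.mul_mem (H.mul_mem mema memb) memc) mema) (H.natCast_mem 2))
      (H.sub_mem mema (H.mul_mem (H.mul_mem mema memb) memc))
      (H.sub_mem H.one_mem (H.mul_mem memb memc))
      p2c.1 q1c.1 q2c.1 q1c.2.1 q2c.2.1 p2c.2.2 q1c.2.2 q2c.2.2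
      p1p1 p2p2 q1q1 q2q2 (eq_neg_of_add_eq_zero_right p1p2) (eq_neg_of_add_eq_zero_right q1q2)
      (eq_sub_of_add_eq' p1q1) (eq_sub_of_add_eq' p2q2)
      (eq_neg_of_add_eq_zero_right p1q2) (eq_neg_of_add_eq_zero_right p2q1) hx
      (m p1) (m p2) (m q1) (m q2) memm
  cases x with
  | a =>
    exact group_mul_mem H W hW mema
      (.of_commute ap1) (.of_commute ap2) (.of_commute aq1) (.of_commute aq2) _ _ _ _ memm
  | b =>
    exact group_mul_mem H W hW memb
      (.of_commute bp1) (.of_anticommute bp2) (.of_commute bq1) (.of_anticommute bq2) _ _ _ _ memm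
  | c =>
    exact group_mul_mem H W hW memc
      (.of_commute cp1) (.of_anticommute cp2) (.of_commute cq1) (.of_anticommute cq2) _ _ _ _ memm
  | d =>
    exact group_mul_mem H W hW memd
      (.of_anticommute dp1) (.of_anticommute dp2) (.of_anticommute dq1) (.of_anticommute dq2)
      _ _ _ _ memm
  | p1 => exact clifford (by simp)
  | p2 => exact clifford (by simp)
  | q1 => exact clifford (by simp)
  | q2 => exact clifford (by simp)

theorem span_mono : Submodule.span k (Set.range (mono k lam mu alp)) = ⊤ := by
  set W := Submodule.span k (Set.range (mono k lam mu alp)) with hW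
  have h1 : (1 : U k lam mu alp) ∈ W := Submodule.subset_span ⟨0, by simp [mono]⟩
  have step (u : FreeAlgebra k Gen) : ∀ w ∈ W, mk k lam mu alp u * w ∈ W := by
    induction u using FreeAlgebra.induction with
    | grade0 t => exact fun w hw => by simpa [← Algebra.smul_def] using W.smul_mem t hw
    | grade1 x => exact fun w hw => gen_mul_mem k lam mu alp x hw
    | mul u v hu hv => exact fun w hw => by simpa only [map_mul, mul_assoc] using hu _ (hv w hw)
    | add u v hu hv =>
      exact fun w hw => by simpa only [map_add, add_mul] using W.add_mem (hu w hw) (hv w hw)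
  refine Submodule.eq_top_iff'.2 fun u => ?_
  obtain ⟨u, rfl⟩ := RingQuot.mkAlgHom_surjective k _ u
  simpa using step u 1 h1

end Spanning

/-- The eight generators, enumerated. -/
def genEquiv : Gen ≃ Fin 8 where
  toFun
    | a => 0 | b => 1 | c => 2 | d => 3 | p1 => 4 | p2 => 5 | q1 => 6 | q2 => 7
  invFun := ![a, b, c, d, p1, p2, q1, q2]
  left_inv x := by cases x <;> rfl
  right_inv n := by fin_cases n <;> rfl

theorem thm [IsAlgClosed k] [CharZero k] (lam mu alp : k) :
    Module.finrank k (U k lam mu alp) = 256 ∧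
    LinearIndependent k (mono k lam mu alp) ∧
    Submodule.span k (Set.range (mono k lam mu alp)) = ⊤ := by
  have hli := linearIndependent_mono k lam mu alp
  have hspan := span_mono k lam mu alp
  refine ⟨?_, hli, hspan⟩
  rw [Module.finrank_eq_nat_card_basis (Module.Basis.mk hli hspan.ge),
    Nat.card_congr (genEquiv.arrowCongr (Equiv.refl (Fin 2)))]
  simp

end Stmt15
end
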